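/- arXiv:2309.14249 — 3 statements merged into one kernel-verified Lean document; each statement's English description precedes it below -/
import Mathlib

section
/- For every 1 < p ≤ 2 there exists a constant C_p such that for every integer N ≥ 2 and every f : ℤ[i] → ℂ, ∥A_N f∥_{ℓ^{p'}(ℤ[i])} ≤ C_p · N^{1/p' − 1/p} · ∥f∥_{ℓ^p(ℤ[i])}, where 1/p + 1/p' = 1 and A_N f(x) = (1/N) Σ_{n ∈ ℤ[i], N(n) < N} Λ(n) f(x − n). -/
open Complex GaussianInt MeasureTheory
open scoped Real ENNReal

noncomputable section
attribute [local instance] Classical.propDecidable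

/-- The real inner product on `ℂ ≅ ℝ²`: `⟨z, w⟩ = Re z · Re w + Im z · Im w`. -/
def cip (z w : ℂ) : ℝ := z.re * w.re + z.im * w.im

/-- `e(t) = exp(2πit)`. -/
def e2 (t : ℝ) : ℂ := Complex.exp (2 * Real.pi * Complex.I * t)

/-- The fundamental box `B_q` of residues modulo `q`:
`B_q = {r : 0 ≤ ⟨r,q⟩ < N(q), 0 ≤ ⟨r,iq⟩ < N(q)}`. -/
def Bq (q : GaussianInt) : Set GaussianInt :=
  {r | 0 ≤ cip (toComplex r) (toComplex q) ∧
       cip (toComplex r) (toComplex q) < Complex.normSq (toComplex q) ∧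
       0 ≤ cip (toComplex r) (Complex.I * toComplex q) ∧
       cip (toComplex r) (Complex.I * toComplex q) < Complex.normSq (toComplex q)}

/-- `𝔸_q`, the reduced residues in `B_q` (gcd with `q` a unit). -/
def Aq (q : GaussianInt) : Set GaussianInt :=
  {r | r ∈ Bq q ∧ IsUnit (EuclideanDomain.gcd r q)}

/-- The Euler totient on `ℤ[i]`: `φ(q) = |𝔸_q|`. -/
def gphi (q : GaussianInt) : ℕ := Nat.card (Aq q)

/-- The Gaussian Ramanujan sum `τ_q(x) = Σ_{n ∈ 𝔸_q} e(⟨x, n/q⟩)`. -/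
def gtau (q x : GaussianInt) : ℂ :=
  ∑' n : Aq q, e2 (cip (toComplex x) (toComplex (n : GaussianInt) / toComplex q))

/-- The Möbius function on `ℤ[i]`: `(-1)^k` on squarefree numbers with `k`
pairwise non-associate prime factors (so `1` on units), and `0` otherwise. -/
def gmu (n : GaussianInt) : ℤ :=
  if n ≠ 0 ∧ Squarefree n then (-1) ^ (UniqueFactorizationMonoid.factors n).card else 0

/-- The von Mangoldt function on `ℤ[i]`: `Λ(n) = log N(ρ)` if `n` is a unit times
`ρ^k` for a Gaussian prime `ρ` and `k ≥ 1`, and `0` otherwise. -/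
def gvm (n : GaussianInt) : ℝ :=
  if h : ∃ ρ : GaussianInt, Irreducible ρ ∧
      ∃ k : ℕ, 1 ≤ k ∧ ∃ u : GaussianInt, IsUnit u ∧ n = u * ρ ^ k
  then Real.log (Complex.normSq (toComplex h.choose)) else 0

/-- `ω ⊆ 𝕋 = ℝ/2πℤ` is an interval (arc) of length `l`. -/
def IsArc (ω : Set Real.Angle) (l : ℝ) : Prop :=
  ∃ a : ℝ, ω = (fun θ : ℝ => (θ : Real.Angle)) '' Set.Ico a (a + l)

/-- `arg z ∈ ω`, as a condition in `𝕋`. -/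
def argIn (z : ℂ) (ω : Set Real.Angle) : Prop := (↑(Complex.arg z) : Real.Angle) ∈ ω

/-- The normalized sector average kernel `M_N^ω`. -/
def Msec (ω : Set Real.Angle) (l : ℝ) (N : ℕ) (n : GaussianInt) : ℝ :=
  if Zsqrtd.norm n < (N : ℤ) ∧ argIn (toComplex n) ω then 2 * Real.pi / (l * N) else 0

/-- The weighted sector average kernel `A_N^ω` (with von Mangoldt weights). -/
def Asec (ω : Set Real.Angle) (l : ℝ) (N : ℕ) (n : GaussianInt) : ℂ :=
  if Zsqrtd.norm n < (N : ℤ) ∧ argIn (toComplex n) ω then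
    ((2 * Real.pi / (l * N) : ℝ) : ℂ) * (gvm n : ℂ) else 0

/-- The canonical representative of a nonzero associate class in `ℤ[i]`. -/
def IsCanon (z : GaussianInt) : Prop := 0 < z.re ∧ 0 ≤ z.im

/-- `Φ(a, q) = τ_q(a)/φ(q)`. -/
def Phi (a q : GaussianInt) : ℂ := gtau q a / (gphi q : ℂ)

/-- `Â_N^ω(α)`: the Fourier transform of the weighted sector average. -/
def Ahat (ω : Set Real.Angle) (l : ℝ) (N : ℕ) (α : ℂ) : ℂ :=
  ((2 * Real.pi / (l * N) : ℝ) : ℂ) *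
    ∑' n : {m : GaussianInt // Zsqrtd.norm m < (N : ℤ) ∧ argIn (toComplex m) ω},
      (gvm (n : GaussianInt) : ℂ) * e2 (cip (toComplex (n : GaussianInt)) α)

/-- `M̂_N^ω(β)`: the Fourier transform of the sector average. -/
def Mhat (ω : Set Real.Angle) (l : ℝ) (N : ℕ) (β : ℂ) : ℂ :=
  ((2 * Real.pi / (l * N) : ℝ) : ℂ) *
    ∑' n : {m : GaussianInt // Zsqrtd.norm m < (N : ℤ) ∧ argIn (toComplex m) ω},
      e2 (cip (toComplex (n : GaussianInt)) β)

/-- The tensor Fejér-type bump `η(ξ₁+iξ₂) = (1-|ξ₁|)₊ (1-|ξ₂|)₊`. -/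
def eta (ξ : ℂ) : ℝ := max 0 (1 - |ξ.re|) * max 0 (1 - |ξ.im|)

/-- `Δ_s(ξ) = η(16^s ξ)`. -/
def Delta (s : ℕ) (ξ : ℂ) : ℝ := eta ((16 : ℂ) ^ s * ξ)

/-- `Δ̌_{q₀}(n) = ∫_{[-1/2,1/2)²} Δ_{q₀}(ξ) e(⟨n, ξ⟩) dξ`. -/
def DeltaCheck (q₀ : ℕ) (n : GaussianInt) : ℂ :=
  ∫ p in (Set.Ico (-(1:ℝ)/2) (1/2)) ×ˢ (Set.Ico (-(1:ℝ)/2) (1/2)),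
    ((Delta q₀ ((p.1 : ℂ) + (p.2 : ℂ) * Complex.I) : ℝ) : ℂ) *
      e2 (cip (toComplex n) ((p.1 : ℂ) + (p.2 : ℂ) * Complex.I))

/-- The Low part `Lo_{Q,N}^ω` with `Q = 2^{q₀}`. -/
def Lo (ω : Set Real.Angle) (l : ℝ) (N : ℕ) (q₀ : ℕ) (x : GaussianInt) : ℂ :=
  (∑' y : GaussianInt, ((Msec ω l N y : ℝ) : ℂ) * DeltaCheck q₀ (x - y)) *
    ∑' q : {q : GaussianInt // IsCanon q ∧ (Zsqrtd.norm q : ℝ) < 2 ^ q₀},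
      ∑' a : Aq (q : GaussianInt),
        Phi (a : GaussianInt) (star (q : GaussianInt)) *
          e2 (cip (toComplex x) (toComplex (a : GaussianInt) / toComplex (q : GaussianInt)))

/-- Distance from `β ∈ ℂ` to the nearest Gaussian integer. -/
def distZi (β : ℂ) : ℝ := Metric.infDist β (Set.range fun n : GaussianInt => toComplex n)

/-- `q` is `Q`-smooth: squarefree with all prime factors of norm at most `Q`. -/
def QSmooth (Q : ℝ) (q : GaussianInt) : Prop :=
  Squarefree q ∧ ∀ ρ : GaussianInt, Irreducible ρ → ρ ∣ q → (Zsqrtd.norm ρ : ℝ) ≤ Q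


/-- The prime average `A_N f(x) = (1/N) Σ_{N(n)<N} Λ(n) f(x-n)`. -/
def AvN (N : ℕ) (f : GaussianInt → ℂ) (x : GaussianInt) : ℂ :=
  (1 / (N : ℂ)) * ∑' n : GaussianInt,
    if Zsqrtd.norm n < (N : ℤ) then (gvm n : ℂ) * f (x - n) else 0

/-- The norm of a Gaussian integer, as a real number. -/
def gn (z : GaussianInt) : ℝ := (Zsqrtd.norm z : ℝ)

lemma gn_eq (z : GaussianInt) : gn z = (z.re : ℝ) ^ 2 + (z.im : ℝ) ^ 2 := by
  simp only [gn, Zsqrtd.norm_def]; push_cast; ring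

lemma gn_mul (z w : GaussianInt) : gn (z * w) = gn z * gn w := by
  simp [gn, Zsqrtd.norm_mul]

lemma gn_one : gn 1 = 1 := by simp [gn]

lemma gn_prod (T : Finset GaussianInt) : gn (∏ P ∈ T, P) = ∏ P ∈ T, gn P := by
  induction T using Finset.induction_on with
  | empty => simp [gn_one]
  | insert a s ha ih => rw [Finset.prod_insert ha, Finset.prod_insert ha, gn_mul, ih]

lemma gn_pow (z : GaussianInt) (n : ℕ) : gn (z ^ n) = gn z ^ n := by
  induction n with
  | zero => simp [gn_one]
  | succ n ih => rw [pow_succ, gn_mul, ih, pow_succ]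

lemma one_le_gn {z : GaussianInt} (hz : z ≠ 0) : 1 ≤ gn z := by
  have h : 0 < Zsqrtd.norm z := GaussianInt.norm_pos.2 hz
  unfold gn; exact_mod_cast h

lemma gn_pos {z : GaussianInt} (hz : z ≠ 0) : 0 < gn z := by linarith [one_le_gn hz]

lemma gn_nonneg (z : GaussianInt) : 0 ≤ gn z := by rw [gn_eq]; positivity

lemma gn_unit {z : GaussianInt} (hz : IsUnit z) : gn z = 1 := by
  obtain ⟨w, hw⟩ := isUnit_iff_exists_inv.1 hz
  have h := gn_mul z w
  rw [hw, gn_one] at h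
  have hz0 : z ≠ 0 := hz.ne_zero
  have hw0 : w ≠ 0 := by rintro rfl; simp at hw
  nlinarith [one_le_gn hz0, one_le_gn hw0]

lemma two_le_gn {z : GaussianInt} (h0 : z ≠ 0) (hz : ¬ IsUnit z) : 2 ≤ gn z := by
  have h : 0 < Zsqrtd.norm z := GaussianInt.norm_pos.2 h0
  have h1 : Zsqrtd.norm z ≠ 1 := fun h1 => hz ((Zsqrtd.norm_eq_one_iff).1 (by simp [h1]))
  have h2 : 2 ≤ Zsqrtd.norm z := by omega
  unfold gn; exact_mod_cast h2

lemma gn_associated {z w : GaussianInt} (h : Associated z w) : gn z = gn w := by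
  obtain ⟨u, rfl⟩ := h
  rw [gn_mul, gn_unit u.isUnit, mul_one]

/-- `f` is periodic modulo the ideal generated by `m`. -/
def GPer (m : GaussianInt) (f : GaussianInt → ℝ) : Prop := ∀ x t, f (x + m * t) = f x

lemma GPer.of_dvd {m n : GaussianInt} {f : GaussianInt → ℝ} (h : GPer m f) (hd : m ∣ n) :
    GPer n f := by
  obtain ⟨c, rfl⟩ := hd
  intro x t
  rw [mul_assoc]; exact h x _

lemma GPer.mul {m : GaussianInt} {f g : GaussianInt → ℝ} (hf : GPer m f) (hg : GPer m g) :
    GPer m (fun x => f x * g x) := fun x t => by simp only [hf x t, hg x t]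

/-- The sum of `f` over a square of side `m` with lower left corner `c`. -/
def boxSum (m : ℕ) (c : GaussianInt) (f : GaussianInt → ℝ) : ℝ :=
  ∑ i ∈ Finset.range m, ∑ j ∈ Finset.range m, f (c + ⟨(i : ℤ), (j : ℤ)⟩)

lemma sum_range_shift (m : ℕ) (g : ℤ → ℝ) (hg : ∀ x, g (x + m) = g x) (a : ℤ) :
    ∑ i ∈ Finset.range m, g (a + i) = ∑ i ∈ Finset.range m, g i := by
  have step : ∀ a : ℤ, ∑ i ∈ Finset.range m, g (a + 1 + i) = ∑ i ∈ Finset.range m, g (a + i) := by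
    intro a
    have h1 := Finset.sum_range_succ (fun i : ℕ => g (a + i)) m
    have h2 := Finset.sum_range_succ' (fun i : ℕ => g (a + i)) m
    rw [h1] at h2
    have h3 := hg a
    push_cast at h2
    rw [h3] at h2
    simp only [add_zero] at h2
    have h4 := add_right_cancel h2
    rw [h4]
    refine Finset.sum_congr rfl fun i _ => ?_
    congr 1; ring
  induction a using Int.induction_on with
  | zero => simp
  | succ n ih => rw [step, ih]
  | pred n ih => rw [← ih, ← step]; simp

lemma boxSum_shift {m : ℕ} {f : GaussianInt → ℝ} (hf : GPer m f) (c : GaussianInt) :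
    boxSum m c f = boxSum m 0 f := by
  unfold boxSum
  have e1 : ∀ (u v : ℤ), f ⟨u, v + m⟩ = f ⟨u, v⟩ := by
    intro u v
    rw [← hf ⟨u, v⟩ ⟨0, 1⟩]
    congr 1
    ext <;> simp
  have e2 : ∀ (u v : ℤ), f ⟨u + m, v⟩ = f ⟨u, v⟩ := by
    intro u v
    rw [← hf ⟨u, v⟩ ⟨1, 0⟩]
    congr 1
    ext <;> simp
  have h1 : ∀ i j : ℕ, f (c + ⟨(i : ℤ), (j : ℤ)⟩) = f ⟨c.re + i, c.im + j⟩ := by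
    intro i j; congr 1
  have h2 : ∀ i j : ℕ, f (0 + ⟨(i : ℤ), (j : ℤ)⟩) = f ⟨i, j⟩ := by
    intro i j; congr 1; simp
  simp only [h1, h2]
  have h3 : ∀ u : ℤ, ∑ j ∈ Finset.range m, f ⟨u, c.im + j⟩ = ∑ j ∈ Finset.range m, f ⟨u, j⟩ :=
    fun u => sum_range_shift m (fun v => f ⟨u, v⟩) (e1 u) c.im
  simp only [h3]
  exact sum_range_shift m (fun u => ∑ j ∈ Finset.range m, f ⟨u, j⟩)
    (fun u => Finset.sum_congr rfl fun j _ => e2 u j) c.re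

lemma sum_range_mul_shift (q m : ℕ) (g : ℤ → ℝ) (hg : ∀ x, g (x + m) = g x) :
    ∑ i ∈ Finset.range (q * m), g i = q * ∑ i ∈ Finset.range m, g i := by
  induction q with
  | zero => simp
  | succ q ih =>
    rw [add_mul, one_mul, Finset.sum_range_add, ih]
    have := sum_range_shift m g hg ((q * m : ℕ) : ℤ)
    push_cast at this ⊢
    rw [this]; ring

lemma boxSum_mul {m : ℕ} {f : GaussianInt → ℝ} (hf : GPer m f) (q : ℕ) :
    boxSum (q * m) 0 f = (q : ℝ) ^ 2 * boxSum m 0 f := by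
  unfold boxSum
  have e1 : ∀ (u v : ℤ), f ⟨u, v + m⟩ = f ⟨u, v⟩ := by
    intro u v
    rw [← hf ⟨u, v⟩ ⟨0, 1⟩]
    congr 1
    ext <;> simp
  have e2 : ∀ (u v : ℤ), f ⟨u + m, v⟩ = f ⟨u, v⟩ := by
    intro u v
    rw [← hf ⟨u, v⟩ ⟨1, 0⟩]
    congr 1
    ext <;> simp
  simp only [zero_add]
  have h3 : ∀ u : ℤ, ∑ j ∈ Finset.range (q * m), f ⟨u, j⟩ = q * ∑ j ∈ Finset.range m, f ⟨u, j⟩ :=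
    fun u => sum_range_mul_shift q m (fun v => f ⟨u, v⟩) (e1 u)
  simp only [h3]
  rw [← Finset.mul_sum, sum_range_mul_shift q m (fun u => ∑ j ∈ Finset.range m, f ⟨u, j⟩)
    (fun u => Finset.sum_congr rfl fun j _ => e2 u j)]
  ring

lemma GPer.shift {m : GaussianInt} {f : GaussianInt → ℝ} (hf : GPer m f) (c : GaussianInt) :
    GPer m (fun x => f (x + c)) := fun x t => by
  change f (x + m * t + c) = f (x + c)
  rw [← hf (x + c) t]; congr 1; ring

lemma boxSum_corner (m : ℕ) (c : GaussianInt) (f : GaussianInt → ℝ) :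
    boxSum m c f = boxSum m 0 (fun x => f (x + c)) := by
  unfold boxSum
  refine Finset.sum_congr rfl fun i _ => Finset.sum_congr rfl fun j _ => ?_
  congr 1; ring

lemma boxSum_mul_corner {m : ℕ} {f : GaussianInt → ℝ} (hf : GPer m f) (q : ℕ) (c : GaussianInt) :
    boxSum (q * m) c f = (q : ℝ) ^ 2 * boxSum m 0 f := by
  rw [boxSum_corner, boxSum_mul (hf.shift c), ← boxSum_corner, boxSum_shift hf]

lemma boxSum_eq_prod (m : ℕ) (c : GaussianInt) (f : GaussianInt → ℝ) :
    boxSum m c f = ∑ x ∈ Finset.range m ×ˢ Finset.range m, f (c + ⟨(x.1 : ℤ), (x.2 : ℤ)⟩) := by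
  unfold boxSum; rw [Finset.sum_product]

lemma boxSum_mono_side {m L : ℕ} (h : m ≤ L) {c : GaussianInt} {f : GaussianInt → ℝ}
    (hf : ∀ x, 0 ≤ f x) : boxSum m c f ≤ boxSum L c f := by
  rw [boxSum_eq_prod, boxSum_eq_prod]
  refine Finset.sum_le_sum_of_subset_of_nonneg ?_ fun _ _ _ => hf _
  exact Finset.product_subset_product (Finset.range_mono h) (Finset.range_mono h)

lemma boxSum_side_diff {m L : ℕ} (h : m ≤ L) {c : GaussianInt} {f : GaussianInt → ℝ}
    (hf : ∀ x, |f x| ≤ 1) : |boxSum L c f - boxSum m c f| ≤ (L : ℝ) ^ 2 - (m : ℝ) ^ 2 := by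
  rw [boxSum_eq_prod, boxSum_eq_prod]
  have hs : Finset.range m ×ˢ Finset.range m ⊆ Finset.range L ×ˢ Finset.range L :=
    Finset.product_subset_product (Finset.range_mono h) (Finset.range_mono h)
  rw [← Finset.sum_sdiff hs, add_sub_cancel_right]
  refine (Finset.abs_sum_le_sum_abs _ _).trans ((Finset.sum_le_card_nsmul _ _ 1
    fun x _ => hf _).trans ?_)
  rw [nsmul_eq_mul, mul_one, Finset.cast_card_sdiff hs]
  simp [sq]

lemma abs_boxSum_le_of_zero {m L : ℕ} (hm : 0 < m) {c : GaussianInt}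
    {f : GaussianInt → ℝ} (hf : ∀ x, |f x| ≤ 1) (hp : GPer m f) (h0 : boxSum m 0 f = 0) :
    |boxSum L c f| ≤ 2 * L * m := by
  have hq : L / m * m ≤ L := Nat.div_mul_le_self L m
  have h1 := boxSum_side_diff hq (c := c) hf
  rw [boxSum_mul_corner hp, h0, mul_zero, sub_zero] at h1
  refine h1.trans ?_
  have h2 : L ≤ L / m * m + m := by
    have := Nat.div_add_mod L m
    have := Nat.mod_lt L hm
    nlinarith
  have h2' : (L : ℝ) ≤ ((L / m * m : ℕ) : ℝ) + m := by exact_mod_cast h2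
  have hq' : ((L / m * m : ℕ) : ℝ) ≤ L := by exact_mod_cast hq
  have h3 : (0 : ℝ) ≤ ((L / m * m : ℕ) : ℝ) := Nat.cast_nonneg _
  nlinarith

lemma boxSum_le_of_nonneg {m L : ℕ} (hm : 0 < m) (h : m ≤ L) {c : GaussianInt}
    {f : GaussianInt → ℝ} (hf : ∀ x, 0 ≤ f x) (hp : GPer m f) :
    boxSum L c f ≤ 4 * (L : ℝ) ^ 2 * (boxSum m 0 f / (m : ℝ) ^ 2) := by
  have h2 : L ≤ (L / m + 1) * m := by
    have := Nat.div_add_mod L m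
    have := Nat.mod_lt L hm
    nlinarith
  refine (boxSum_mono_side h2 hf).trans ?_
  rw [boxSum_mul_corner hp]
  have hS : 0 ≤ boxSum m 0 f := by
    unfold boxSum; exact Finset.sum_nonneg fun _ _ => Finset.sum_nonneg fun _ _ => hf _
  have hm' : (0 : ℝ) < m := by exact_mod_cast hm
  rw [mul_div_assoc', le_div_iff₀ (by positivity)]
  have h3 : (L / m + 1) * m ≤ 2 * L := by
    have := Nat.div_mul_le_self L m
    nlinarith
  have h3' : ((L / m + 1 : ℕ) : ℝ) * m ≤ 2 * L := by exact_mod_cast h3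
  have h4 : (((L / m + 1 : ℕ) : ℝ) * m) ^ 2 ≤ (2 * (L : ℝ)) ^ 2 :=
    pow_le_pow_left₀ (by positivity) h3' 2
  nlinarith

/-- The mean of `f` over a square of side `M`. -/
def gmean (M : ℕ) (f : GaussianInt → ℝ) : ℝ := boxSum M 0 f / (M : ℝ) ^ 2

lemma boxSum_add (m : ℕ) (c : GaussianInt) (f g : GaussianInt → ℝ) :
    boxSum m c (fun x => f x + g x) = boxSum m c f + boxSum m c g := by
  simp [boxSum, Finset.sum_add_distrib]

lemma boxSum_const_mul (m : ℕ) (c : GaussianInt) (a : ℝ) (f : GaussianInt → ℝ) :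
    boxSum m c (fun x => a * f x) = a * boxSum m c f := by
  simp [boxSum, Finset.mul_sum]

lemma boxSum_const (m : ℕ) (c : GaussianInt) (a : ℝ) :
    boxSum m c (fun _ => a) = (m : ℝ) ^ 2 * a := by
  simp [boxSum]; ring

lemma boxSum_sum {ι : Type*} (s : Finset ι) (m : ℕ) (c : GaussianInt) (f : ι → GaussianInt → ℝ) :
    boxSum m c (fun x => ∑ i ∈ s, f i x) = ∑ i ∈ s, boxSum m c (f i) := by
  simp only [boxSum_eq_prod]
  rw [Finset.sum_comm]

lemma boxSum_comm (m : ℕ) (c d : GaussianInt) (f : GaussianInt → GaussianInt → ℝ) :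
    boxSum m c (fun x => boxSum m d (fun y => f x y)) =
      boxSum m d (fun y => boxSum m c (fun x => f x y)) := by
  simp only [boxSum_eq_prod]
  rw [Finset.sum_comm]

lemma gmean_shift {M : ℕ} {f : GaussianInt → ℝ} (hf : GPer M f) (c : GaussianInt) :
    gmean M (fun x => f (x + c)) = gmean M f := by
  unfold gmean; rw [← boxSum_corner, boxSum_shift hf]

lemma gmean_const {M : ℕ} (hM : 0 < M) (a : ℝ) : gmean M (fun _ => a) = a := by
  unfold gmean
  have : (M : ℝ) ≠ 0 := by positivity
  rw [boxSum_const]; field_simp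

lemma gmean_mul_of_coprime {M : ℕ} (hM : 0 < M) {P e : GaussianInt} (hP : P ∣ M) (he : e ∣ M)
    (hc : IsCoprime P e) {u v : GaussianInt → ℝ} (hu : GPer P u) (hv : GPer e v) :
    gmean M (fun x => u x * v x) = gmean M u * gmean M v := by
  have huM := hu.of_dvd hP
  have hvM := hv.of_dvd he
  obtain ⟨a, b, hab⟩ := hc
  have hM' : (M : ℝ) ≠ 0 := by positivity
  have key : ∀ x, boxSum M 0 (fun t => u (x + e * t)) = boxSum M 0 (fun t => u (e * t)) := by
    intro x
    have hper : GPer M (fun t => u (e * t)) := by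
      intro y t
      change u (e * (y + M * t)) = u (e * y)
      rw [← huM (e * y) (e * t)]; congr 1; ring
    rw [← boxSum_shift hper (b * x), boxSum_corner M (b * x)]
    congr 1; funext t
    rw [← hu (e * (t + b * x)) (a * x)]
    congr 1
    linear_combination (-x) * hab
  have hconst : (M : ℝ) ^ 2 * boxSum M 0 (fun t => u (e * t)) = (M : ℝ) ^ 2 * boxSum M 0 u := by
    rw [← boxSum_const M 0, ← boxSum_const M 0]
    calc boxSum M 0 (fun _ => boxSum M 0 (fun t => u (e * t)))
        = boxSum M 0 (fun x => boxSum M 0 (fun t => u (x + e * t))) := by simp only [key]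
      _ = boxSum M 0 (fun t => boxSum M 0 (fun x => u (x + e * t))) := boxSum_comm _ _ _ _
      _ = _ := by
        congr 1; funext t
        rw [← boxSum_corner, boxSum_shift huM]
  have hconst' := mul_left_cancel₀ (pow_ne_zero 2 hM') hconst
  have main : (M : ℝ) ^ 2 * boxSum M 0 (fun x => u x * v x) = boxSum M 0 u * boxSum M 0 v := by
    calc (M : ℝ) ^ 2 * boxSum M 0 (fun x => u x * v x)
        = boxSum M 0 (fun t => boxSum M 0 (fun x => u x * v x)) := by rw [boxSum_const]
      _ = boxSum M 0 (fun t => boxSum M 0 (fun x => u (x + e * t) * v x)) := by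
        congr 1; funext t
        rw [← boxSum_shift (huM.mul hvM) (e * t), boxSum_corner]
        simp only [hv _ t]
      _ = boxSum M 0 (fun x => boxSum M 0 (fun t => u (x + e * t) * v x)) := boxSum_comm _ _ _ _
      _ = boxSum M 0 (fun x => boxSum M 0 u * v x) := by
        congr 1; funext x
        rw [← hconst', ← key x, mul_comm _ (v x), ← boxSum_const_mul]
        simp only [mul_comm]
      _ = _ := boxSum_const_mul _ _ _ _
  unfold gmean
  field_simp
  linarith

lemma gmean_prod {M : ℕ} (hM : 0 < M) (U : Finset GaussianInt) (hU : (∏ P ∈ U, P) ∣ (M : GaussianInt))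
    (hc : ∀ P ∈ U, ∀ Q ∈ U, P ≠ Q → IsCoprime P Q) (u : GaussianInt → GaussianInt → ℝ)
    (hu : ∀ P ∈ U, GPer P (u P)) :
    gmean M (fun x => ∏ P ∈ U, u P x) = ∏ P ∈ U, gmean M (u P) := by
  induction U using Finset.induction_on with
  | empty => simp [gmean_const hM]
  | insert a s ha ih =>
    simp only [Finset.prod_insert ha] at hU ⊢
    have hps : GPer (∏ P ∈ s, P) (fun x => ∏ P ∈ s, u P x) := by
      intro x t
      refine Finset.prod_congr rfl fun P hP => ?_
      exact ((hu P (Finset.mem_insert_of_mem hP)).of_dvd (Finset.dvd_prod_of_mem _ hP)) x t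
    rw [gmean_mul_of_coprime hM ((Dvd.intro _ rfl).trans hU) ((Dvd.intro_left _ rfl).trans hU) ?_
      (hu a (Finset.mem_insert_self _ _)) hps]
    · rw [ih ((Dvd.intro_left _ rfl).trans hU)
        (fun P hP Q hQ => hc P (Finset.mem_insert_of_mem hP) Q (Finset.mem_insert_of_mem hQ))
        (fun P hP => hu P (Finset.mem_insert_of_mem hP))]
    · refine IsCoprime.prod_right fun Q hQ => ?_
      refine hc a (Finset.mem_insert_self _ _) Q (Finset.mem_insert_of_mem hQ) ?_
      rintro rfl; exact ha hQ

/-- The ℤ-basis `1, i` of the Gaussian integers. -/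
def gaussBasis : Module.Basis (Fin 2) ℤ GaussianInt :=
  Module.Basis.ofEquivFun
    { toFun := fun z => ![z.re, z.im]
      invFun := fun v => ⟨v 0, v 1⟩
      left_inv := fun z => by ext <;> simp
      right_inv := fun v => by ext i; fin_cases i <;> simp
      map_add' := fun z w => by ext i; fin_cases i <;> simp
      map_smul' := fun a z => by ext i; fin_cases i <;> simp }

lemma algebra_norm_eq (z : GaussianInt) : Algebra.norm ℤ z = Zsqrtd.norm z := by
  rw [Algebra.norm_eq_matrix_det gaussBasis, Matrix.det_fin_two]
  have h0 : gaussBasis 0 = 1 := by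
    rw [gaussBasis, Module.Basis.coe_ofEquivFun]
    exact (LinearEquiv.symm_apply_eq _).2 (by ext i; fin_cases i <;> simp)
  have h1 : gaussBasis 1 = ⟨0, 1⟩ := by
    rw [gaussBasis, Module.Basis.coe_ofEquivFun]
    exact (LinearEquiv.symm_apply_eq _).2 (by ext i; fin_cases i <;> simp)
  have h2 : ∀ w i, gaussBasis.repr w i = ![w.re, w.im] i := fun w i => rfl
  simp only [Algebra.leftMulMatrix_eq_repr_mul, h0, h1, h2, Zsqrtd.norm_def]
  simp

instance : Module.Free ℤ GaussianInt := Module.Free.of_basis gaussBasis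
instance : Module.Finite ℤ GaussianInt := Module.Finite.of_basis gaussBasis

lemma card_quot_span {P : GaussianInt} :
    (Nat.card (GaussianInt ⧸ Ideal.span {P}) : ℝ) = gn P := by
  have h := Ideal.absNorm_span_singleton P
  rw [algebra_norm_eq, Ideal.absNorm_apply, Submodule.cardQuot_apply] at h
  have h2 : ((Zsqrtd.norm P).natAbs : ℤ) = Zsqrtd.norm P := GaussianInt.abs_natCast_norm P
  unfold gn
  rw [← h2, ← h]
  norm_cast

lemma finite_quot_span {P : GaussianInt} (hP : P ≠ 0) :
    Finite (GaussianInt ⧸ Ideal.span {P}) := by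
  refine Nat.finite_of_card_ne_zero fun h => ?_
  have := card_quot_span (P := P)
  rw [h] at this
  have := gn_pos hP
  simp_all

lemma gper_dvd (P c : GaussianInt) : GPer P (fun x => if P ∣ x - c then 1 else 0) := by
  intro x t
  have : P ∣ x + P * t - c ↔ P ∣ x - c := by
    rw [show x + P * t - c = (x - c) + P * t by ring]
    exact dvd_add_left (Dvd.intro _ rfl)
  simp only [this]

lemma gmean_dvd {M : ℕ} (hM : 0 < M) {P : GaussianInt} (hP0 : P ≠ 0) (hP : P ∣ M)
    (c : GaussianInt) : gmean M (fun x => if P ∣ x - c then 1 else 0) = 1 / gn P := by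
  have := finite_quot_span hP0
  have := Fintype.ofFinite (GaussianInt ⧸ Ideal.span {P})
  have h0 : ∀ c, gmean M (fun x => if P ∣ x - c then 1 else 0) =
      gmean M (fun x => if P ∣ x - 0 then 1 else 0) := by
    intro c
    rw [← gmean_shift ((gper_dvd P 0).of_dvd hP) (-c)]
    simp [sub_eq_add_neg]
  rw [h0, eq_div_iff (gn_pos hP0).ne', ← card_quot_span]
  have h1 : ∀ x : GaussianInt, (1 : ℝ) = ∑ q : GaussianInt ⧸ Ideal.span {P},
      if P ∣ x - Quotient.out q then 1 else 0 := by
    intro x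
    rw [Finset.sum_eq_single (Ideal.Quotient.mk (Ideal.span {P}) x)]
    · rw [if_pos]
      rw [← Ideal.mem_span_singleton, ← Ideal.Quotient.eq]
      exact (Quotient.out_eq (Ideal.Quotient.mk (Ideal.span {P}) x)).symm
    · intro q _ hq
      rw [if_neg]
      rw [← Ideal.mem_span_singleton, ← Ideal.Quotient.eq]
      intro h; apply hq
      rw [h]; exact (Quotient.out_eq q).symm
    · simp
  have h2 := gmean_const hM (1 : ℝ)
  rw [show (fun _ : GaussianInt => (1 : ℝ)) = fun x => ∑ q : GaussianInt ⧸ Ideal.span {P},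
      if P ∣ x - Quotient.out q then 1 else 0 from funext h1] at h2
  have h3 : ∀ c, boxSum M 0 (fun x => if P ∣ x - c then 1 else 0) / (M : ℝ) ^ 2 =
      gmean M (fun x => if P ∣ x - 0 then 1 else 0) := h0
  unfold gmean at h2
  rw [boxSum_sum, Finset.sum_div, Finset.sum_congr rfl fun q _ => h3 _] at h2
  simp only [Finset.sum_const, nsmul_eq_mul, Finset.card_univ] at h2
  rw [Nat.card_eq_fintype_card, mul_comm]; exact h2

lemma one_le_prod_real {ι : Type*} {s : Finset ι} {f : ι → ℝ} (h : ∀ i ∈ s, 1 ≤ f i) :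
    1 ≤ ∏ i ∈ s, f i := by
  have := Finset.prod_le_prod (s := s) (f := fun _ => (1 : ℝ)) (fun _ _ => zero_le_one) h
  simpa using this

lemma natAbs_norm_cast (z : GaussianInt) : ((Zsqrtd.norm z).natAbs : ℝ) = gn z := by
  exact GaussianInt.natCast_natAbs_norm z

lemma dvd_natAbs_norm (z : GaussianInt) : z ∣ (((Zsqrtd.norm z).natAbs : ℕ) : GaussianInt) := by
  refine ⟨star z, ?_⟩
  rw [← Zsqrtd.norm_eq_mul_conj]
  exact GaussianInt.natCast_natAbs_norm z

/-- The local factor in the Selberg sieve excluding the residues of `y i` modulo `P`. -/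
def sphi {k : ℕ} (y : Fin k → GaussianInt) (P x : GaussianInt) : ℝ :=
  if ∃ i, P ∣ x - y i then -1 else k / (gn P - k)

lemma gper_sphi {k : ℕ} (y : Fin k → GaussianInt) (P : GaussianInt) : GPer P (sphi y P) := by
  intro x t
  have : ∀ c, P ∣ x + P * t - c ↔ P ∣ x - c := by
    intro c
    rw [show x + P * t - c = (x - c) + P * t by ring]
    exact dvd_add_left (Dvd.intro _ rfl)
  simp only [sphi, this]

lemma sum_indicator_dvd {k : ℕ} {y : Fin k → GaussianInt} {P : GaussianInt}
    (hP : ∀ i j, i ≠ j → ¬ P ∣ y i - y j) (x : GaussianInt) :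
    (∑ i, if P ∣ x - y i then (1 : ℝ) else 0) = if ∃ i, P ∣ x - y i then 1 else 0 := by
  split_ifs with h
  · obtain ⟨i, hi⟩ := h
    rw [Finset.sum_eq_single i, if_pos hi]
    · intro j _ hj
      rw [if_neg]
      intro hj'
      refine hP i j hj.symm ?_
      have := dvd_sub hj' hi
      rwa [show x - y j - (x - y i) = y i - y j by ring] at this
    · simp
  · refine Finset.sum_eq_zero fun i _ => if_neg fun hi => h ⟨i, hi⟩

lemma gmean_lin {M : ℕ} (hM : 0 < M) {k : ℕ} (y : Fin k → GaussianInt) {P : GaussianInt}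
    (hP0 : P ≠ 0) (hPM : P ∣ M) (hP : ∀ i j, i ≠ j → ¬ P ∣ y i - y j) (a b : ℝ) :
    gmean M (fun x => if ∃ i, P ∣ x - y i then a else b) = b + (a - b) * (k / gn P) := by
  have h1 : (fun x => if ∃ i, P ∣ x - y i then a else b) =
      fun x => b + (a - b) * ∑ i, if P ∣ x - y i then (1 : ℝ) else 0 := by
    funext x
    rw [sum_indicator_dvd hP]
    split_ifs <;> ring
  rw [h1, gmean, boxSum_add, boxSum_const_mul, boxSum_sum, add_div, mul_div_assoc, Finset.sum_div]
  have h2 := gmean_const hM b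
  unfold gmean at h2
  rw [h2]
  have h3 : ∀ i, boxSum M 0 (fun x => if P ∣ x - y i then 1 else 0) / (M : ℝ) ^ 2 = 1 / gn P :=
    fun i => gmean_dvd hM hP0 hPM (y i)
  simp only [h3]
  simp
  left; rfl

/-- `P` is usable for sieving by the residues of `y`. -/
def GoodPrime {k : ℕ} (y : Fin k → GaussianInt) (P : GaussianInt) : Prop :=
  P ≠ 0 ∧ 2 * (k : ℝ) ≤ gn P ∧ ∀ i j, i ≠ j → ¬ P ∣ y i - y j

section
variable {k : ℕ} {y : Fin k → GaussianInt} {P : GaussianInt}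

lemma GoodPrime.sub_pos (h : GoodPrime y P) : 0 < gn P - k := by
  have h1 := one_le_gn h.1
  have h2 := h.2.1
  rcases Nat.eq_zero_or_pos k with rfl | hk
  · simp; linarith
  · have : (0 : ℝ) < k := by exact_mod_cast hk
    linarith

lemma gmean_sphi {M : ℕ} (hM : 0 < M) (h : GoodPrime y P) (hPM : P ∣ M) :
    gmean M (sphi y P) = 0 := by
  have := gmean_lin hM y h.1 hPM h.2.2 (-1) (k / (gn P - k))
  change gmean M (fun x => _) = 0
  simp only [sphi]
  rw [this]
  have h1 := h.sub_pos.ne'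
  have h2 := (gn_pos h.1).ne'
  field_simp
  ring

lemma gmean_sphi_sq {M : ℕ} (hM : 0 < M) (h : GoodPrime y P) (hPM : P ∣ M) :
    gmean M (fun x => sphi y P x * sphi y P x) = k / (gn P - k) := by
  have := gmean_lin hM y h.1 hPM h.2.2 1 ((k / (gn P - k)) ^ 2)
  have e : (fun x => sphi y P x * sphi y P x) =
      fun x => if ∃ i, P ∣ x - y i then 1 else (k / (gn P - k)) ^ 2 := by
    funext x
    unfold sphi
    split_ifs <;> ring
  rw [e, this]
  have h1 := h.sub_pos.ne'
  have h2 := (gn_pos h.1).ne'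
  field_simp
  ring

lemma GoodPrime.h_nonneg (h : GoodPrime y P) : 0 ≤ k / (gn P - k) :=
  div_nonneg (Nat.cast_nonneg _) h.sub_pos.le

lemma abs_sphi_le (h : GoodPrime y P) (x : GaussianInt) : |sphi y P x| ≤ 1 := by
  unfold sphi
  split_ifs
  · simp
  · rw [abs_of_nonneg h.h_nonneg, div_le_one h.sub_pos]
    linarith [h.2.1]

end

/-- The sets of primes from `S` whose product has norm at most `R`. -/
def lowSets (S : Finset GaussianInt) (R : ℝ) : Finset (Finset GaussianInt) :=
  S.powerset.filter fun T => gn (∏ P ∈ T, P) ≤ R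

lemma mem_lowSets {S T : Finset GaussianInt} {R : ℝ} :
    T ∈ lowSets S R ↔ T ⊆ S ∧ gn (∏ P ∈ T, P) ≤ R := by simp [lowSets]

/-- The main sum in the Selberg sieve. -/
def selG (k : ℕ) (S : Finset GaussianInt) (R : ℝ) : ℝ :=
  ∑ T ∈ lowSets S R, ∏ P ∈ T, (k / (gn P - k) : ℝ)

lemma pair_prod {T T' : Finset GaussianInt} (f : GaussianInt → ℝ) :
    (∏ P ∈ T, f P) * ∏ P ∈ T', f P =
      ∏ P ∈ T ∪ T', ((if P ∈ T then f P else 1) * if P ∈ T' then f P else 1) := by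
  rw [Finset.prod_mul_distrib, Finset.prod_ite_mem, Finset.prod_ite_mem,
    Finset.union_inter_cancel_left, Finset.union_inter_cancel_right]

lemma prod_sphi_gper {k : ℕ} (y : Fin k → GaussianInt) (T : Finset GaussianInt) :
    GPer (∏ P ∈ T, P) (fun x => ∏ P ∈ T, sphi y P x) := fun x t =>
  Finset.prod_congr rfl fun P hP => (gper_sphi y P).of_dvd (Finset.dvd_prod_of_mem _ hP) x t

lemma gmean_pair {k : ℕ} {y : Fin k → GaussianInt} {S : Finset GaussianInt}
    (hS : ∀ P ∈ S, GoodPrime y P) (hc : ∀ P ∈ S, ∀ Q ∈ S, P ≠ Q → IsCoprime P Q)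
    {T T' : Finset GaussianInt} (hT : T ⊆ S) (hT' : T' ⊆ S) {M : ℕ} (hM : 0 < M)
    (hd : (∏ P ∈ T, P) * ∏ P ∈ T', P ∣ (M : GaussianInt)) :
    gmean M (fun x => (∏ P ∈ T, sphi y P x) * ∏ P ∈ T', sphi y P x) =
      if T = T' then ∏ P ∈ T, (k / (gn P - k) : ℝ) else 0 := by
  have hU : T ∪ T' ⊆ S := Finset.union_subset hT hT'
  have hd' : (∏ P ∈ T ∪ T', P) ∣ (M : GaussianInt) :=
    (Dvd.intro _ (Finset.prod_union_inter (s₁ := T) (s₂ := T') (f := fun P => P))).trans hd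
  simp only [pair_prod (fun P => sphi y P _)]
  rw [gmean_prod hM (T ∪ T') hd' (fun P hP Q hQ => hc P (hU hP) Q (hU hQ))
    (fun P x => (if P ∈ T then sphi y P x else 1) * if P ∈ T' then sphi y P x else 1)]
  · split_ifs with h
    · subst h
      rw [Finset.union_self]
      refine Finset.prod_congr rfl fun P hP => ?_
      simp only [hP, if_true]
      exact gmean_sphi_sq hM (hS P (hT hP))
        ((Finset.dvd_prod_of_mem _ (Finset.mem_union_left _ hP)).trans hd')
    · obtain ⟨P, hP⟩ : (symmDiff T T').Nonempty := by
        rwa [Finset.symmDiff_nonempty]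
      rw [Finset.mem_symmDiff] at hP
      have hPU : P ∈ T ∪ T' := by rw [Finset.mem_union]; tauto
      refine Finset.prod_eq_zero hPU ?_
      have hz := gmean_sphi hM (hS P (hU hPU)) ((Finset.dvd_prod_of_mem _ hPU).trans hd')
      rcases hP with ⟨h1, h2⟩ | ⟨h1, h2⟩ <;> simpa [h1, h2] using hz
  · intro P _ x t
    have := gper_sphi y P x t
    simp only [this]

/-- **Selberg's sieve** for `k` distinct residue classes. -/
theorem selberg_sieve {k : ℕ} (hk : 1 ≤ k) {y : Fin k → GaussianInt} {S : Finset GaussianInt}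
    (hS : ∀ P ∈ S, GoodPrime y P) (hc : ∀ P ∈ S, ∀ Q ∈ S, P ≠ Q → IsCoprime P Q)
    {R L : ℕ} (hR : 1 ≤ R) (hL : R ^ 2 ≤ L) (c : GaussianInt) :
    boxSum L c (fun x => if ∀ P ∈ S, ∀ i, ¬ P ∣ x - y i then 1 else 0) ≤
      4 * (L : ℝ) ^ 2 / selG k S R + 2 * L * (R : ℝ) ^ 4 := by
  set D := lowSets S R with hD
  set G := selG k S R with hG
  set w : Finset GaussianInt → ℝ := fun T => ∏ P ∈ T, (k / (gn P - k) : ℝ) with hw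
  have hGD : G = ∑ T ∈ D, w T := rfl
  have hTS : ∀ T ∈ D, T ⊆ S := fun T hT => (mem_lowSets.1 hT).1
  have hTR : ∀ T ∈ D, gn (∏ P ∈ T, P) ≤ R := fun T hT => (mem_lowSets.1 hT).2
  have hT0 : ∀ T ∈ D, (∏ P ∈ T, P) ≠ 0 := fun T hT =>
    Finset.prod_ne_zero_iff.2 fun P hP => (hS P (hTS T hT hP)).1
  have hw0 : ∀ T ∈ D, 0 ≤ w T := fun T hT =>
    Finset.prod_nonneg fun P hP => (hS P (hTS T hT hP)).h_nonneg
  have hk' : (1 : ℝ) ≤ k := by exact_mod_cast hk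
  have hwR : ∀ T ∈ D, 1 ≤ R * w T := by
    intro T hT
    have h1 : 1 ≤ gn (∏ P ∈ T, P) * w T := by
      rw [gn_prod, hw, ← Finset.prod_mul_distrib]
      refine one_le_prod_real fun P hP => ?_
      have hg := hS P (hTS T hT hP)
      rw [mul_div_assoc', le_div_iff₀ hg.sub_pos]
      nlinarith [gn_pos hg.1]
    exact h1.trans (mul_le_mul_of_nonneg_right (hTR T hT) (hw0 T hT))
  have hG1 : 1 ≤ G := by
    have h0 : ∅ ∈ D := by
      rw [hD, mem_lowSets]; simp [gn_one]; exact_mod_cast hR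
    rw [hGD]
    have := Finset.single_le_sum hw0 h0
    simpa [hw] using this
  have hcard : (D.card : ℝ) ≤ R * G := by
    rw [hGD, Finset.mul_sum]
    have := Finset.card_nsmul_le_sum D (fun T => R * w T) 1 hwR
    simpa using this
  set F : GaussianInt → ℝ := fun x => ∑ T ∈ D, ∏ P ∈ T, sphi y P x with hF
  have hpt : ∀ x, G ^ 2 * (if ∀ P ∈ S, ∀ i, ¬ P ∣ x - y i then 1 else 0) ≤ F x * F x := by
    intro x
    split_ifs with h
    · have : F x = G := by
        rw [hGD, hF]
        refine Finset.sum_congr rfl fun T hT => Finset.prod_congr rfl fun P hP => ?_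
        unfold sphi
        rw [if_neg]
        rintro ⟨i, hi⟩
        exact h P (hTS T hT hP) i hi
      rw [this, mul_one, sq]
    · rw [mul_zero]; exact mul_self_nonneg _
  have hsum : boxSum L c (fun x => F x * F x) = ∑ T ∈ D, ∑ T' ∈ D,
      boxSum L c (fun x => (∏ P ∈ T, sphi y P x) * ∏ P ∈ T', sphi y P x) := by
    simp only [← boxSum_sum]
    congr 1; funext x
    rw [hF]; simp only [Finset.sum_mul_sum]
  have habs : ∀ T ∈ D, ∀ x, |∏ P ∈ T, sphi y P x| ≤ 1 := by
    intro T hT x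
    rw [Finset.abs_prod]
    exact Finset.prod_le_one (fun _ _ => abs_nonneg _)
      fun P hP => abs_sphi_le (hS P (hTS T hT hP)) x
  have hterm : ∀ T ∈ D, ∀ T' ∈ D,
      boxSum L c (fun x => (∏ P ∈ T, sphi y P x) * ∏ P ∈ T', sphi y P x) ≤
        (if T = T' then 4 * (L : ℝ) ^ 2 * w T else 0) + 2 * L * (R : ℝ) ^ 2 := by
    intro T hT T' hT'
    set m := (Zsqrtd.norm ((∏ P ∈ T, P) * ∏ P ∈ T', P)).natAbs with hm
    have hne : ((∏ P ∈ T, P) * ∏ P ∈ T', P) ≠ 0 := mul_ne_zero (hT0 T hT) (hT0 T' hT')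
    have hmr : (m : ℝ) = gn (∏ P ∈ T, P) * gn (∏ P ∈ T', P) := by
      rw [hm, natAbs_norm_cast, gn_mul]
    have hm0 : 0 < m := by
      have : (0 : ℝ) < m := by rw [hmr]; exact mul_pos (gn_pos (hT0 T hT)) (gn_pos (hT0 T' hT'))
      exact_mod_cast this
    have hmR : (m : ℝ) ≤ (R : ℝ) ^ 2 := by
      rw [hmr, sq]
      exact mul_le_mul (hTR T hT) (hTR T' hT') (gn_nonneg _) (Nat.cast_nonneg _)
    have hmL : m ≤ L := by
      have : m ≤ R ^ 2 := by exact_mod_cast hmR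
      omega
    have hdm := dvd_natAbs_norm ((∏ P ∈ T, P) * ∏ P ∈ T', P)
    rw [← hm] at hdm
    have hmean := gmean_pair hS hc (hTS T hT) (hTS T' hT') hm0 hdm
    have hper : GPer m (fun x => (∏ P ∈ T, sphi y P x) * ∏ P ∈ T', sphi y P x) :=
      ((prod_sphi_gper y T).of_dvd ((Dvd.intro _ rfl).trans hdm)).mul
        ((prod_sphi_gper y T').of_dvd ((Dvd.intro_left _ rfl).trans hdm))
    have hL0 : (0 : ℝ) ≤ L := Nat.cast_nonneg _
    split_ifs with h
    · subst h
      rw [if_pos rfl] at hmean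
      have := boxSum_le_of_nonneg hm0 hmL (c := c) (fun x => mul_self_nonneg _) hper
      rw [gmean] at hmean
      rw [hmean] at this
      refine this.trans ?_
      have : 0 ≤ 2 * (L : ℝ) * (R : ℝ) ^ 2 := by positivity
      simp only [hw]; linarith
    · rw [if_neg h, gmean, div_eq_zero_iff] at hmean
      have h0 := hmean.resolve_right (by positivity)
      have := abs_boxSum_le_of_zero (L := L) hm0 (c := c) (fun x => ?_) hper h0
      · refine (le_abs_self _).trans (this.trans ?_)
        rw [zero_add]
        exact mul_le_mul_of_nonneg_left hmR (by positivity)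
      · rw [abs_mul]
        exact mul_le_one₀ (habs T hT x) (abs_nonneg _) (habs T' hT' x)
  have hmain : G ^ 2 * boxSum L c (fun x => if ∀ P ∈ S, ∀ i, ¬ P ∣ x - y i then 1 else 0) ≤
      4 * (L : ℝ) ^ 2 * G + (D.card : ℝ) ^ 2 * (2 * L * (R : ℝ) ^ 2) := by
    rw [← boxSum_const_mul]
    calc _ ≤ boxSum L c (fun x => F x * F x) := by
          unfold boxSum
          exact Finset.sum_le_sum fun i _ => Finset.sum_le_sum fun j _ => hpt _
      _ ≤ ∑ T ∈ D, ∑ T' ∈ D,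
          ((if T = T' then 4 * (L : ℝ) ^ 2 * w T else 0) + 2 * L * (R : ℝ) ^ 2) := by
          rw [hsum]
          exact Finset.sum_le_sum fun T hT => Finset.sum_le_sum fun T' hT' => hterm T hT T' hT'
      _ = _ := by
          simp only [Finset.sum_add_distrib, Finset.sum_ite_eq, Finset.sum_const, nsmul_eq_mul]
          rw [Finset.sum_congr rfl fun T hT => if_pos hT, ← Finset.mul_sum, ← hGD]
          ring
  have hG0 : 0 < G := by linarith
  have h2 : (D.card : ℝ) ^ 2 ≤ (R * G) ^ 2 := pow_le_pow_left₀ (Nat.cast_nonneg _) hcard 2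
  have h3 : (D.card : ℝ) ^ 2 * (2 * L * (R : ℝ) ^ 2) ≤ (R * G) ^ 2 * (2 * L * (R : ℝ) ^ 2) :=
    mul_le_mul_of_nonneg_right h2 (by positivity)
  have h4 : G ^ 2 * (4 * (L : ℝ) ^ 2 / G + 2 * L * (R : ℝ) ^ 4) =
      4 * (L : ℝ) ^ 2 * G + (R * G) ^ 2 * (2 * L * (R : ℝ) ^ 2) := by
    field_simp
  refine le_of_mul_le_mul_left ?_ (pow_pos hG0 2)
  rw [h4]; linarith

lemma sum_le_sum_of_injOn' {α β : Type*} {s : Finset α} {t : Finset β} {f : α → ℝ} {g : β → ℝ}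
    (e : α → β) (he : ∀ a ∈ s, e a ∈ t) (hi : Set.InjOn e s) (h : ∀ a ∈ s, f a ≤ g (e a))
    (hg : ∀ b ∈ t, 0 ≤ g b) : ∑ a ∈ s, f a ≤ ∑ b ∈ t, g b := by
  calc ∑ a ∈ s, f a ≤ ∑ a ∈ s, g (e a) := Finset.sum_le_sum h
    _ = ∑ b ∈ s.image e, g b := (Finset.sum_image hi).symm
    _ ≤ _ := Finset.sum_le_sum_of_subset_of_nonneg (Finset.image_subset_iff.2 he)
        fun b hb _ => hg b hb

/-- The sum over sets of primes in `S` with product of norm at most `R` of a multiplicative weight. -/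
def lowW (a : GaussianInt → ℝ) (S : Finset GaussianInt) (R : ℝ) : ℝ :=
  ∑ T ∈ lowSets S R, ∏ P ∈ T, a P

lemma one_le_gn_prod {S T : Finset GaussianInt} (hS : ∀ P ∈ S, P ≠ 0) (hT : T ⊆ S) :
    1 ≤ gn (∏ P ∈ T, P) :=
  one_le_gn (Finset.prod_ne_zero_iff.2 fun P hP => hS P (hT hP))

lemma gn_prod_mono {S T U : Finset GaussianInt} (hS : ∀ P ∈ S, P ≠ 0) (hT : T ⊆ U) (hU : U ⊆ S) :
    gn (∏ P ∈ T, P) ≤ gn (∏ P ∈ U, P) := by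
  rw [← Finset.prod_sdiff hT, gn_mul]
  exact le_mul_of_one_le_left (gn_nonneg _)
    (one_le_gn_prod hS (Finset.sdiff_subset.trans hU))

lemma lowW_mul_le {a b : GaussianInt → ℝ} {S : Finset GaussianInt} (hS : ∀ P ∈ S, P ≠ 0)
    (ha : ∀ P ∈ S, 0 ≤ a P) (hb : ∀ P ∈ S, 0 ≤ b P) {R₁ R₂ : ℝ} :
    lowW a S R₁ * lowW b S R₂ ≤ lowW (fun P => a P + a P * b P + b P) S (R₁ * R₂) := by
  unfold lowW
  rw [Finset.sum_mul_sum, ← Finset.sum_product']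
  have hR : ∀ U ∈ lowSets S (R₁ * R₂), ∏ P ∈ U, (a P + a P * b P + b P) =
      ∑ T ∈ U.powerset, ∑ V ∈ T.powerset,
        (∏ P ∈ T, a P) * ((∏ P ∈ V, b P) * ∏ P ∈ U \ T, b P) := by
    intro U _
    rw [Finset.prod_add]
    refine Finset.sum_congr rfl fun T _ => ?_
    rw [← Finset.mul_sum, ← Finset.sum_mul, ← Finset.prod_one_add, ← mul_assoc,
      ← Finset.prod_mul_distrib]
    congr 1
    exact Finset.prod_congr rfl fun P _ => by ring
  rw [Finset.sum_congr rfl hR, Finset.sum_sigma', Finset.sum_sigma']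
  refine sum_le_sum_of_injOn' (fun x => ⟨⟨x.1 ∪ x.2, x.1⟩, x.1 ∩ x.2⟩) ?_ ?_ ?_ ?_
  · rintro ⟨T, V⟩ hx
    simp only [Finset.mem_product, mem_lowSets] at hx
    obtain ⟨⟨h1, h2⟩, h3, h4⟩ := hx
    simp only [Finset.mem_sigma, mem_lowSets, Finset.mem_powerset]
    refine ⟨⟨⟨Finset.union_subset h1 h3, ?_⟩, Finset.subset_union_left⟩, Finset.inter_subset_left⟩
    have h5 : gn (∏ P ∈ T ∪ V, P) * gn (∏ P ∈ T ∩ V, P) =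
        gn (∏ P ∈ T, P) * gn (∏ P ∈ V, P) := by
      rw [← gn_mul, ← gn_mul, Finset.prod_union_inter]
    have h6 := one_le_gn_prod hS ((Finset.inter_subset_left (s₂ := V)).trans h1)
    have h7 := mul_le_mul h2 h4 (gn_nonneg _) ((gn_nonneg _).trans h2)
    nlinarith [gn_nonneg (∏ P ∈ T ∪ V, P)]
  · rintro ⟨T, V⟩ _ ⟨T', V'⟩ _ h
    simp only [Sigma.mk.injEq, heq_eq_eq] at h
    obtain ⟨⟨h1, h2⟩, h3⟩ := h
    subst h2
    have : ∀ W : Finset GaussianInt, W = T ∩ W ∪ (T ∪ W) \ T := by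
      intro W; ext x; simp; tauto
    rw [Prod.mk.injEq]
    refine ⟨rfl, ?_⟩
    rw [this V, this V', h1, h3]
  · rintro ⟨T, V⟩ hx
    simp only
    have e : (T ∪ V) \ T = V \ T := by ext x; simp; tauto
    rw [e, Finset.inter_comm, mul_comm (∏ P ∈ V ∩ T, b P)]
    have : (∏ P ∈ V, b P) = (∏ P ∈ V \ T, b P) * ∏ P ∈ V ∩ T, b P := by
      rw [← Finset.prod_sdiff (Finset.inter_subset_left (s₁ := V) (s₂ := T)),
        Finset.sdiff_inter_self_left]
    rw [this]
  · rintro ⟨⟨U, T⟩, V⟩ hx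
    simp only [Finset.mem_sigma, mem_lowSets, Finset.mem_powerset] at hx
    obtain ⟨⟨⟨h1, -⟩, h2⟩, h3⟩ := hx
    exact mul_nonneg (Finset.prod_nonneg fun P hP => ha P (h1 (h2 hP)))
      (mul_nonneg (Finset.prod_nonneg fun P hP => hb P (h1 (h2 (h3 hP))))
        (Finset.prod_nonneg fun P hP => hb P (h1 (Finset.sdiff_subset hP))))

lemma lowW_mono {a b : GaussianInt → ℝ} {S : Finset GaussianInt}
    (ha : ∀ P ∈ S, 0 ≤ a P) (hb : ∀ P ∈ S, a P ≤ b P) {R : ℝ} :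
    lowW a S R ≤ lowW b S R :=
  Finset.sum_le_sum fun _ hT => Finset.prod_le_prod (fun P hP => ha P ((mem_lowSets.1 hT).1 hP))
    fun P hP => hb P ((mem_lowSets.1 hT).1 hP)

lemma lowW_nonneg {a : GaussianInt → ℝ} {S : Finset GaussianInt}
    (ha : ∀ P ∈ S, 0 ≤ a P) {R : ℝ} : 0 ≤ lowW a S R :=
  Finset.sum_nonneg fun _ hT => Finset.prod_nonneg fun P hP => ha P ((mem_lowSets.1 hT).1 hP)

lemma lowW_pow_le {S : Finset GaussianInt} (hS : ∀ P ∈ S, P ≠ 0) (r : ℝ) (k : ℕ) :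
    lowW (fun P => 1 / gn P) S r ^ k ≤ lowW (fun P => (1 + 1 / gn P) ^ k - 1) S (r ^ k) := by
  have hn : ∀ P, 0 ≤ 1 / gn P := fun P => by have := gn_nonneg P; positivity
  induction k with
  | zero =>
    simp only [pow_zero, lowW]
    have h0 : ∅ ∈ lowSets S 1 := by rw [mem_lowSets]; simp [gn_one]
    have := Finset.single_le_sum (f := fun T : Finset GaussianInt => ∏ P ∈ T, ((1 : ℝ) - 1))
      (fun T _ => Finset.prod_nonneg fun P _ => by simp) h0
    simpa using this
  | succ k ih =>
    rw [pow_succ]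
    refine (mul_le_mul_of_nonneg_right ih (lowW_nonneg fun P _ => hn P)).trans ?_
    refine (lowW_mul_le hS (fun P _ => ?_) fun P _ => hn P).trans (le_of_eq ?_)
    · have := one_le_pow₀ (n := k) (show 1 ≤ 1 + 1 / gn P by linarith [hn P])
      linarith
    · rw [← pow_succ]
      congr 1; funext P
      ring

lemma lowW_pow_le_selG {k : ℕ} {S : Finset GaussianInt} (hS : ∀ P ∈ S, P ≠ 0)
    (hk : ∀ P ∈ S, (k : ℝ) < gn P) (r : ℝ) :
    lowW (fun P => 1 / gn P) S r ^ k ≤ selG k S (r ^ k) := by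
  refine (lowW_pow_le hS r k).trans ?_
  unfold selG
  refine lowW_mono (fun P hP => ?_) fun P hP => ?_
  · have h0 : 0 ≤ 1 / gn P := by have := gn_nonneg P; positivity
    have := one_le_pow₀ (n := k) (show 1 ≤ 1 + 1 / gn P by linarith)
    linarith
  · have h1 := one_le_gn (hS P hP)
    have h2 := hk P hP
    have h3 : 0 < gn P - k := by linarith
    have h0 : 0 < gn P := by linarith
    have h4 : 1 / gn P ≤ 1 := by rw [div_le_one h0]; exact h1
    have h5 : 0 ≤ 1 / gn P := by positivity
    have hb := one_add_mul_le_pow (a := -(1 / gn P)) (by linarith) k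
    have h6 : (1 + 1 / gn P) ^ k * (1 + -(1 / gn P)) ^ k ≤ 1 := by
      rw [← mul_pow]
      refine pow_le_one₀ ?_ ?_
      · apply mul_nonneg <;> linarith
      · nlinarith
    have h7 : (1 + 1 / gn P) ^ k * (1 + k * -(1 / gn P)) ≤ 1 :=
      (mul_le_mul_of_nonneg_left hb (by positivity)).trans h6
    rw [sub_le_iff_le_add, div_add_one h3.ne', le_div_iff₀ h3]
    have h8 : 1 + k * -(1 / gn P) = (gn P - k) / gn P := by field_simp; ring
    rw [h8, mul_div_assoc', div_le_iff₀ h0] at h7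
    linarith

lemma lowW_remove {a : GaussianInt → ℝ} {S : Finset GaussianInt} (hS : ∀ P ∈ S, P ≠ 0)
    (ha : ∀ P ∈ S, 0 ≤ a P) (p : GaussianInt → Prop) (r : ℝ) :
    lowW a S r ≤ lowW a (S.filter p) r * ∏ P ∈ S.filter (fun P => ¬ p P), (1 + a P) := by
  unfold lowW
  rw [Finset.prod_one_add, Finset.sum_mul_sum, ← Finset.sum_product']
  refine sum_le_sum_of_injOn' (fun T => (T.filter p, T.filter (fun P => ¬ p P))) ?_ ?_ ?_ ?_
  · intro T hT
    rw [mem_lowSets] at hT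
    simp only [Finset.mem_product, mem_lowSets, Finset.mem_powerset]
    exact ⟨⟨Finset.filter_subset_filter _ hT.1,
      (gn_prod_mono hS (Finset.filter_subset _ _) hT.1).trans hT.2⟩,
      Finset.filter_subset_filter _ hT.1⟩
  · intro T _ T' _ h
    simp only [Prod.mk.injEq] at h
    rw [← Finset.filter_union_filter_not_eq p T, h.1, h.2, Finset.filter_union_filter_not_eq]
  · intro T _
    exact (Finset.prod_filter_mul_prod_filter_not T p a).ge
  · rintro ⟨T, V⟩ h
    simp only [Finset.mem_product, mem_lowSets, Finset.mem_powerset] at h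
    exact mul_nonneg
      (Finset.prod_nonneg fun P hP => ha P (Finset.filter_subset _ _ (h.1.1 hP)))
      (Finset.prod_nonneg fun P hP => ha P (Finset.filter_subset _ _ (h.2 hP)))

/-- The square of Gaussian integers with real and imaginary part at most `X` in absolute value. -/
def gbox (X : ℕ) : Finset GaussianInt :=
  (Finset.Icc (-(X : ℤ)) X ×ˢ Finset.Icc (-(X : ℤ)) X).image fun x => ⟨x.1, x.2⟩

lemma mem_gbox {X : ℕ} {z : GaussianInt} : z ∈ gbox X ↔ |z.re| ≤ X ∧ |z.im| ≤ X := by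
  simp only [gbox, Finset.mem_image, Finset.mem_product, Finset.mem_Icc, Prod.exists, abs_le]
  constructor
  · rintro ⟨a, b, h, rfl⟩; exact h
  · intro h; exact ⟨z.re, z.im, h, rfl⟩

lemma card_gbox (X : ℕ) : (gbox X).card = (2 * X + 1) ^ 2 := by
  unfold gbox
  rw [Finset.card_image_of_injective, Finset.card_product, Int.card_Icc, sq]
  · congr 1 <;> omega
  · rintro ⟨a, b⟩ ⟨c, d⟩ h
    simpa [Zsqrtd.ext_iff] using h

lemma mem_gbox_of_gn_le {X : ℕ} {z : GaussianInt} (h : gn z ≤ (X : ℝ) ^ 2) : z ∈ gbox X := by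
  rw [gn_eq] at h
  rw [mem_gbox]
  have h1 : (z.re : ℝ) ^ 2 ≤ (X : ℝ) ^ 2 := by nlinarith [sq_nonneg (z.im : ℝ)]
  have h2 : (z.im : ℝ) ^ 2 ≤ (X : ℝ) ^ 2 := by nlinarith [sq_nonneg (z.re : ℝ)]
  have h1' := abs_le_of_sq_le_sq h1 (Nat.cast_nonneg _)
  have h2' := abs_le_of_sq_le_sq h2 (Nat.cast_nonneg _)
  constructor
  · exact_mod_cast h1'
  · exact_mod_cast h2'

lemma mem_gbox_of_gn_le' {X : ℕ} {z : GaussianInt} (h : gn z ≤ X) : z ∈ gbox X := by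
  refine mem_gbox_of_gn_le (h.trans ?_)
  rcases Nat.eq_zero_or_pos X with rfl | hX
  · simp
  · have : (1 : ℝ) ≤ X := by exact_mod_cast hX
    nlinarith

/-- A chosen representative of each associate class. -/
def grep (z : GaussianInt) : GaussianInt := Quotient.out (Associates.mk z)

lemma grep_associated (z : GaussianInt) : Associated (grep z) z :=
  Associates.mk_eq_mk_iff_associated.1 (Quotient.out_eq (Associates.mk z))

lemma grep_eq_of_associated {z w : GaussianInt} (h : Associated z w) : grep z = grep w := by
  unfold grep; rw [Associates.mk_eq_mk_iff_associated.2 h]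

/-- `P` is the chosen representative of a class of Gaussian primes. -/
def PrimeRep (P : GaussianInt) : Prop := Prime P ∧ grep P = P

lemma primeRep_grep {z : GaussianInt} (h : Prime z) : PrimeRep (grep z) :=
  ⟨(grep_associated z).symm.prime h, grep_eq_of_associated (grep_associated z)⟩

lemma PrimeRep.isCoprime {P Q : GaussianInt} (hP : PrimeRep P) (hQ : PrimeRep Q) (h : P ≠ Q) :
    IsCoprime P Q := by
  rw [hP.1.irreducible.coprime_iff_not_dvd]
  intro hd
  have := hP.1.associated_of_dvd hQ.1 hd
  exact h (by rw [← hP.2, ← hQ.2, grep_eq_of_associated this])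

/-- Representatives of the Gaussian primes of norm at most `R`. -/
def primeSet (R : ℕ) : Finset GaussianInt :=
  (gbox R).filter fun P => PrimeRep P ∧ gn P ≤ R

lemma mem_primeSet {R : ℕ} {P : GaussianInt} : P ∈ primeSet R ↔ PrimeRep P ∧ gn P ≤ R := by
  simp only [primeSet, Finset.mem_filter, and_iff_right_iff_imp]
  exact fun h => mem_gbox_of_gn_le' h.2

lemma ne_zero_of_mem_primeSet {R : ℕ} : ∀ P ∈ primeSet R, P ≠ 0 := fun _ hP =>
  (mem_primeSet.1 hP).1.1.ne_zero

lemma exists_squarefree_decomposition (z : GaussianInt) : z ≠ 0 →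
    ∃ u m : GaussianInt, ∃ T : Finset GaussianInt, IsUnit u ∧ (∀ P ∈ T, PrimeRep P) ∧
      z = u * (∏ P ∈ T, P) * m ^ 2 := by
  induction z using UniqueFactorizationMonoid.induction_on_prime with
  | h₁ => intro h; exact absurd rfl h
  | h₂ x hx => intro _; exact ⟨x, 1, ∅, hx, by simp, by simp⟩
  | h₃ a p ha hp ih =>
    intro _
    obtain ⟨u, m, T, hu, hT, h⟩ := ih ha
    obtain ⟨v, hv⟩ := grep_associated p
    by_cases hq : grep p ∈ T
    · refine ⟨u * v, grep p * m, T.erase (grep p), hu.mul v.isUnit,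
        fun P hP => hT P (Finset.mem_of_mem_erase hP), ?_⟩
      have := Finset.mul_prod_erase T (fun P => P) hq
      generalize grep p = q at *
      rw [h, ← this, ← hv]
      ring
    · refine ⟨u * v, m, insert (grep p) T, hu.mul v.isUnit, ?_, ?_⟩
      · intro P hP
        rcases Finset.mem_insert.1 hP with rfl | hP
        · exact primeRep_grep hp
        · exact hT P hP
      · rw [Finset.prod_insert hq, h]
        nth_rewrite 1 [← hv]
        ring

lemma summable_int_inv : Summable fun a : ℤ => (1 : ℝ) / (1 + (a : ℝ) ^ 2) := by
  have h : Summable fun n : ℕ => (1 : ℝ) / (1 + (n : ℝ) ^ 2) := by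
    have h2 : Summable fun n : ℕ => (1 : ℝ) / (n : ℝ) ^ 2 :=
      Real.summable_one_div_nat_pow.2 one_lt_two
    rw [← summable_nat_add_iff 1] at h2 ⊢
    refine Summable.of_nonneg_of_le (fun n => by positivity) (fun n => ?_) h2
    apply one_div_le_one_div_of_le <;> [positivity; linarith]
  refine Summable.of_nat_of_neg ?_ ?_ <;> simpa using h

lemma exists_gn_inv_sq_bound : ∃ Z : ℝ, 0 < Z ∧ ∀ s : Finset GaussianInt, (∀ z ∈ s, z ≠ 0) →
    ∑ z ∈ s, 1 / gn z ^ 2 ≤ Z := by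
  have hs := summable_int_inv.mul_of_nonneg summable_int_inv (fun _ => by positivity)
    (fun _ => by positivity)
  refine ⟨3 * (∑' x : ℤ × ℤ, 1 / (1 + (x.1 : ℝ) ^ 2) * (1 / (1 + (x.2 : ℝ) ^ 2))) + 1,
    by positivity, fun s h0 => ?_⟩
  have h1 : ∑ z ∈ s, 1 / gn z ^ 2 ≤
      ∑ x ∈ s.image (fun z : GaussianInt => ((z.re, z.im) : ℤ × ℤ)),
        3 * (1 / (1 + (x.1 : ℝ) ^ 2) * (1 / (1 + (x.2 : ℝ) ^ 2))) := by
    refine sum_le_sum_of_injOn' (fun z : GaussianInt => ((z.re, z.im) : ℤ × ℤ)) (fun z hz => Finset.mem_image_of_mem _ hz)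
      ?_ ?_ fun _ _ => by positivity
    · intro z _ w _ h
      simp only [Prod.mk.injEq] at h
      exact Zsqrtd.ext h.1 h.2
    · intro z hz
      have h2 := one_le_gn (h0 z hz)
      have h3 := gn_eq z
      simp only
      rw [one_div_mul_one_div, mul_one_div, div_le_div_iff₀ (by positivity) (by positivity)]
      have : ((z.re : ℝ) ^ 2) * (z.im : ℝ) ^ 2 ≤ gn z ^ 2 := by
        rw [h3]; nlinarith [sq_nonneg (z.re : ℝ), sq_nonneg (z.im : ℝ),
          mul_nonneg (sq_nonneg (z.re : ℝ)) (sq_nonneg (z.im : ℝ))]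
      nlinarith
  rw [← Finset.mul_sum] at h1
  have h2 := hs.sum_le_tsum (s.image (fun z : GaussianInt => ((z.re, z.im) : ℤ × ℤ))) (fun _ _ => by positivity)
  linarith

/-- The sum of inverse norms of nonzero Gaussian integers of norm at most `r`. -/
def invSum (r : ℕ) : ℝ := ∑ z ∈ (gbox r).filter (fun z => z ≠ 0 ∧ gn z ≤ r), 1 / gn z

lemma exists_invSum_le : ∃ Z : ℝ, 0 < Z ∧ ∀ r R : ℕ, r ≤ R →
    invSum r ≤ Z * lowW (fun P => 1 / gn P) (primeSet R) r := by
  obtain ⟨Z, hZ, hb⟩ := exists_gn_inv_sq_bound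
  refine ⟨9 * Z, by positivity, fun r R hrR => ?_⟩
  choose! u m T hu hT hz using exists_squarefree_decomposition
  have hcard : ((gbox 1).card : ℝ) = 9 := by rw [card_gbox]; norm_num
  have hn : ∀ P, 0 ≤ 1 / gn P := fun P => by have := gn_nonneg P; positivity
  have key : invSum r ≤ ∑ x ∈ gbox 1 ×ˢ ((gbox r).filter (fun z => z ≠ 0) ×ˢ
      lowSets (primeSet R) r), 1 / gn x.2.1 ^ 2 * ∏ P ∈ x.2.2, 1 / gn P := by
    refine sum_le_sum_of_injOn' (fun z => (u z, m z, T z)) ?_ ?_ ?_ ?_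
    · intro z h
      simp only [Finset.mem_filter] at h
      obtain ⟨-, h0, hr⟩ := h
      have hm0 : m z ≠ 0 := by
        intro h; apply h0; rw [hz z h0, h]; simp
      have hp0 : (∏ P ∈ T z, P) ≠ 0 := by
        intro h; apply h0; rw [hz z h0, h]; simp
      have e : gn z = gn (∏ P ∈ T z, P) * gn (m z) ^ 2 := by
        conv_lhs => rw [hz z h0]
        rw [gn_mul, gn_mul, gn_unit (hu z h0), gn_pow]; ring
      have h1 := one_le_gn hm0
      have h2 := one_le_gn hp0
      have h3 : gn (∏ P ∈ T z, P) ≤ r := by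
        have := one_le_pow₀ h1 (n := 2)
        nlinarith
      have h4 : gn (m z) ≤ r := by nlinarith
      simp only [Finset.mem_product, Finset.mem_filter, mem_lowSets]
      refine ⟨mem_gbox_of_gn_le' (by rw [gn_unit (hu z h0)]; simp),
        ⟨mem_gbox_of_gn_le' h4, hm0⟩, fun P hP => ?_, h3⟩
      rw [mem_primeSet]
      refine ⟨hT z h0 P hP, ?_⟩
      have := gn_prod_mono (S := T z) (T := {P}) (U := T z)
        (fun P hP => (hT z h0 P hP).1.ne_zero) (by simpa using hP) le_rfl
      simp only [Finset.prod_singleton] at this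
      have hrR' : (r : ℝ) ≤ R := by exact_mod_cast hrR
      linarith
    · intro z h z' h' he
      simp only [Finset.coe_filter, Set.mem_ofPred_eq] at h h'
      simp only [Prod.mk.injEq] at he
      rw [hz z h.2.1, hz z' h'.2.1, he.1, he.2.1, he.2.2]
    · intro z h
      simp only [Finset.mem_filter] at h
      have e : gn z = gn (∏ P ∈ T z, P) * gn (m z) ^ 2 := by
        conv_lhs => rw [hz z h.2.1]
        rw [gn_mul, gn_mul, gn_unit (hu z h.2.1), gn_pow]; ring
      rw [e, gn_prod, Finset.prod_div_distrib, Finset.prod_const_one, one_div_mul_one_div, mul_comm]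
    · intro x _
      exact mul_nonneg (by positivity) (Finset.prod_nonneg fun P _ => hn P)
  refine key.trans ?_
  rw [Finset.sum_product]
  simp only
  rw [Finset.sum_const, nsmul_eq_mul, hcard, Finset.sum_product]
  simp only
  rw [← Finset.sum_mul_sum, mul_assoc]
  refine mul_le_mul_of_nonneg_left ?_ (by norm_num)
  refine mul_le_mul_of_nonneg_right (hb _ fun z hz => (Finset.mem_filter.1 hz).2) ?_
  exact lowW_nonneg fun P _ => hn P

lemma log_le_invSum {r : ℕ} (hr : 1 ≤ r) : Real.log (r + 1) ≤ 5 * invSum r := by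
  have h1 : 1 ≤ invSum r := by
    have := Finset.single_le_sum (s := (gbox r).filter (fun z => z ≠ 0 ∧ gn z ≤ r))
      (f := fun z => 1 / gn z) (a := 1) (fun z _ => by have := gn_nonneg z; positivity) ?_
    · simpa [gn_one, invSum] using this
    · have : gn 1 ≤ r := by rw [gn_one]; exact_mod_cast hr
      simp only [Finset.mem_filter]
      exact ⟨mem_gbox_of_gn_le' this, one_ne_zero, this⟩
  set s := Nat.sqrt (r / 2) with hs
  have hs1 : 2 * s ^ 2 ≤ r := by
    have : s ^ 2 ≤ r / 2 := Nat.sqrt_le' (r / 2)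
    omega
  have hs2 : r + 1 ≤ 2 * (s + 1) ^ 2 := by
    have : r / 2 < (s + 1) ^ 2 := Nat.lt_succ_sqrt' (r / 2)
    omega
  have h2 : (1 / 2 : ℝ) * ∑ a ∈ Finset.range s, ((a : ℝ) + 1)⁻¹ ≤ invSum r := by
    calc (1 / 2 : ℝ) * ∑ a ∈ Finset.range s, ((a : ℝ) + 1)⁻¹
        = ∑ a ∈ Finset.range s, ∑ b ∈ Finset.range (a + 1), 1 / (2 * ((a : ℝ) + 1) ^ 2) := by
          rw [Finset.mul_sum]
          refine Finset.sum_congr rfl fun a _ => ?_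
          rw [Finset.sum_const, Finset.card_range, nsmul_eq_mul]
          push_cast; field_simp
      _ ≤ _ := by
          rw [Finset.sum_sigma']
          refine sum_le_sum_of_injOn' (fun x => ⟨(x.1 : ℤ) + 1, (x.2 : ℤ) + 1⟩) ?_ ?_ ?_ ?_
          · rintro ⟨a, b⟩ h
            simp only [Finset.mem_sigma, Finset.mem_range] at h
            have hg : gn ⟨(a : ℤ) + 1, (b : ℤ) + 1⟩ ≤ r := by
              rw [gn_eq]; push_cast
              have ha : (a : ℝ) + 1 ≤ s := by exact_mod_cast h.1
              have hb : (b : ℝ) + 1 ≤ s := by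
                have : b + 1 ≤ s := by omega
                exact_mod_cast this
              have h3 : (2 : ℝ) * (s : ℝ) ^ 2 ≤ r := by exact_mod_cast hs1
              nlinarith [Nat.cast_nonneg (α := ℝ) a, Nat.cast_nonneg (α := ℝ) b]
            simp only [Finset.mem_filter]
            refine ⟨mem_gbox_of_gn_le' hg, ?_, hg⟩
            intro h0
            have := congrArg Zsqrtd.re h0
            simp at this; omega
          · rintro ⟨a, b⟩ _ ⟨c, d⟩ _ h
            simp only [Zsqrtd.ext_iff, add_left_inj, Nat.cast_inj] at h
            rw [h.1, h.2]
          · rintro ⟨a, b⟩ h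
            simp only [Finset.mem_sigma, Finset.mem_range] at h
            simp only
            rw [gn_eq]; push_cast
            have hb : (b : ℝ) ≤ a := by
              have : b ≤ a := by omega
              exact_mod_cast this
            apply one_div_le_one_div_of_le (by positivity)
            nlinarith [Nat.cast_nonneg (α := ℝ) a, Nat.cast_nonneg (α := ℝ) b]
          · intro z _; have := gn_nonneg z; positivity
  have h3 : Real.log (s + 1) ≤ ∑ a ∈ Finset.range s, ((a : ℝ) + 1)⁻¹ := by
    have := log_add_one_le_harmonic s
    rw [harmonic] at this
    push_cast at this
    exact this
  have h4 : Real.log (r + 1) ≤ Real.log 2 + 2 * Real.log (s + 1) := by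
    have : ((r : ℝ) + 1) ≤ 2 * ((s : ℝ) + 1) ^ 2 := by exact_mod_cast hs2
    refine (Real.log_le_log (by positivity) this).trans (le_of_eq ?_)
    rw [Real.log_mul (by norm_num) (by positivity), Real.log_pow]; norm_num
  have h5 : Real.log 2 ≤ 1 := by linarith [Real.log_two_lt_d9]
  linarith

/-- The main sum of inverse norms over squarefree products is at least of logarithmic size. -/
lemma exists_log_le_lowW : ∃ c : ℝ, 0 < c ∧ ∀ r R : ℕ, 1 ≤ r → r ≤ R →
    c * Real.log (r + 1) ≤ lowW (fun P => 1 / gn P) (primeSet R) r := by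
  obtain ⟨Z, hZ, h⟩ := exists_invSum_le
  refine ⟨(5 * Z)⁻¹, by positivity, fun r R hr hR => ?_⟩
  rw [inv_mul_le_iff₀ (by positivity)]
  have := h r R hR
  have := log_le_invSum hr
  linarith

lemma one_add_pow_le (M : ℕ) {t : ℝ} (h0 : 0 ≤ t) (h1 : t ≤ 1) :
    (1 + t) ^ M ≤ 1 + (2 ^ M - 1) * t := by
  induction M with
  | zero => simp
  | succ M ih =>
    have h2 : (1 : ℝ) ≤ 2 ^ M := one_le_pow₀ (by norm_num)
    have h3 : t * t ≤ t := by nlinarith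
    calc (1 + t) ^ (M + 1) = (1 + t) ^ M * (1 + t) := pow_succ _ _
      _ ≤ (1 + (2 ^ M - 1) * t) * (1 + t) := by gcongr
      _ ≤ 1 + (2 ^ (M + 1) - 1) * t := by
        rw [pow_succ]; nlinarith [mul_nonneg (sub_nonneg.2 h2) (sub_nonneg.2 h3)]

lemma gn_le_of_mem_gbox {X : ℕ} {z : GaussianInt} (h : z ∈ gbox X) : gn z ≤ 2 * (X : ℝ) ^ 2 := by
  rw [mem_gbox] at h
  have h1 : |(z.re : ℝ)| ≤ X := by exact_mod_cast h.1
  have h2 : |(z.im : ℝ)| ≤ X := by exact_mod_cast h.2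
  have h3 := sq_le_sq' (abs_le.1 h1).1 (abs_le.1 h1).2
  have h4 := sq_le_sq' (abs_le.1 h2).1 (abs_le.1 h2).2
  rw [gn_eq]; linarith

lemma card_multiples_le (X : ℕ) {d : GaussianInt} (hd : d ≠ 0) :
    (((gbox X).filter fun z => z ≠ 0 ∧ d ∣ z).card : ℝ) ≤ 50 * (X : ℝ) ^ 2 / gn d := by
  set ρ : ℝ := 2 * (X : ℝ) ^ 2 / gn d with hρ
  have hdp := gn_pos hd
  have hbd : ∀ w, d * w ∈ gbox X → gn w ≤ ρ := by
    intro w hw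
    have := gn_le_of_mem_gbox hw
    rw [gn_mul] at this
    rw [hρ, le_div_iff₀ hdp]; linarith
  rcases lt_or_ge ρ 1 with h | h
  · have : (gbox X).filter (fun z => z ≠ 0 ∧ d ∣ z) = ∅ := by
      rw [Finset.filter_eq_empty_iff]
      rintro z hz ⟨h0, w, rfl⟩
      have := one_le_gn (right_ne_zero_of_mul h0)
      linarith [hbd w hz]
    rw [this]; simp only [Finset.card_empty, Nat.cast_zero]; positivity
  · have hs := Real.one_le_sqrt.2 h
    have hsub : (gbox X).filter (fun z => z ≠ 0 ∧ d ∣ z) ⊆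
        (gbox ⌈√ρ⌉₊).image fun w => d * w := by
      intro z hz
      simp only [Finset.mem_filter] at hz
      obtain ⟨hz, -, w, rfl⟩ := hz
      refine Finset.mem_image_of_mem _ (mem_gbox_of_gn_le ((hbd w hz).trans ?_))
      calc ρ = √ρ ^ 2 := (Real.sq_sqrt (by linarith)).symm
        _ ≤ _ := by gcongr; exact Nat.le_ceil _
    have hc := (Finset.card_le_card hsub).trans Finset.card_image_le
    rw [card_gbox] at hc
    have h1 : (⌈√ρ⌉₊ : ℝ) ≤ 2 * √ρ := by
      have := (Nat.ceil_lt_add_one (Real.sqrt_nonneg ρ)).le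
      linarith
    calc (((gbox X).filter fun z => z ≠ 0 ∧ d ∣ z).card : ℝ)
        ≤ (2 * (⌈√ρ⌉₊ : ℝ) + 1) ^ 2 := by exact_mod_cast hc
      _ ≤ (5 * √ρ) ^ 2 := by gcongr; linarith
      _ = 25 * ρ := by rw [mul_pow, Real.sq_sqrt (by linarith)]; norm_num
      _ = _ := by rw [hρ]; ring

/-- The divisor-type weight `∏ (1 + 1 / N(P))` over the primes of norm at most `R` dividing `z`. -/
def divW (R : ℕ) (z : GaussianInt) : ℝ :=
  ∏ P ∈ (primeSet R).filter (fun P => P ∣ z), (1 + 1 / gn P)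

lemma one_le_divW (R : ℕ) (z : GaussianInt) : 1 ≤ divW R z := by
  refine one_le_prod_real fun P _ => ?_
  have := gn_nonneg P
  have : 0 ≤ 1 / gn P := by positivity
  linarith

lemma exists_divW_moment (M : ℕ) : ∃ C : ℝ, 0 < C ∧ ∀ R X : ℕ,
    ∑ z ∈ (gbox X).filter (fun z => z ≠ 0), divW R z ^ M ≤ C * (X : ℝ) ^ 2 := by
  obtain ⟨Z, hZ, hb⟩ := exists_gn_inv_sq_bound
  set D : ℝ := 2 ^ M - 1 with hD
  have hD0 : 0 ≤ D := by
    have : (1 : ℝ) ≤ 2 ^ M := one_le_pow₀ (by norm_num)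
    linarith
  refine ⟨50 * Real.exp (D * Z), by positivity, fun R X => ?_⟩
  have h0 : ∀ T : Finset GaussianInt, 0 ≤ ∏ P ∈ T, D * (1 / gn P) := fun T =>
    Finset.prod_nonneg fun P _ => by have := gn_nonneg P; positivity
  have h1 : ∀ z, divW R z ^ M ≤
      ∑ T ∈ (primeSet R).powerset, if ∏ P ∈ T, P ∣ z then ∏ P ∈ T, D * (1 / gn P) else 0 := by
    intro z
    unfold divW
    rw [← Finset.prod_pow]
    calc ∏ P ∈ (primeSet R).filter (fun P => P ∣ z), (1 + 1 / gn P) ^ M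
        ≤ ∏ P ∈ (primeSet R).filter (fun P => P ∣ z), (1 + D * (1 / gn P)) := by
          refine Finset.prod_le_prod (fun P _ => ?_) fun P hP => ?_
          · have := gn_nonneg P; positivity
          · have hP0 := ne_zero_of_mem_primeSet P (Finset.mem_filter.1 hP).1
            have := one_le_gn hP0
            exact one_add_pow_le M (by positivity) ((div_le_one (by linarith)).2 this)
      _ = ∑ T ∈ ((primeSet R).filter (fun P => P ∣ z)).powerset, ∏ P ∈ T, D * (1 / gn P) :=
          Finset.prod_one_add _
      _ ≤ _ := by
          rw [← Finset.sum_filter]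
          refine Finset.sum_le_sum_of_subset_of_nonneg (fun T hT => ?_) fun T _ _ => h0 T
          rw [Finset.mem_powerset] at hT
          simp only [Finset.mem_filter, Finset.mem_powerset]
          refine ⟨hT.trans (Finset.filter_subset _ _), ?_⟩
          refine Finset.prod_dvd_of_coprime (fun P hP Q hQ hPQ => ?_)
            fun P hP => (Finset.mem_filter.1 (hT hP)).2
          exact (mem_primeSet.1 (Finset.mem_filter.1 (hT hP)).1).1.isCoprime
            (mem_primeSet.1 (Finset.mem_filter.1 (hT hQ)).1).1 hPQ
  calc ∑ z ∈ (gbox X).filter (fun z => z ≠ 0), divW R z ^ M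
      ≤ ∑ z ∈ (gbox X).filter (fun z => z ≠ 0), ∑ T ∈ (primeSet R).powerset,
          if ∏ P ∈ T, P ∣ z then ∏ P ∈ T, D * (1 / gn P) else 0 :=
        Finset.sum_le_sum fun z _ => h1 z
    _ = ∑ T ∈ (primeSet R).powerset,
          (((gbox X).filter fun z => z ≠ 0 ∧ ∏ P ∈ T, P ∣ z).card : ℝ) *
            ∏ P ∈ T, D * (1 / gn P) := by
        rw [Finset.sum_comm]
        refine Finset.sum_congr rfl fun T _ => ?_
        rw [← Finset.sum_filter, Finset.filter_filter, Finset.sum_const, nsmul_eq_mul]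
    _ ≤ ∑ T ∈ (primeSet R).powerset, 50 * (X : ℝ) ^ 2 * ∏ P ∈ T, D * (1 / gn P ^ 2) := by
        refine Finset.sum_le_sum fun T hT => ?_
        have hT0 : ∏ P ∈ T, P ≠ 0 := Finset.prod_ne_zero_iff.2 fun P hP =>
          ne_zero_of_mem_primeSet P (Finset.mem_powerset.1 hT hP)
        refine (mul_le_mul_of_nonneg_right (card_multiples_le X hT0) (h0 T)).trans (le_of_eq ?_)
        rw [gn_prod, div_eq_mul_one_div, mul_assoc]
        congr 1
        rw [one_div, ← Finset.prod_inv_distrib, ← Finset.prod_mul_distrib]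
        refine Finset.prod_congr rfl fun P _ => ?_
        ring
    _ = 50 * (X : ℝ) ^ 2 * ∏ P ∈ primeSet R, (1 + D * (1 / gn P ^ 2)) := by
        rw [← Finset.mul_sum, Finset.prod_one_add]
    _ ≤ 50 * (X : ℝ) ^ 2 * Real.exp (D * Z) := by
        gcongr
        calc ∏ P ∈ primeSet R, (1 + D * (1 / gn P ^ 2))
            ≤ ∏ P ∈ primeSet R, Real.exp (D * (1 / gn P ^ 2)) := by
              refine Finset.prod_le_prod (fun P _ => ?_) fun P _ => ?_
              · positivity
              · rw [add_comm]; exact Real.add_one_le_exp _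
          _ = Real.exp (D * ∑ P ∈ primeSet R, 1 / gn P ^ 2) := by
              rw [← Real.exp_sum, Finset.mul_sum]
          _ ≤ _ := Real.exp_le_exp.2 (mul_le_mul_of_nonneg_left
              (hb _ ne_zero_of_mem_primeSet) hD0)
    _ = _ := by ring

lemma exists_log_pow_le (k : ℕ) : ∃ C : ℝ, 0 < C ∧ ∀ N : ℕ, 1 ≤ N →
    Real.log N ^ k ≤ C * (N : ℝ) ^ (1 / 4 : ℝ) := by
  have hk : (0 : ℝ) < 1 / (4 * (k + 1)) := by positivity
  refine ⟨(4 * (k + 1)) ^ k, by positivity, fun N hN => ?_⟩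
  have hN' : (1 : ℝ) ≤ N := by exact_mod_cast hN
  have h := Real.log_le_rpow_div (x := N) (by linarith) hk
  calc Real.log N ^ k ≤ ((N : ℝ) ^ (1 / (4 * (k + 1)) : ℝ) / (1 / (4 * (k + 1)))) ^ k :=
        pow_le_pow_left₀ (Real.log_nonneg hN') h k
    _ = (4 * (k + 1)) ^ k * (N : ℝ) ^ (1 / (4 * (k + 1)) * k : ℝ) := by
        rw [div_div_eq_mul_div, div_one, mul_pow, ← Real.rpow_natCast ((N : ℝ) ^ _) k,
          ← Real.rpow_mul (by linarith), mul_comm]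
    _ ≤ _ := by
        refine mul_le_mul_of_nonneg_left (Real.rpow_le_rpow_of_exponent_le hN' ?_) (by positivity)
        rw [div_mul_eq_mul_div, one_mul, div_le_div_iff₀ (by positivity) (by norm_num)]
        linarith

/-- Cut-off parameter of the sieve. -/
def lvl (k N : ℕ) : ℕ := ⌊(N : ℝ) ^ (1 / (16 * k) : ℝ)⌋₊

section
variable {k N : ℕ}

lemma one_le_lvl (hN : 1 ≤ N) : 1 ≤ lvl k N := by
  rw [lvl, Nat.one_le_floor_iff]
  exact Real.one_le_rpow (by exact_mod_cast hN) (by positivity)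

lemma lvl_pow_le (hk : 1 ≤ k) : ((lvl k N ^ k : ℕ) : ℝ) ≤ (N : ℝ) ^ (1 / 16 : ℝ) := by
  have hk' : (k : ℝ) ≠ 0 := by positivity
  push_cast
  calc (lvl k N : ℝ) ^ k ≤ ((N : ℝ) ^ (1 / (16 * k) : ℝ)) ^ k := by
        gcongr; exact Nat.floor_le (by positivity)
    _ = _ := by
        rw [← Real.rpow_natCast, ← Real.rpow_mul (Nat.cast_nonneg _)]
        congr 1; field_simp

lemma log_lvl (hN : 1 ≤ N) : Real.log N / (16 * k) ≤ Real.log (lvl k N + 1) := by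
  have hN' : (0 : ℝ) < N := by exact_mod_cast hN
  have := (Nat.lt_floor_add_one ((N : ℝ) ^ (1 / (16 * k) : ℝ))).le
  have := Real.log_le_log (by positivity) this
  rw [Real.log_rpow hN'] at this
  calc Real.log N / (16 * k) = 1 / (16 * k) * Real.log N := by ring
    _ ≤ _ := this

/-- Half-side of the box containing all Gaussian integers of norm less than `N`. -/
def side (N : ℕ) : ℕ := Nat.sqrt N + 1

lemma sqrt_le_side : √(N : ℝ) ≤ side N := by
  have : N ≤ (side N) ^ 2 := (Nat.lt_succ_sqrt' N).le
  exact Real.sqrt_le_left (by positivity) |>.2 (by exact_mod_cast this)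

lemma side_le (hN : 1 ≤ N) : (side N : ℝ) ≤ 2 * √(N : ℝ) := by
  have h1 : (Nat.sqrt N : ℝ) ≤ √(N : ℝ) := Real.nat_sqrt_le_real_sqrt
  have h2 : (1 : ℝ) ≤ √(N : ℝ) := Real.one_le_sqrt.2 (by exact_mod_cast hN)
  rw [side]; push_cast; linarith

lemma mem_gbox_side {n : GaussianInt} (h : Zsqrtd.norm n < (N : ℤ)) : n ∈ gbox (side N) := by
  refine mem_gbox_of_gn_le ?_
  have h1 : gn n ≤ N := by rw [gn]; exact_mod_cast h.le
  have : N ≤ (side N) ^ 2 := (Nat.lt_succ_sqrt' N).le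
  exact h1.trans (by exact_mod_cast this)

lemma sum_gbox_le_boxSum (X : ℕ) {f : GaussianInt → ℝ} (hf : ∀ x, 0 ≤ f x) :
    ∑ x ∈ gbox X, f x ≤ boxSum (2 * X + 1) ⟨-(X : ℤ), -(X : ℤ)⟩ f := by
  unfold boxSum
  rw [← Finset.sum_product']
  refine sum_le_sum_of_injOn' (fun z => ((z.re + X).toNat, (z.im + X).toNat)) ?_ ?_ ?_
    fun _ _ => hf _
  · intro z hz
    rw [mem_gbox, abs_le, abs_le] at hz
    simp only [Finset.mem_product, Finset.mem_range]
    omega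
  · intro z hz w hw h
    rw [Finset.mem_coe, mem_gbox, abs_le, abs_le] at hz hw
    simp only [Prod.mk.injEq] at h
    refine Zsqrtd.ext ?_ ?_ <;> omega
  · intro z hz
    rw [mem_gbox, abs_le, abs_le] at hz
    refine le_of_eq (congrArg f ?_)
    refine Zsqrtd.ext ?_ ?_
    · simp only [Zsqrtd.re_add]; omega
    · simp only [Zsqrtd.im_add]; omega

lemma prod_biUnion_le {ι α : Type*} [DecidableEq α] (s : Finset ι) (t : ι → Finset α) {g : α → ℝ}
    (hg : ∀ a, 1 ≤ g a) : ∏ a ∈ s.biUnion t, g a ≤ ∏ i ∈ s, ∏ a ∈ t i, g a := by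
  classical
  induction s using Finset.induction_on with
  | empty => simp
  | insert i s hi ih =>
    rw [Finset.biUnion_insert, Finset.prod_insert hi]
    have h1 : 1 ≤ ∏ a ∈ t i ∩ s.biUnion t, g a := one_le_prod_real fun a _ => hg a
    have h2 : 0 ≤ ∏ a ∈ t i ∪ s.biUnion t, g a :=
      Finset.prod_nonneg fun a _ => zero_le_one.trans (hg a)
    calc ∏ a ∈ t i ∪ s.biUnion t, g a
        ≤ (∏ a ∈ t i ∪ s.biUnion t, g a) * ∏ a ∈ t i ∩ s.biUnion t, g a :=
          le_mul_of_one_le_right h2 h1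
      _ = (∏ a ∈ t i, g a) * ∏ a ∈ s.biUnion t, g a := Finset.prod_union_inter
      _ ≤ _ := mul_le_mul_of_nonneg_left ih (Finset.prod_nonneg fun a _ => zero_le_one.trans (hg a))

/-- The product of the weights `divW` of all differences of the tuple `y`. -/
def pairW (R : ℕ) (y : Fin k → GaussianInt) : ℝ :=
  ∏ x ∈ (Finset.univ : Finset (Fin k)).offDiag, divW R (y x.1 - y x.2)

lemma one_le_pairW (R : ℕ) (y : Fin k → GaussianInt) : 1 ≤ pairW R y :=
  one_le_prod_real fun _ _ => one_le_divW _ _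

lemma exists_bad_prod_le (k : ℕ) : ∃ B : ℝ, 0 < B ∧ ∀ (R : ℕ) (y : Fin k → GaussianInt),
    ∏ P ∈ (primeSet R).filter (fun P => ¬ GoodPrime y P), (1 + 1 / gn P) ≤ B * pairW R y := by
  refine ⟨2 ^ (gbox (2 * k)).card, by positivity, fun R y => ?_⟩
  set S := primeSet R
  have hg : ∀ P, 1 ≤ 1 + 1 / gn P := fun P => by
    have := gn_nonneg P
    have : 0 ≤ 1 / gn P := by positivity
    linarith
  set A := S.filter fun P => gn P < 2 * k
  set t : Fin k × Fin k → Finset GaussianInt := fun x => S.filter fun P => P ∣ y x.1 - y x.2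
  have hsub : S.filter (fun P => ¬ GoodPrime y P) ⊆
      A ∪ (Finset.univ : Finset (Fin k)).offDiag.biUnion t := by
    intro P hP
    rw [Finset.mem_filter, GoodPrime] at hP
    obtain ⟨hP, hb⟩ := hP
    simp only [Finset.mem_union, Finset.mem_biUnion, A, t, Finset.mem_filter, Finset.mem_offDiag,
      Finset.mem_univ, true_and, Prod.exists, hP]
    by_contra hcon
    push Not at hcon
    exact hb ⟨ne_zero_of_mem_primeSet P hP, hcon.1, fun i j hij => hcon.2 i j hij⟩
  have hA : ∏ P ∈ A, (1 + 1 / gn P) ≤ 2 ^ (gbox (2 * k)).card := by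
    calc ∏ P ∈ A, (1 + 1 / gn P) ≤ ∏ P ∈ A, (2 : ℝ) := by
          refine Finset.prod_le_prod (fun P _ => zero_le_one.trans (hg P)) fun P hP => ?_
          have := one_le_gn (ne_zero_of_mem_primeSet P (Finset.mem_filter.1 hP).1)
          have : 1 / gn P ≤ 1 := (div_le_one (by linarith)).2 this
          linarith
      _ = 2 ^ A.card := Finset.prod_const _
      _ ≤ _ := by
          refine pow_le_pow_right₀ (by norm_num) (Finset.card_le_card fun P hP => ?_)
          refine mem_gbox_of_gn_le' ?_
          have := (Finset.mem_filter.1 hP).2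
          push_cast; linarith
  calc ∏ P ∈ S.filter (fun P => ¬ GoodPrime y P), (1 + 1 / gn P)
      ≤ ∏ P ∈ A ∪ (Finset.univ : Finset (Fin k)).offDiag.biUnion t, (1 + 1 / gn P) := by
        rw [← Finset.prod_sdiff hsub]
        exact le_mul_of_one_le_left (Finset.prod_nonneg fun P _ => zero_le_one.trans (hg P))
          (one_le_prod_real fun P _ => hg P)
    _ ≤ (∏ P ∈ A, (1 + 1 / gn P)) *
          ∏ P ∈ (Finset.univ : Finset (Fin k)).offDiag.biUnion t, (1 + 1 / gn P) := by
        rw [← Finset.prod_union_inter]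
        exact le_mul_of_one_le_right (Finset.prod_nonneg fun P _ => zero_le_one.trans (hg P))
          (one_le_prod_real fun P _ => hg P)
    _ ≤ 2 ^ (gbox (2 * k)).card * pairW R y := by
        refine mul_le_mul hA (prod_biUnion_le _ t hg)
          (Finset.prod_nonneg fun P _ => zero_le_one.trans (hg P)) (by positivity)

/-- The elements of the box which avoid all the shifts `y i` modulo the small primes. -/
def sifted (k N : ℕ) (y : Fin k → GaussianInt) : Finset GaussianInt :=
  (gbox (side N)).filter fun x => ∀ P ∈ primeSet (lvl k N ^ k), ∀ i, ¬ P ∣ x - y i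

lemma exists_card_sifted_le (hk : 1 ≤ k) : ∃ C : ℝ, 0 < C ∧ ∀ N : ℕ, 2 ≤ N →
    ∀ y : Fin k → GaussianInt,
      Real.log N ^ k * (sifted k N y).card ≤ C * N * pairW (lvl k N ^ k) y ^ k := by
  obtain ⟨B, hB, hbad⟩ := exists_bad_prod_le k
  obtain ⟨c, hc, hlow⟩ := exists_log_le_lowW
  obtain ⟨D, hD, hlog⟩ := exists_log_pow_le k
  have hk' : (1 : ℝ) ≤ k := by exact_mod_cast hk
  refine ⟨100 * (16 * k * B / c) ^ k + 10 * D, by positivity, fun N hN y => ?_⟩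
  have hN1 : 1 ≤ N := by omega
  have hN' : (1 : ℝ) ≤ N := by exact_mod_cast hN1
  set r := lvl k N with hr
  set R := r ^ k with hR
  set H := pairW R y with hH
  set lg := Real.log N with hlg
  have hlgpos : 0 < lg := Real.log_pos (by exact_mod_cast hN)
  have hr1 : 1 ≤ r := one_le_lvl hN1
  have hR1 : 1 ≤ R := Nat.one_le_pow _ _ hr1
  have hrR : r ≤ R := Nat.le_self_pow (by omega) r
  have hH1 : 1 ≤ H := one_le_pairW R y
  have hRN : (R : ℝ) ≤ (N : ℝ) ^ (1 / 16 : ℝ) := lvl_pow_le hk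
  have hsq : √(N : ℝ) = (N : ℝ) ^ (1 / 2 : ℝ) := Real.sqrt_eq_rpow _
  set L := 2 * side N + 1 with hL
  have hL1 : (L : ℝ) ≤ 5 * √(N : ℝ) := by
    have h1 := side_le hN1
    have h2 : (1 : ℝ) ≤ √(N : ℝ) := Real.one_le_sqrt.2 hN'
    rw [hL]; push_cast; linarith
  have hRL : R ^ 2 ≤ L := by
    have h1 : (R : ℝ) ^ 2 ≤ √(N : ℝ) := by
      calc (R : ℝ) ^ 2 ≤ ((N : ℝ) ^ (1 / 16 : ℝ)) ^ 2 := by gcongr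
        _ = (N : ℝ) ^ (1 / 16 * 2 : ℝ) := by
            rw [Real.rpow_mul (by linarith)]; norm_cast
        _ ≤ (N : ℝ) ^ (1 / 2 : ℝ) := Real.rpow_le_rpow_of_exponent_le hN' (by norm_num)
        _ = _ := hsq.symm
    have h2 := sqrt_le_side (N := N)
    have h3 : (R : ℝ) ^ 2 ≤ L := by rw [hL]; push_cast; linarith
    exact_mod_cast h3
  set S := (primeSet R).filter fun P => GoodPrime y P with hS
  have hS0 : ∀ P ∈ S, P ≠ 0 := fun P hP => ne_zero_of_mem_primeSet P (Finset.mem_filter.1 hP).1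
  have hsieve := selberg_sieve hk (y := y) (S := S) (fun P hP => (Finset.mem_filter.1 hP).2)
    (fun P hP Q hQ h => (mem_primeSet.1 (Finset.mem_filter.1 hP).1).1.isCoprime
      (mem_primeSet.1 (Finset.mem_filter.1 hQ).1).1 h) hR1 hRL ⟨-(side N : ℤ), -(side N : ℤ)⟩
  have hcard : ((sifted k N y).card : ℝ) ≤
      4 * (L : ℝ) ^ 2 / selG k S R + 2 * L * (R : ℝ) ^ 4 := by
    refine le_trans ?_ hsieve
    refine le_trans ?_ (sum_gbox_le_boxSum _ fun x => by split_ifs <;> norm_num)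
    rw [sifted, Finset.card_filter]
    push_cast
    refine Finset.sum_le_sum fun x _ => ?_
    split_ifs with h1 h2
    · exact le_rfl
    · exact absurd (fun P hP => h1 P (Finset.mem_filter.1 hP).1) h2
    · exact zero_le_one
    · exact le_rfl
  have hG : (c * lg / (16 * k) / (B * H)) ^ k ≤ selG k S R := by
    have h1 : (R : ℝ) = (r : ℝ) ^ k := by rw [hR]; push_cast; rfl
    rw [h1]
    refine le_trans ?_ (lowW_pow_le_selG hS0 (fun P hP => ?_) r)
    · refine pow_le_pow_left₀ (by positivity) ?_ k
      rw [div_le_iff₀ (by positivity)]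
      calc c * lg / (16 * k) = c * (lg / (16 * k)) := by ring
        _ ≤ c * Real.log (r + 1) := mul_le_mul_of_nonneg_left (log_lvl hN1) hc.le
        _ ≤ lowW (fun P => 1 / gn P) (primeSet R) r := hlow r R hr1 hrR
        _ ≤ _ := lowW_remove (ne_zero_of_mem_primeSet)
            (fun P _ => by have := gn_nonneg P; positivity) (fun P => GoodPrime y P) r
        _ ≤ _ := mul_le_mul_of_nonneg_left (hbad R y)
            (lowW_nonneg fun P _ => by have := gn_nonneg P; positivity)
    · have := (Finset.mem_filter.1 hP).2.2.1
      linarith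
  have hGpos : 0 < (c * lg / (16 * k) / (B * H)) ^ k := by positivity
  have hm : lg ^ k * (4 * (L : ℝ) ^ 2 / selG k S R) ≤ 100 * (16 * k * B / c) ^ k * N * H ^ k := by
    calc lg ^ k * (4 * (L : ℝ) ^ 2 / selG k S R)
        ≤ lg ^ k * (4 * (5 * √(N : ℝ)) ^ 2 / (c * lg / (16 * k) / (B * H)) ^ k) := by gcongr
      _ = _ := by
          rw [mul_pow 5, Real.sq_sqrt (by linarith)]
          simp only [div_pow, mul_pow]
          field_simp
          norm_num
  have he : lg ^ k * (2 * L * (R : ℝ) ^ 4) ≤ 10 * D * N := by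
    have h4 : (R : ℝ) ^ 4 ≤ (N : ℝ) ^ (1 / 4 : ℝ) := by
      calc (R : ℝ) ^ 4 ≤ ((N : ℝ) ^ (1 / 16 : ℝ)) ^ 4 := by gcongr
        _ = (N : ℝ) ^ (1 / 16 * 4 : ℝ) := by
            rw [Real.rpow_mul (by linarith)]; norm_cast
        _ = _ := by norm_num
    calc lg ^ k * (2 * L * (R : ℝ) ^ 4)
        ≤ (D * (N : ℝ) ^ (1 / 4 : ℝ)) * (2 * (5 * √(N : ℝ)) * (N : ℝ) ^ (1 / 4 : ℝ)) := by
          gcongr; exact hlog N hN1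
      _ = 10 * D * ((N : ℝ) ^ (1 / 4 : ℝ) * (N : ℝ) ^ (1 / 4 : ℝ) * (N : ℝ) ^ (1 / 2 : ℝ)) := by
          rw [hsq]; ring
      _ = 10 * D * N := by
          rw [← Real.rpow_add (by linarith), ← Real.rpow_add (by linarith)]; norm_num
  calc lg ^ k * (sifted k N y).card
      ≤ lg ^ k * (4 * (L : ℝ) ^ 2 / selG k S R + 2 * L * (R : ℝ) ^ 4) := by gcongr
    _ = lg ^ k * (4 * (L : ℝ) ^ 2 / selG k S R) + lg ^ k * (2 * L * (R : ℝ) ^ 4) := mul_add _ _ _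
    _ ≤ 100 * (16 * k * B / c) ^ k * N * H ^ k + 10 * D * N * H ^ k := by
        refine add_le_add hm (he.trans (le_mul_of_one_le_right (by positivity) (one_le_pow₀ hH1)))
    _ = _ := by ring

end

lemma gvm_eq_zero_or (n : GaussianInt) : gvm n = 0 ∨ ∃ ρ : GaussianInt, Irreducible ρ ∧
    (∃ a : ℕ, 1 ≤ a ∧ ∃ u : GaussianInt, IsUnit u ∧ n = u * ρ ^ a) ∧ gvm n = Real.log (gn ρ) := by
  by_cases h : ∃ ρ : GaussianInt, Irreducible ρ ∧
      ∃ k : ℕ, 1 ≤ k ∧ ∃ u : GaussianInt, IsUnit u ∧ n = u * ρ ^ k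
  · right
    refine ⟨h.choose, h.choose_spec.1, h.choose_spec.2, ?_⟩
    rw [gvm, dif_pos h, gn, GaussianInt.intCast_real_norm]
  · left; rw [gvm, dif_neg h]

lemma gvm_nonneg (n : GaussianInt) : 0 ≤ gvm n := by
  rcases gvm_eq_zero_or n with h | ⟨ρ, hρ, -, h⟩
  · exact h.ge
  · rw [h]; exact Real.log_nonneg (one_le_gn hρ.ne_zero)

lemma gvm_le_log {n : GaussianInt} {N : ℕ} (hN : 1 ≤ N) (hn : Zsqrtd.norm n < (N : ℤ)) :
    gvm n ≤ Real.log N := by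
  have hN' : (1 : ℝ) ≤ N := by exact_mod_cast hN
  rcases gvm_eq_zero_or n with h | ⟨ρ, hρ, ⟨a, ha, u, hu, rfl⟩, h⟩
  · rw [h]; exact Real.log_nonneg hN'
  · rw [h]
    have h1 := one_le_gn hρ.ne_zero
    have h2 : gn (u * ρ ^ a) ≤ N := by rw [gn]; exact_mod_cast hn.le
    rw [gn_mul, gn_unit hu, one_mul, gn_pow] at h2
    exact Real.log_le_log (by linarith) ((le_self_pow₀ h1 (by omega)).trans h2)

/-- The von Mangoldt weight restricted to norms less than `N`. -/
def kap (N : ℕ) (n : GaussianInt) : ℝ := if Zsqrtd.norm n < (N : ℤ) then gvm n else 0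

lemma kap_nonneg (N : ℕ) (n : GaussianInt) : 0 ≤ kap N n := by
  unfold kap; split_ifs
  · exact gvm_nonneg n
  · exact le_rfl

lemma kap_le_log {N : ℕ} (hN : 1 ≤ N) (n : GaussianInt) : kap N n ≤ Real.log N := by
  unfold kap; split_ifs with h
  · exact gvm_le_log hN h
  · exact Real.log_nonneg (by exact_mod_cast hN)

lemma mem_gbox_of_kap_ne_zero {N : ℕ} {n : GaussianInt} (h : kap N n ≠ 0) : n ∈ gbox (side N) := by
  refine mem_gbox_side (by_contra fun hn => h ?_)
  rw [kap, if_neg hn]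

/-- Prime powers of norm less than `N` divisible by a prime of norm at most `R`. -/
def smallPow (N R : ℕ) : Finset GaussianInt :=
  (gbox (side N)).filter fun n => kap N n ≠ 0 ∧ ∃ P ∈ primeSet R, P ∣ n

lemma card_smallPow_le (N R : ℕ) :
    (smallPow N R).card ≤ 9 * (2 * R + 1) ^ 2 * (Nat.log 2 N + 1) := by
  have hsub : smallPow N R ⊆ (gbox 1 ×ˢ gbox R ×ˢ Finset.range (Nat.log 2 N + 1)).image
      fun x => x.1 * x.2.1 ^ x.2.2 := by
    intro n hn
    simp only [smallPow, Finset.mem_filter] at hn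
    obtain ⟨-, hk, P, hP, hd⟩ := hn
    have hnN : Zsqrtd.norm n < (N : ℤ) := by
      by_contra h; exact hk (by rw [kap, if_neg h])
    rw [kap, if_pos hnN] at hk
    rcases gvm_eq_zero_or n with h | ⟨ρ, hρ, ⟨a, ha, u, hu, rfl⟩, h⟩
    · exact absurd h hk
    · obtain ⟨hP1, hP2⟩ := mem_primeSet.1 hP
      have hPρ : P ∣ ρ := hP1.1.dvd_of_dvd_pow ((hu.dvd_mul_left).1 hd)
      have hass : Associated P ρ := hP1.1.irreducible.associated_of_dvd hρ hPρ
      rw [gn_associated hass] at hP2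
      simp only [Finset.mem_image, Finset.mem_product, Finset.mem_range, Prod.exists]
      refine ⟨u, ρ, a, ⟨mem_gbox_of_gn_le' (by rw [gn_unit hu]; simp), mem_gbox_of_gn_le' hP2, ?_⟩,
        rfl⟩
      have h1 : 2 ≤ gn ρ := by rw [← gn_associated hass]; exact two_le_gn hP1.1.ne_zero hP1.1.not_isUnit
      have h2 : gn (u * ρ ^ a) < N := by rw [gn]; exact_mod_cast hnN
      rw [gn_mul, gn_unit hu, one_mul, gn_pow] at h2
      have h3 : (2 : ℝ) ^ a < N := (pow_le_pow_left₀ (by norm_num) h1 a).trans_lt h2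
      have h4 : 2 ^ a < N := by exact_mod_cast h3
      have := Nat.le_log_of_pow_le (by norm_num) h4.le
      omega
  refine (Finset.card_le_card hsub).trans (Finset.card_image_le.trans (le_of_eq ?_))
  rw [Finset.card_product, Finset.card_product, card_gbox, card_gbox, Finset.card_range]
  ring

lemma exists_card_smallPow_le {k : ℕ} (hk : 1 ≤ k) : ∃ C : ℝ, 0 < C ∧ ∀ N : ℕ, 2 ≤ N →
    Real.log N ^ k * (smallPow N (lvl k N ^ k)).card ≤ C * N := by
  obtain ⟨D, hD, hlog⟩ := exists_log_pow_le (k + 1)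
  refine ⟨324 * D, by positivity, fun N hN => ?_⟩
  have hN1 : 1 ≤ N := by omega
  have hN' : (1 : ℝ) ≤ N := by exact_mod_cast hN1
  set R := lvl k N ^ k
  have hR1 : (1 : ℝ) ≤ R := by exact_mod_cast Nat.one_le_pow _ _ (one_le_lvl hN1)
  have hRN : (R : ℝ) ≤ (N : ℝ) ^ (1 / 16 : ℝ) := lvl_pow_le hk
  have hl2 : Real.log 2 ≤ Real.log N := Real.log_le_log (by norm_num) (by exact_mod_cast hN)
  have hl3 := Real.log_two_gt_d9
  have hlogN : (Nat.log 2 N : ℝ) + 1 ≤ 4 * Real.log N := by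
    have h1 : (2 : ℝ) ^ Nat.log 2 N ≤ N := by exact_mod_cast Nat.pow_log_le_self 2 (by omega)
    have h2 := Real.log_le_log (by positivity) h1
    rw [Real.log_pow] at h2
    have : (0 : ℝ) ≤ Nat.log 2 N := Nat.cast_nonneg _
    nlinarith
  have hl0 : 0 ≤ Real.log N := by linarith
  calc Real.log N ^ k * (smallPow N R).card
      ≤ Real.log N ^ k * (9 * (2 * R + 1) ^ 2 * (Nat.log 2 N + 1)) := by
        gcongr; exact_mod_cast card_smallPow_le N R
    _ ≤ Real.log N ^ k * (9 * (3 * R) ^ 2 * (4 * Real.log N)) := by gcongr; linarith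
    _ = 324 * Real.log N ^ (k + 1) * (R : ℝ) ^ 2 := by ring
    _ ≤ 324 * (D * (N : ℝ) ^ (1 / 4 : ℝ)) * ((N : ℝ) ^ (1 / 16 : ℝ)) ^ 2 := by
        gcongr; exact hlog N hN1
    _ = 324 * D * (N : ℝ) ^ (1 / 4 + 1 / 16 * 2 : ℝ) := by
        rw [Real.rpow_add (by linarith), Real.rpow_mul (by linarith)]; norm_cast; ring
    _ ≤ 324 * D * (N : ℝ) ^ (1 : ℝ) := by
        gcongr
        norm_num
    _ = _ := by rw [Real.rpow_one]

/-- The correlation of the von Mangoldt weights translated by the tuple `y`. -/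
def corr {k : ℕ} (N : ℕ) (y : Fin k → GaussianInt) : ℝ :=
  ∑ x ∈ gbox (side N), ∏ i, kap N (x - y i)

lemma corr_nonneg {k : ℕ} (N : ℕ) (y : Fin k → GaussianInt) : 0 ≤ corr N y :=
  Finset.sum_nonneg fun _ _ => Finset.prod_nonneg fun _ _ => kap_nonneg _ _

lemma card_gbox_side_le {N : ℕ} (hN : 1 ≤ N) (j : ℕ) (hj : 1 ≤ j) :
    ((gbox (j * side N)).card : ℝ) ≤ 25 * (j : ℝ) ^ 2 * N := by
  have h1 := side_le hN
  have hN' : (1 : ℝ) ≤ N := by exact_mod_cast hN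
  have h2 : (1 : ℝ) ≤ √(N : ℝ) := Real.one_le_sqrt.2 hN'
  have hj' : (1 : ℝ) ≤ j := by exact_mod_cast hj
  rw [card_gbox]; push_cast
  calc (2 * ((j : ℝ) * side N) + 1) ^ 2 ≤ (5 * j * √(N : ℝ)) ^ 2 := by
        gcongr; nlinarith
    _ = _ := by rw [mul_pow, Real.sq_sqrt (by linarith)]; ring

lemma corr_le_trivial {k N : ℕ} (hN : 1 ≤ N) (y : Fin k → GaussianInt) :
    corr N y ≤ 25 * N * Real.log N ^ k := by
  have hl0 : 0 ≤ Real.log N := Real.log_nonneg (by exact_mod_cast hN)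
  calc corr N y ≤ ∑ x ∈ gbox (side N), Real.log N ^ k := by
        refine Finset.sum_le_sum fun x _ => ?_
        calc ∏ i, kap N (x - y i) ≤ ∏ _i : Fin k, Real.log N :=
              Finset.prod_le_prod (fun _ _ => kap_nonneg _ _) fun _ _ => kap_le_log hN _
          _ = _ := by simp
    _ = (gbox (side N)).card * Real.log N ^ k := by rw [Finset.sum_const, nsmul_eq_mul]
    _ ≤ _ := by
        have := card_gbox_side_le hN 1 le_rfl
        rw [one_mul] at this
        gcongr; simpa using this

lemma exists_corr_le {k : ℕ} (hk : 1 ≤ k) : ∃ C : ℝ, 0 < C ∧ ∀ N : ℕ, 2 ≤ N →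
    ∀ y : Fin k → GaussianInt, corr N y ≤ C * N * pairW (lvl k N ^ k) y ^ k := by
  obtain ⟨C₁, hC₁, h₁⟩ := exists_card_sifted_le hk
  obtain ⟨C₂, hC₂, h₂⟩ := exists_card_smallPow_le hk
  refine ⟨k * C₂ + C₁, by positivity, fun N hN y => ?_⟩
  have hN1 : 1 ≤ N := by omega
  have hl0 : 0 ≤ Real.log N := Real.log_nonneg (by exact_mod_cast hN1)
  set R := lvl k N ^ k with hR
  have hH := one_le_pow₀ (one_le_pairW R y) (n := k)
  have hpt : ∀ x ∈ gbox (side N), ∏ i, kap N (x - y i) ≤ Real.log N ^ k *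
      ((∑ i, if x - y i ∈ smallPow N R then (1 : ℝ) else 0) +
        if ∀ P ∈ primeSet R, ∀ i, ¬ P ∣ x - y i then 1 else 0) := by
    intro x _
    have hs0 : ∀ i ∈ (Finset.univ : Finset (Fin k)),
        0 ≤ if x - y i ∈ smallPow N R then (1 : ℝ) else 0 :=
      fun i _ => by split_ifs <;> norm_num
    by_cases h0 : ∏ i, kap N (x - y i) = 0
    · rw [h0]
      refine mul_nonneg (pow_nonneg hl0 _) (add_nonneg (Finset.sum_nonneg hs0) ?_)
      split_ifs <;> norm_num
    · have hle : ∏ i, kap N (x - y i) ≤ Real.log N ^ k := by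
        calc ∏ i, kap N (x - y i) ≤ ∏ _i : Fin k, Real.log N :=
              Finset.prod_le_prod (fun _ _ => kap_nonneg _ _) fun _ _ => kap_le_log hN1 _
          _ = _ := by simp
      refine hle.trans (le_mul_of_one_le_right (pow_nonneg hl0 _) ?_)
      rw [← ne_eq, Finset.prod_ne_zero_iff] at h0
      split_ifs with h
      · linarith [Finset.sum_nonneg hs0]
      · push Not at h
        obtain ⟨P, hP, i, hd⟩ := h
        have hm : x - y i ∈ smallPow N R := by
          rw [smallPow, Finset.mem_filter]
          have := h0 i (Finset.mem_univ _)
          exact ⟨mem_gbox_of_kap_ne_zero this, this, P, hP, hd⟩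
        have := Finset.single_le_sum hs0 (Finset.mem_univ i)
        rw [if_pos hm] at this
        linarith
  have hcs : ∀ i, ∑ x ∈ gbox (side N), (if x - y i ∈ smallPow N R then (1 : ℝ) else 0) ≤
      (smallPow N R).card := by
    intro i
    rw [← Finset.sum_filter, Finset.sum_const, nsmul_eq_mul, mul_one, Nat.cast_le]
    refine Finset.card_le_card_of_injOn (fun x => x - y i) (fun x hx => ?_)
      fun a _ b _ h => sub_left_injective h
    simp only [Finset.coe_filter, Set.mem_ofPred_eq] at hx
    exact hx.2
  calc corr N y ≤ ∑ x ∈ gbox (side N), Real.log N ^ k *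
        ((∑ i, if x - y i ∈ smallPow N R then (1 : ℝ) else 0) +
        if ∀ P ∈ primeSet R, ∀ i, ¬ P ∣ x - y i then 1 else 0) := Finset.sum_le_sum hpt
    _ = Real.log N ^ k * (∑ i, ∑ x ∈ gbox (side N),
          (if x - y i ∈ smallPow N R then (1 : ℝ) else 0)) +
          Real.log N ^ k * (sifted k N y).card := by
        rw [← Finset.mul_sum, Finset.sum_add_distrib, Finset.sum_comm, mul_add, sifted,
          Finset.card_filter]
        push_cast; rfl
    _ ≤ Real.log N ^ k * (∑ _i : Fin k, ((smallPow N R).card : ℝ)) +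
          C₁ * N * pairW R y ^ k := by
        refine add_le_add (mul_le_mul_of_nonneg_left (Finset.sum_le_sum fun i _ => hcs i)
          (pow_nonneg hl0 _)) (h₁ N hN y)
    _ = k * (Real.log N ^ k * (smallPow N R).card) + C₁ * N * pairW R y ^ k := by
        simp only [Finset.sum_const, Finset.card_univ, Fintype.card_fin, nsmul_eq_mul]; ring
    _ ≤ k * (C₂ * N) * pairW R y ^ k + C₁ * N * pairW R y ^ k := by
        refine add_le_add ?_ le_rfl
        refine le_trans ?_ (le_mul_of_one_le_right (by positivity) hH)
        exact mul_le_mul_of_nonneg_left (h₂ N hN) (Nat.cast_nonneg _)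
    _ = _ := by ring

lemma prod_le_one_add_sum_pow {ι : Type*} (s : Finset ι) {f : ι → ℝ} (hf : ∀ i, 1 ≤ f i) :
    ∏ i ∈ s, f i ≤ 1 + ∑ i ∈ s, f i ^ s.card := by
  rcases s.eq_empty_or_nonempty with rfl | hs
  · simp
  · obtain ⟨j, hj, hmax⟩ := s.exists_max_image f hs
    have h0 : ∀ i, 0 ≤ f i := fun i => zero_le_one.trans (hf i)
    have h1 : ∏ i ∈ s, f i ≤ f j ^ s.card := by
      rw [← Finset.prod_const]
      exact Finset.prod_le_prod (fun i _ => h0 i) hmax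
    have h2 := Finset.single_le_sum (f := fun i => f i ^ s.card)
      (fun i _ => pow_nonneg (h0 i) _) hj
    linarith

lemma sum_pair_diff_le {k : ℕ} {i j : Fin k} (hij : i ≠ j) (Y : ℕ) {F : GaussianInt → ℝ}
    (hF : ∀ z, 0 ≤ F z) :
    ∑ y ∈ Fintype.piFinset (fun _ : Fin k => gbox Y), F (y i - y j) ≤
      ((gbox Y).card : ℝ) ^ (k - 1) * ∑ z ∈ gbox (2 * Y), F z := by
  set t : Fin k → Finset GaussianInt := fun l => if l = i then {0} else gbox Y with ht
  have hcard : (Fintype.piFinset t).card = (gbox Y).card ^ (k - 1) := by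
    rw [Fintype.card_piFinset]
    have : ∀ l, (t l).card = if l = i then 1 else (gbox Y).card := by
      intro l; simp only [ht]; split_ifs <;> simp
    simp only [this]
    rw [Finset.prod_ite, Finset.prod_const_one, one_mul, Finset.prod_const, Finset.filter_ne',
      Finset.card_erase_of_mem (Finset.mem_univ i), Finset.card_univ, Fintype.card_fin]
  calc ∑ y ∈ Fintype.piFinset (fun _ : Fin k => gbox Y), F (y i - y j)
      ≤ ∑ x ∈ gbox (2 * Y) ×ˢ Fintype.piFinset t, F x.1 := by
        refine sum_le_sum_of_injOn' (fun y => (y i - y j, Function.update y i 0)) ?_ ?_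
          (fun y _ => le_rfl) fun x _ => hF _
        · intro y hy
          rw [Fintype.mem_piFinset] at hy
          simp only [Finset.mem_product, Fintype.mem_piFinset]
          refine ⟨?_, fun l => ?_⟩
          · have h1 := hy i
            have h2 := hy j
            rw [mem_gbox, abs_le, abs_le] at *
            simp only [Zsqrtd.re_sub, Zsqrtd.im_sub]
            push_cast
            refine ⟨⟨?_, ?_⟩, ?_, ?_⟩ <;> omega
          · simp only [ht]
            split_ifs with h
            · subst h; simp
            · rw [Function.update_of_ne h]; exact hy l
        · intro y _ y' _ h
          simp only [Prod.mk.injEq] at h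
          obtain ⟨h1, h2⟩ := h
          have h3 : ∀ l, l ≠ i → y l = y' l := fun l hl => by
            have := congrFun h2 l
            rwa [Function.update_of_ne hl, Function.update_of_ne hl] at this
          funext l
          by_cases hl : l = i
          · subst hl
            rw [h3 j hij.symm] at h1
            exact sub_left_injective h1
          · exact h3 l hl
    _ = _ := by
        rw [Finset.sum_product]
        simp only [Finset.sum_const, nsmul_eq_mul]
        rw [← Finset.mul_sum, hcard]; push_cast; rfl

lemma exists_corr_moment {k : ℕ} (hk : 1 ≤ k) : ∃ C : ℝ, 0 < C ∧ ∀ N : ℕ, 2 ≤ N →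
    ∑ y ∈ Fintype.piFinset (fun _ : Fin k => gbox (2 * side N)), corr N y ^ k ≤
      C * (N : ℝ) ^ (2 * k) := by
  obtain ⟨C₁, hC₁, h₁⟩ := exists_corr_le hk
  set I := (Finset.univ : Finset (Fin k)).offDiag with hI
  obtain ⟨C₂, hC₂, h₂⟩ := exists_divW_moment (k * k * I.card)
  obtain ⟨C₃, hC₃, h₃⟩ := exists_log_pow_le (k * k)
  set A := C₁ + 25 with hA
  set E := C₃ + 64 * C₂ with hE
  refine ⟨A ^ k * (100 ^ k + I.card * (100 ^ k * E)), by positivity, fun N hN => ?_⟩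
  have hN1 : 1 ≤ N := by omega
  have hN' : (1 : ℝ) ≤ N := by exact_mod_cast hN1
  have hl0 : 0 ≤ Real.log N := Real.log_nonneg hN'
  set R := lvl k N ^ k with hR
  set F : GaussianInt → ℝ := fun z =>
    if z = 0 then Real.log N ^ (k * k) else divW R z ^ (k * k * I.card) with hF
  have hF0 : ∀ z, 0 ≤ F z := by
    intro z; simp only [hF]; split_ifs
    · positivity
    · exact pow_nonneg (zero_le_one.trans (one_le_divW R z)) _
  have hFs : ∑ z ∈ gbox (2 * (2 * side N)), F z ≤ E * N := by
    rw [← Finset.sum_filter_add_sum_filter_not _ (fun z : GaussianInt => z ≠ 0)]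
    have e1 : ∑ z ∈ (gbox (2 * (2 * side N))).filter (fun z => z ≠ 0), F z ≤ 64 * C₂ * N := by
      calc ∑ z ∈ (gbox (2 * (2 * side N))).filter (fun z => z ≠ 0), F z
          = ∑ z ∈ (gbox (2 * (2 * side N))).filter (fun z => z ≠ 0),
              divW R z ^ (k * k * I.card) :=
            Finset.sum_congr rfl fun z hz => if_neg (Finset.mem_filter.1 hz).2
        _ ≤ C₂ * ((2 * (2 * side N) : ℕ) : ℝ) ^ 2 := h₂ R _
        _ ≤ C₂ * (8 * √(N : ℝ)) ^ 2 := by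
            have := side_le hN1
            gcongr; push_cast; linarith
        _ = _ := by rw [mul_pow, Real.sq_sqrt (by linarith)]; ring
    have e2 : ∑ z ∈ (gbox (2 * (2 * side N))).filter (fun z => ¬ z ≠ 0), F z ≤ C₃ * N := by
      calc ∑ z ∈ (gbox (2 * (2 * side N))).filter (fun z => ¬ z ≠ 0), F z
          ≤ ∑ z ∈ {0}, F z := by
            refine Finset.sum_le_sum_of_subset_of_nonneg (fun z hz => ?_) fun z _ _ => hF0 z
            simpa using (Finset.mem_filter.1 hz).2
        _ = Real.log N ^ (k * k) := by simp [hF]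
        _ ≤ C₃ * (N : ℝ) ^ (1 / 4 : ℝ) := h₃ N hN1
        _ ≤ C₃ * (N : ℝ) ^ (1 : ℝ) := by gcongr; norm_num
        _ = _ := by rw [Real.rpow_one]
    rw [hE, add_mul]; linarith
  have hpt : ∀ y : Fin k → GaussianInt,
      corr N y ^ k ≤ (A * N) ^ k * (1 + ∑ x ∈ I, F (y x.1 - y x.2)) := by
    intro y
    have hs0 : 0 ≤ ∑ x ∈ I, F (y x.1 - y x.2) := Finset.sum_nonneg fun _ _ => hF0 _
    by_cases hy : Function.Injective y
    · calc corr N y ^ k ≤ (C₁ * N * pairW R y ^ k) ^ k :=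
            pow_le_pow_left₀ (corr_nonneg N y) (h₁ N hN y) k
        _ = (C₁ * N) ^ k * pairW R y ^ (k * k) := by rw [mul_pow, ← pow_mul]
        _ ≤ (A * N) ^ k * (1 + ∑ x ∈ I, F (y x.1 - y x.2)) := by
            have hle : C₁ ≤ A := by linarith
            have : 0 ≤ pairW R y := zero_le_one.trans (one_le_pairW R y)
            gcongr
            rw [pairW, ← Finset.prod_pow]
            refine (prod_le_one_add_sum_pow _ fun x => one_le_pow₀ (one_le_divW _ _)).trans ?_
            refine add_le_add le_rfl (Finset.sum_le_sum fun x hx => ?_)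
            have : y x.1 - y x.2 ≠ 0 := by
              rw [sub_ne_zero]
              exact fun h => (Finset.mem_offDiag.1 hx).2.2 (hy h)
            simp only [hF]
            rw [if_neg this, ← pow_mul]
    · rw [Function.not_injective_iff] at hy
      obtain ⟨i, j, hij, hne⟩ := hy
      calc corr N y ^ k ≤ (25 * N * Real.log N ^ k) ^ k :=
            pow_le_pow_left₀ (corr_nonneg N y) (corr_le_trivial hN1 y) k
        _ = (25 * N) ^ k * Real.log N ^ (k * k) := by rw [mul_pow, ← pow_mul]
        _ ≤ (A * N) ^ k * (1 + ∑ x ∈ I, F (y x.1 - y x.2)) := by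
            have hle : 25 ≤ A := by linarith
            gcongr
            have h := Finset.single_le_sum (f := fun x : Fin k × Fin k => F (y x.1 - y x.2))
              (fun _ _ => hF0 _) (show (i, j) ∈ I from by simp [hI, hne])
            simp only [hij, sub_self] at h
            have h0 : F 0 = Real.log N ^ (k * k) := by simp [hF]
            linarith
  have hB : ((gbox (2 * side N)).card : ℝ) ≤ 100 * N := by
    have := card_gbox_side_le hN1 2 (by norm_num)
    refine this.trans (le_of_eq ?_); norm_num
  calc ∑ y ∈ Fintype.piFinset (fun _ : Fin k => gbox (2 * side N)), corr N y ^ k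
      ≤ ∑ y ∈ Fintype.piFinset (fun _ : Fin k => gbox (2 * side N)),
          (A * N) ^ k * (1 + ∑ x ∈ I, F (y x.1 - y x.2)) := Finset.sum_le_sum fun y _ => hpt y
    _ = (A * N) ^ k * (((gbox (2 * side N)).card : ℝ) ^ k +
          ∑ x ∈ I, ∑ y ∈ Fintype.piFinset (fun _ : Fin k => gbox (2 * side N)),
            F (y x.1 - y x.2)) := by
        rw [← Finset.mul_sum, Finset.sum_add_distrib, Finset.sum_comm, Finset.sum_const,
          Fintype.card_piFinset]
        simp
    _ ≤ (A * N) ^ k * ((100 * N) ^ k + ∑ x ∈ I, (100 * N) ^ (k - 1) * (E * N)) := by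
        refine mul_le_mul_of_nonneg_left (add_le_add ?_ (Finset.sum_le_sum fun x hx => ?_))
          (by positivity)
        · gcongr
        · refine (sum_pair_diff_le (Finset.mem_offDiag.1 hx).2.2 _ hF0).trans ?_
          refine mul_le_mul ?_ hFs (Finset.sum_nonneg fun _ _ => hF0 _) (by positivity)
          gcongr
    _ ≤ (A * N) ^ k * ((100 * N) ^ k + I.card * ((100 * N) ^ k * E)) := by
        rw [Finset.sum_const, nsmul_eq_mul]
        have hstep : (100 * (N : ℝ)) ^ (k - 1) * (E * N) ≤ (100 * N) ^ k * E := by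
          obtain ⟨m, rfl⟩ := Nat.exists_eq_add_of_le' hk
          rw [Nat.add_sub_cancel]
          calc (100 * (N : ℝ)) ^ m * (E * N) = (100 * N) ^ m * N * E := by ring
            _ ≤ (100 * N) ^ m * (100 * N) * E := by gcongr; linarith
            _ = _ := by rw [pow_succ]
        refine mul_le_mul_of_nonneg_left (add_le_add le_rfl ?_) (by positivity)
        exact mul_le_mul_of_nonneg_left hstep (Nat.cast_nonneg _)
    _ = _ := by
        rw [mul_pow, mul_pow, two_mul, pow_add]; ring

lemma sum_pow_conv_eq (k N : ℕ) (g : GaussianInt → ℝ) :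
    ∑ x ∈ gbox (side N), (∑ y ∈ gbox (2 * side N), kap N (x - y) * g y) ^ k =
      ∑ y ∈ Fintype.piFinset (fun _ : Fin k => gbox (2 * side N)),
        (∏ i, g (y i)) * corr N y := by
  have h : ∀ x, (∑ y ∈ gbox (2 * side N), kap N (x - y) * g y) ^ k =
      ∑ y ∈ Fintype.piFinset (fun _ : Fin k => gbox (2 * side N)),
        (∏ i, g (y i)) * ∏ i, kap N (x - y i) := by
    intro x
    have := Finset.prod_univ_sum (fun _ : Fin k => gbox (2 * side N))
      (fun _ y => kap N (x - y) * g y)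
    rw [Finset.prod_const, Finset.card_univ, Fintype.card_fin] at this
    rw [this]
    refine Finset.sum_congr rfl fun y _ => ?_
    rw [Finset.prod_mul_distrib, mul_comm]
  simp only [h, corr, Finset.mul_sum]
  rw [Finset.sum_comm]

lemma exists_corr_rpow_moment {k : ℕ} (hk : 1 ≤ k) {q : ℝ} (hq0 : 0 ≤ q) (hqk : q ≤ k) :
    ∃ C : ℝ, 0 < C ∧ ∀ N : ℕ, 2 ≤ N →
      ∑ y ∈ Fintype.piFinset (fun _ : Fin k => gbox (2 * side N)), corr N y ^ q ≤
        C * (N : ℝ) ^ (q + k) := by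
  obtain ⟨C, hC, h⟩ := exists_corr_moment hk
  refine ⟨100 ^ k + C, by positivity, fun N hN => ?_⟩
  have hN1 : 1 ≤ N := by omega
  have hN' : (0 : ℝ) < N := by exact_mod_cast hN1
  have hB : ((gbox (2 * side N)).card : ℝ) ≤ 100 * N := by
    have := card_gbox_side_le hN1 2 (by norm_num)
    refine this.trans (le_of_eq ?_); norm_num
  have hpt : ∀ y : Fin k → GaussianInt,
      corr N y ^ q ≤ (N : ℝ) ^ q * (1 + corr N y ^ k / (N : ℝ) ^ k) := by
    intro y
    have h0 := corr_nonneg N y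
    have e : corr N y ^ q = (N : ℝ) ^ q * (corr N y / N) ^ q := by
      rw [← Real.mul_rpow hN'.le (by positivity), mul_div_cancel₀ _ hN'.ne']
    rw [e, ← div_pow]
    have h1 : 0 ≤ corr N y / N := by positivity
    refine mul_le_mul_of_nonneg_left ?_ (by positivity)
    rcases le_total (corr N y / N) 1 with h2 | h2
    · have := Real.rpow_le_one h1 h2 hq0
      linarith [pow_nonneg h1 k]
    · have := Real.rpow_le_rpow_of_exponent_le h2 hqk
      rw [Real.rpow_natCast] at this
      linarith
  calc ∑ y ∈ Fintype.piFinset (fun _ : Fin k => gbox (2 * side N)), corr N y ^ q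
      ≤ ∑ y ∈ Fintype.piFinset (fun _ : Fin k => gbox (2 * side N)),
          (N : ℝ) ^ q * (1 + corr N y ^ k / (N : ℝ) ^ k) := Finset.sum_le_sum fun y _ => hpt y
    _ = (N : ℝ) ^ q * (((gbox (2 * side N)).card : ℝ) ^ k +
          (∑ y ∈ Fintype.piFinset (fun _ : Fin k => gbox (2 * side N)), corr N y ^ k) /
            (N : ℝ) ^ k) := by
        rw [← Finset.mul_sum, Finset.sum_add_distrib, Finset.sum_const,
          Fintype.card_piFinset, Finset.sum_div]
        simp
    _ ≤ (N : ℝ) ^ q * ((100 * N) ^ k + C * (N : ℝ) ^ (2 * k) / (N : ℝ) ^ k) := by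
        gcongr; exact h N hN
    _ = _ := by
        rw [Real.rpow_add hN', Real.rpow_natCast, two_mul, pow_add, mul_pow]
        field_simp

lemma le_of_rpow_le {p q k N D G s : ℝ} (hp0 : 0 < p) (hq0 : 0 < q) (hk0 : 0 < k) (hN : 0 < N)
    (hD : 0 < D) (hG : 0 ≤ G) (hs : 0 ≤ s)
    (h : s ^ (k / q) ≤ D * N ^ (2 * k / q) * G ^ (k / p)) :
    s ≤ D ^ (q / k) * N ^ 2 * G ^ (q / p) := by
  calc s = (s ^ (k / q)) ^ (q / k) := by
        rw [← Real.rpow_mul hs, div_mul_div_cancel₀ hq0.ne', div_self hk0.ne', Real.rpow_one]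
    _ ≤ (D * N ^ (2 * k / q) * G ^ (k / p)) ^ (q / k) :=
        Real.rpow_le_rpow (by positivity) h (by positivity)
    _ = _ := by
        rw [Real.mul_rpow (by positivity) (by positivity),
          Real.mul_rpow (by positivity) (by positivity), ← Real.rpow_mul hN.le,
          ← Real.rpow_mul hG, ← Real.rpow_natCast]
        have h1 : 2 * k / q * (q / k) = ((2 : ℕ) : ℝ) := by push_cast; field_simp
        have h2 : k / p * (q / k) = q / p := by field_simp
        rw [h1, h2]

/-- The improving estimate on a single box. -/
lemma exists_local_bound {p q : ℝ} (hpq : p.HolderConjugate q) : ∃ C : ℝ, 0 < C ∧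
    ∀ N : ℕ, 2 ≤ N → ∀ g : GaussianInt → ℝ, (∀ y, 0 ≤ g y) →
      ∑ x ∈ gbox (side N), (∑ y ∈ gbox (2 * side N), kap N (x - y) * g y) ^ q ≤
        C * (N : ℝ) ^ 2 * (∑ y ∈ gbox (2 * side N), g y ^ p) ^ (q / p) := by
  have hp0 : 0 < p := hpq.pos
  have hq0 : 0 < q := hpq.symm.pos
  have hq1 : 1 < q := hpq.symm.lt
  obtain ⟨k, hqk⟩ := exists_nat_ge q
  have hk : 1 ≤ k := by
    have : (0 : ℝ) < k := hq0.trans_le hqk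
    exact_mod_cast this
  have hk0 : (0 : ℝ) < k := hq0.trans_le hqk
  obtain ⟨C, hC, hmom⟩ := exists_corr_rpow_moment hk hq0.le hqk
  set D : ℝ := 25 ^ (k / q - 1) * C ^ (1 / q) with hD
  refine ⟨D ^ (q / k), by positivity, fun N hN g hg => ?_⟩
  have hN1 : 1 ≤ N := by omega
  have hN' : (0 : ℝ) < N := by exact_mod_cast hN1
  set F : GaussianInt → ℝ := fun x => ∑ y ∈ gbox (2 * side N), kap N (x - y) * g y with hF
  change ∑ x ∈ gbox (side N), F x ^ q ≤ _
  have hF0 : ∀ x, 0 ≤ F x := fun x =>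
    Finset.sum_nonneg fun y _ => mul_nonneg (kap_nonneg _ _) (hg y)
  set G := ∑ y ∈ gbox (2 * side N), g y ^ p with hG
  have hG0 : 0 ≤ G := Finset.sum_nonneg fun y _ => Real.rpow_nonneg (hg y) p
  have hGk : ∑ y ∈ Fintype.piFinset (fun _ : Fin k => gbox (2 * side N)), (∏ i, g (y i)) ^ p =
      G ^ k := by
    have := Finset.prod_univ_sum (fun _ : Fin k => gbox (2 * side N)) (fun _ y => g y ^ p)
    rw [Finset.prod_const, Finset.card_univ, Fintype.card_fin] at this
    rw [hG, this]
    exact Finset.sum_congr rfl fun y _ => (Real.finsetProd_rpow _ _ (fun i _ => hg _) p).symm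
  have hFk : ∑ x ∈ gbox (side N), F x ^ k ≤
      C ^ (1 / q) * (N : ℝ) ^ (1 + k / q) * G ^ (k / p) := by
    rw [hF, sum_pow_conv_eq]
    refine (Real.inner_le_Lp_mul_Lq_of_nonneg _ hpq
      (fun y _ => Finset.prod_nonneg fun i _ => hg _) (fun y _ => corr_nonneg N y)).trans ?_
    rw [hGk, mul_comm]
    refine mul_le_mul ?_ (le_of_eq ?_) (by positivity) (by positivity)
    · calc (∑ y ∈ Fintype.piFinset (fun _ : Fin k => gbox (2 * side N)), corr N y ^ q) ^ (1 / q)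
          ≤ (C * (N : ℝ) ^ (q + k)) ^ (1 / q) :=
            Real.rpow_le_rpow (Finset.sum_nonneg fun y _ => Real.rpow_nonneg (corr_nonneg N y) q)
              (hmom N hN) (by positivity)
        _ = _ := by
            rw [Real.mul_rpow hC.le (by positivity), ← Real.rpow_mul hN'.le]
            congr 2; field_simp
    · rw [← Real.rpow_natCast, ← Real.rpow_mul hG0]; congr 1; ring
  have hD0 : 0 < D := by positivity
  clear_value F G D
  have hkq : 1 ≤ k / q := (one_le_div hq0).2 hqk
  have hmean : (∑ x ∈ gbox (side N), F x ^ q) ^ (k / q) ≤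
      D * (N : ℝ) ^ (2 * k / q) * G ^ (k / p) := by
    have h1 := Real.rpow_sum_le_const_mul_sum_rpow_of_nonneg (gbox (side N))
      (f := fun x => F x ^ q) hkq (fun x _ => Real.rpow_nonneg (hF0 x) q)
    have e : ∀ x, (F x ^ q) ^ (k / q) = F x ^ k := fun x => by
      rw [← Real.rpow_mul (hF0 x), mul_div_cancel₀ _ hq0.ne', Real.rpow_natCast]
    simp only [e] at h1
    refine h1.trans ?_
    have hB : ((gbox (side N)).card : ℝ) ≤ 25 * N := by
      have := card_gbox_side_le hN1 1 le_rfl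
      rw [one_mul] at this
      simpa using this
    calc ((gbox (side N)).card : ℝ) ^ (k / q - 1) * ∑ x ∈ gbox (side N), F x ^ k
        ≤ (25 * N) ^ (k / q - 1) * (C ^ (1 / q) * (N : ℝ) ^ (1 + k / q) * G ^ (k / p)) := by
          refine mul_le_mul (Real.rpow_le_rpow (Nat.cast_nonneg _) hB (by linarith)) hFk
            (Finset.sum_nonneg fun x _ => pow_nonneg (hF0 x) k) (by positivity)
      _ = D * ((N : ℝ) ^ (k / q - 1) * (N : ℝ) ^ (1 + k / q)) * G ^ (k / p) := by
          rw [Real.mul_rpow (by norm_num) hN'.le, hD]; ring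
      _ = _ := by
          rw [← Real.rpow_add hN']
          congr 3; ring
  have hs0 : 0 ≤ ∑ x ∈ gbox (side N), F x ^ q :=
    Finset.sum_nonneg fun x _ => Real.rpow_nonneg (hF0 x) q
  exact le_of_rpow_le hp0 hq0 hk0 hN' hD0 hG0 hs0 hmean

/-- The convolution of the truncated von Mangoldt weight with `h`. -/
def kconv (N : ℕ) (h : GaussianInt → ℝ) (x : GaussianInt) : ℝ :=
  ∑ n ∈ gbox (side N), kap N n * h (x - n)

lemma kconv_le_sum {N : ℕ} {h : GaussianInt → ℝ} (hh : ∀ x, 0 ≤ h x) {c d : GaussianInt}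
    (hd : d ∈ gbox (side N)) :
    kconv N h (d + c) ≤ ∑ y ∈ gbox (2 * side N), kap N (d - y) * h (y + c) := by
  refine sum_le_sum_of_injOn' (fun n => d - n) (fun n hn => ?_) (fun a _ b _ hab => ?_)
    (fun n _ => ?_) fun y _ => mul_nonneg (kap_nonneg _ _) (hh _)
  · rw [mem_gbox, abs_le, abs_le] at *
    simp only [Zsqrtd.re_sub, Zsqrtd.im_sub]
    push_cast
    refine ⟨⟨?_, ?_⟩, ?_, ?_⟩ <;> omega
  · exact sub_right_injective hab
  · simp only [sub_sub_cancel]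
    rw [add_sub_right_comm]

lemma norm_AvN_le {N : ℕ} (f : GaussianInt → ℂ) (x : GaussianInt) :
    ‖AvN N f x‖ ≤ 1 / (N : ℝ) * kconv N (fun y => ‖f y‖) x := by
  have h : (∑' n : GaussianInt,
      if Zsqrtd.norm n < (N : ℤ) then (gvm n : ℂ) * f (x - n) else 0) =
      ∑ n ∈ gbox (side N), (kap N n : ℂ) * f (x - n) := by
    rw [tsum_eq_sum (s := gbox (side N))]
    · refine Finset.sum_congr rfl fun n _ => ?_
      unfold kap; split_ifs <;> simp
    · intro n hn
      rw [if_neg]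
      exact fun h => hn (mem_gbox_side h)
  rw [AvN, h, norm_mul]
  refine mul_le_mul (by simp) ?_ (norm_nonneg _) (by positivity)
  refine (norm_sum_le _ _).trans (Finset.sum_le_sum fun n _ => ?_)
  rw [norm_mul, Complex.norm_real, Real.norm_of_nonneg (kap_nonneg _ _)]

lemma tsum_sum_translate (s : Finset GaussianInt) (u : GaussianInt → ℝ≥0∞) :
    ∑' c, ∑ d ∈ s, u (d + c) = s.card * ∑' x, u x := by
  rw [Summable.tsum_finsetSum fun _ _ => ENNReal.summable]
  have : ∀ d ∈ s, ∑' c, u (d + c) = ∑' x, u x := fun d _ => (Equiv.addLeft d).tsum_eq u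
  rw [Finset.sum_congr rfl this, Finset.sum_const, nsmul_eq_mul]

lemma exists_kconv_bound {p q : ℝ} (hpq : p.HolderConjugate q) (hpq' : p ≤ q) :
    ∃ C : ℝ, 0 < C ∧ ∀ N : ℕ, 2 ≤ N → ∀ h : GaussianInt → ℝ, (∀ x, 0 ≤ h x) →
      ∑' x, ENNReal.ofReal (kconv N h x) ^ q ≤
        ENNReal.ofReal C * (N : ℝ≥0∞) ^ (2 : ℝ) * (∑' x, ENNReal.ofReal (h x) ^ p) ^ (q / p) := by
  obtain ⟨C, hC, hloc⟩ := exists_local_bound hpq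
  have hp0 : 0 < p := hpq.pos
  have hq0 : 0 < q := hpq.symm.pos
  refine ⟨4 * C, by positivity, fun N hN h hh => ?_⟩
  have hk0 : ∀ x, 0 ≤ kconv N h x := fun x =>
    Finset.sum_nonneg fun n _ => mul_nonneg (kap_nonneg _ _) (hh _)
  set a : GaussianInt → ℝ≥0∞ := fun c =>
    ∑ d ∈ gbox (2 * side N), ENNReal.ofReal (h (d + c)) ^ p with ha
  set A : ℝ≥0∞ := ∑' x, ENNReal.ofReal (h x) ^ p with hA
  set K : ℝ≥0∞ := ENNReal.ofReal C * (N : ℝ≥0∞) ^ (2 : ℝ) with hK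
  have hlocal : ∀ c, ∑ d ∈ gbox (side N), ENNReal.ofReal (kconv N h (d + c)) ^ q ≤
      K * a c ^ (q / p) := by
    intro c
    have h1 := hloc N hN (fun y => h (y + c)) fun y => hh _
    have h2 : ∑ d ∈ gbox (side N), kconv N h (d + c) ^ q ≤
        C * (N : ℝ) ^ 2 * (∑ y ∈ gbox (2 * side N), h (y + c) ^ p) ^ (q / p) :=
      (Finset.sum_le_sum fun d hd =>
        Real.rpow_le_rpow (hk0 _) (kconv_le_sum hh hd) hq0.le).trans h1
    have h3 := ENNReal.ofReal_le_ofReal h2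
    have hs : 0 ≤ ∑ y ∈ gbox (2 * side N), h (y + c) ^ p :=
      Finset.sum_nonneg fun y _ => Real.rpow_nonneg (hh _) p
    rw [ENNReal.ofReal_sum_of_nonneg fun d _ => Real.rpow_nonneg (hk0 _) q,
      ENNReal.ofReal_mul (by positivity), ENNReal.ofReal_mul hC.le,
      ← ENNReal.ofReal_rpow_of_nonneg hs (by positivity),
      ENNReal.ofReal_sum_of_nonneg fun y _ => Real.rpow_nonneg (hh _) p] at h3
    have e1 : ENNReal.ofReal ((N : ℝ) ^ 2) = (N : ℝ≥0∞) ^ (2 : ℝ) := by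
      rw [ENNReal.ofReal_pow (Nat.cast_nonneg _), ENNReal.ofReal_natCast]
      norm_cast
    rw [e1] at h3
    simp only [← ENNReal.ofReal_rpow_of_nonneg (hk0 _) hq0.le,
      ← ENNReal.ofReal_rpow_of_nonneg (hh _) hp0.le] at h3
    exact h3
  have haA : ∀ c, a c ≤ A := by
    intro c
    calc a c ≤ ∑' d, ENNReal.ofReal (h (d + c)) ^ p := ENNReal.sum_le_tsum _
      _ = A := (Equiv.addRight c).tsum_eq fun x => ENNReal.ofReal (h x) ^ p
  have hqp : 0 ≤ q / p - 1 := sub_nonneg.2 ((one_le_div hp0).2 hpq')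
  have hpow : ∀ (b : ℝ≥0∞), b ^ (q / p) = b * b ^ (q / p - 1) := by
    intro b
    have := ENNReal.rpow_add_of_nonneg (x := b) 1 (q / p - 1) zero_le_one hqp
    rw [ENNReal.rpow_one, add_sub_cancel] at this
    exact this
  have hsum : ((gbox (side N)).card : ℝ≥0∞) * ∑' x, ENNReal.ofReal (kconv N h x) ^ q ≤
      (gbox (side N)).card * (4 * (K * A ^ (q / p))) := by
    have hc4 : ((gbox (2 * side N)).card : ℝ≥0∞) ≤ (gbox (side N)).card * 4 := by
      have : (gbox (2 * side N)).card ≤ (gbox (side N)).card * 4 := by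
        rw [card_gbox, card_gbox]
        calc (2 * (2 * side N) + 1) ^ 2 ≤ (2 * (2 * side N + 1)) ^ 2 :=
              Nat.pow_le_pow_left (by omega) 2
          _ = _ := by ring
      exact_mod_cast this
    calc ((gbox (side N)).card : ℝ≥0∞) * ∑' x, ENNReal.ofReal (kconv N h x) ^ q
        = ∑' c, ∑ d ∈ gbox (side N), ENNReal.ofReal (kconv N h (d + c)) ^ q :=
          (tsum_sum_translate _ fun x => ENNReal.ofReal (kconv N h x) ^ q).symm
      _ ≤ ∑' c, K * A ^ (q / p - 1) * a c := by
          refine ENNReal.tsum_le_tsum fun c => (hlocal c).trans ?_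
          calc K * a c ^ (q / p) = K * a c ^ (q / p - 1) * a c := by rw [hpow]; ring
            _ ≤ K * A ^ (q / p - 1) * a c :=
              mul_le_mul' (mul_le_mul' le_rfl (ENNReal.rpow_le_rpow (haA c) hqp)) le_rfl
      _ = K * A ^ (q / p - 1) * ((gbox (2 * side N)).card * A) := by
          rw [ENNReal.tsum_mul_left]
          congr 1
          exact tsum_sum_translate _ fun x => ENNReal.ofReal (h x) ^ p
      _ ≤ K * A ^ (q / p - 1) * ((gbox (side N)).card * 4 * A) := by gcongr
      _ = _ := by rw [hpow A]; ring
  have hc0 : ((gbox (side N)).card : ℝ≥0∞) ≠ 0 := by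
    rw [card_gbox]; simp
  rw [ENNReal.mul_le_mul_iff_right hc0 (ENNReal.natCast_ne_top _)] at hsum
  refine hsum.trans (le_of_eq ?_)
  rw [ENNReal.ofReal_mul (by norm_num), hK, ENNReal.ofReal_ofNat]; ring

theorem lp_improving (p : ℝ) (hp1 : 1 < p) (hp2 : p ≤ 2) :
    ∃ C : ℝ, 0 < C ∧ ∀ p' : ℝ, 1 / p + 1 / p' = 1 →
      ∀ N : ℕ, 2 ≤ N → ∀ f : GaussianInt → ℂ,
      (∑' x : GaussianInt, (‖AvN N f x‖₊ : ℝ≥0∞) ^ p') ^ (1 / p')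
        ≤ ENNReal.ofReal C * (N : ℝ≥0∞) ^ (1 / p' - 1 / p) *
          (∑' n : GaussianInt, (‖f n‖₊ : ℝ≥0∞) ^ p) ^ (1 / p) := by
  have hconj : p.HolderConjugate p.conjExponent := Real.HolderConjugate.conjExponent hp1
  set q := p.conjExponent with hq
  have hp0 : 0 < p := hconj.pos
  have hq0 : 0 < q := hconj.symm.pos
  have hinv : 1 / p + 1 / q = 1 := by
    simpa only [one_div] using hconj.inv_add_inv_eq_one
  have hpq : p ≤ q := by
    have h1 : 1 / 2 ≤ 1 / p := one_div_le_one_div_of_le hp0 hp2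
    have h2 : 1 / q ≤ 1 / p := by linarith
    exact (one_div_le_one_div hq0 hp0).1 h2
  obtain ⟨C, hC, hbd⟩ := exists_kconv_bound hconj hpq
  refine ⟨C ^ (1 / q), by positivity, fun p' hp' N hN f => ?_⟩
  have hp'q : p' = q := by
    have : 1 / p' = 1 / q := by linarith
    simpa using this
  subst hp'q
  have hN0 : (N : ℝ≥0∞) ≠ 0 := by
    have : N ≠ 0 := by omega
    exact_mod_cast this
  have hNt : (N : ℝ≥0∞) ≠ ⊤ := ENNReal.natCast_ne_top _
  have hpt : ∀ x, (‖AvN N f x‖₊ : ℝ≥0∞) ≤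
      (N : ℝ≥0∞)⁻¹ * ENNReal.ofReal (kconv N (fun y => ‖f y‖) x) := by
    intro x
    rw [← enorm_eq_nnnorm, ← ofReal_norm]
    refine (ENNReal.ofReal_le_ofReal (norm_AvN_le f x)).trans (le_of_eq ?_)
    have hN' : (0 : ℝ) < N := by
      have : 0 < N := by omega
      exact_mod_cast this
    rw [ENNReal.ofReal_mul (by positivity), one_div, ENNReal.ofReal_inv_of_pos hN',
      ENNReal.ofReal_natCast]
  have hf : ∀ n, (‖f n‖₊ : ℝ≥0∞) = ENNReal.ofReal ‖f n‖ := fun n => by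
    rw [ofReal_norm, enorm_eq_nnnorm]
  simp only [hf]
  set A := ∑' n, ENNReal.ofReal ‖f n‖ ^ p
  calc (∑' x : GaussianInt, (‖AvN N f x‖₊ : ℝ≥0∞) ^ q) ^ (1 / q)
      ≤ (∑' x, ((N : ℝ≥0∞)⁻¹ * ENNReal.ofReal (kconv N (fun y => ‖f y‖) x)) ^ q) ^ (1 / q) := by
        refine ENNReal.rpow_le_rpow (ENNReal.tsum_le_tsum fun x => ?_) (by positivity)
        exact ENNReal.rpow_le_rpow (hpt x) hq0.le
    _ = ((N : ℝ≥0∞)⁻¹ ^ q *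
          ∑' x, ENNReal.ofReal (kconv N (fun y => ‖f y‖) x) ^ q) ^ (1 / q) := by
        simp only [ENNReal.mul_rpow_of_nonneg _ _ hq0.le]
        rw [ENNReal.tsum_mul_left]
    _ ≤ ((N : ℝ≥0∞)⁻¹ ^ q *
          (ENNReal.ofReal C * (N : ℝ≥0∞) ^ (2 : ℝ) * A ^ (q / p))) ^ (1 / q) := by
        refine ENNReal.rpow_le_rpow ?_ (by positivity)
        gcongr
        exact hbd N hN _ fun x => norm_nonneg _
    _ = _ := by
        have hq1 : 0 ≤ 1 / q := by positivity
        rw [ENNReal.mul_rpow_of_nonneg _ _ hq1, ENNReal.mul_rpow_of_nonneg _ _ hq1,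
          ENNReal.mul_rpow_of_nonneg _ _ hq1, ← ENNReal.rpow_mul, ← ENNReal.rpow_mul,
          ← ENNReal.rpow_mul, ENNReal.ofReal_rpow_of_pos hC, mul_one_div_cancel hq0.ne',
          ENNReal.rpow_one]
        have e1 : q / p * (1 / q) = 1 / p := by field_simp
        have e2 : (N : ℝ≥0∞)⁻¹ * (N : ℝ≥0∞) ^ (2 * (1 / q)) = (N : ℝ≥0∞) ^ (1 / q - 1 / p) := by
          rw [← ENNReal.rpow_neg_one, ← ENNReal.rpow_add _ _ hN0 hNt]
          congr 1; linarith
        rw [e1, ← e2]; ring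

end
end

section
/- For every interval ω ⊆ 𝕋 there is a constant C_ω such that for every β ∈ ℂ with N(β) ≥ max(2, C_ω |ω|^{−2}): |(2π/|ω|) ∫_{x ∈ ℂ : N(x) ≤ 1, arg(x) ∈ ω} e(−⟨x, β⟩) dx| ≤ C_ω · log N(β) / N(β)^{1/2}. -/
open Complex GaussianInt MeasureTheory
open scoped Real ENNReal

noncomputable section
attribute [local instance] Classical.propDecidable

lemma norm_e2 (t : ℝ) : ‖e2 t‖ = 1 := by
  have : e2 t = Complex.exp ((2 * Real.pi * t : ℝ) * Complex.I) := by
    unfold e2; congr 1; push_cast; ring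
  rw [this, Complex.norm_exp_ofReal_mul_I]

lemma continuous_e2 : Continuous e2 := by
  unfold e2; fun_prop

lemma norm_intervalIntegral_e2_le {b : ℝ} (hb : 0 < b) (u v : ℝ) :
    ‖∫ x in u..v, e2 (-(b * x))‖ ≤ 1 / (Real.pi * b) := by
  have hπ := Real.pi_pos
  set k : ℂ := -(2 * Real.pi * b : ℝ) * Complex.I with hk
  have hk0 : k ≠ 0 := by
    simp [hk, hb.ne', Real.pi_ne_zero]
  have hf : ∀ x : ℝ, e2 (-(b * x)) = Complex.exp (k * x) := by
    intro x; unfold e2; congr 1; rw [hk]; push_cast; ring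
  have hn : ∀ x : ℝ, ‖Complex.exp (k * x)‖ = 1 := fun x => by rw [← hf, norm_e2]
  have hkn : ‖k‖ = 2 * Real.pi * b := by
    rw [hk, norm_mul, Complex.norm_I, mul_one, norm_neg, Complex.norm_real, Real.norm_eq_abs,
      abs_of_pos (by positivity)]
  simp_rw [hf]
  rw [integral_exp_mul_complex hk0, norm_div, hkn]
  calc _ ≤ 2 / (2 * Real.pi * b) := by
        gcongr
        refine (norm_sub_le _ _).trans ?_
        rw [hn, hn]; norm_num
    _ = _ := by field_simp

lemma norm_setIntegral_e2_le {b : ℝ} (hb : 0 < b) {s : Set ℝ} (hs : s.OrdConnected)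
    (hbb : BddBelow s) (hba : BddAbove s) :
    ‖∫ x in s, e2 (-(b * x))‖ ≤ 1 / (Real.pi * b) := by
  rcases s.eq_empty_or_nonempty with rfl | hne
  · simpa using by positivity
  have hle : sInf s ≤ sSup s := csInf_le_csSup hne hbb hba
  have h1 : Set.Ioo (sInf s) (sSup s) ⊆ s := by
    intro x hx
    obtain ⟨y, hy, hyx⟩ := exists_lt_of_csInf_lt hne hx.1
    obtain ⟨z, hz, hxz⟩ := exists_lt_of_lt_csSup hne hx.2
    exact hs.out hy hz ⟨hyx.le, hxz.le⟩
  have h2 : s ⊆ Set.Icc (sInf s) (sSup s) := fun x hx => ⟨csInf_le hbb hx, le_csSup hba hx⟩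
  have hae : s =ᵐ[volume] Set.Ioc (sInf s) (sSup s) := by
    refine Filter.EventuallyLE.antisymm ?_ ?_
    · exact (LE.le.eventuallyLE h2).trans Ioc_ae_eq_Icc.symm.le
    · exact Ioo_ae_eq_Ioc.symm.le.trans (LE.le.eventuallyLE h1)
  rw [setIntegral_congr_set hae, ← intervalIntegral.integral_of_le hle]
  exact norm_intervalIntegral_e2_le hb _ _

lemma norm_setIntegral_e2_re_le {b : ℝ} (hb : 0 < b) {S : Set ℂ} (hS : Convex ℝ S)
    (hS1 : S ⊆ Metric.closedBall 0 1) :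
    ‖∫ z in S, e2 (-(b * z.re))‖ ≤ 2 / (Real.pi * b) := by
  have hm : NullMeasurableSet S volume := hS.nullMeasurableSet volume
  have hfin : volume S ≠ ⊤ :=
    ((measure_mono hS1).trans_lt (isCompact_closedBall _ _).measure_lt_top).ne
  set f : ℂ → ℂ := fun z => e2 (-(b * z.re))
  have hfc : Continuous f := continuous_e2.comp (by fun_prop)
  have hint : Integrable (S.indicator f) volume := by
    refine IntegrableOn.integrable_indicator₀ ?_ hm
    exact Measure.integrableOn_of_bounded hfin hfc.aestronglyMeasurable
      (M := 1) (Filter.Eventually.of_forall fun z => (norm_e2 _).le)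
  have hmp := Complex.volume_preserving_equiv_real_prod.symm
  have hint2 : Integrable
      (fun p : ℝ × ℝ => S.indicator f (Complex.measurableEquivRealProd.symm p))
      (volume.prod volume) :=
    (hmp.integrable_comp_emb (MeasurableEquiv.measurableEmbedding _)).2 hint
  rw [← integral_indicator₀ hm,
    ← hmp.integral_comp (MeasurableEquiv.measurableEmbedding _), Measure.volume_eq_prod,
    integral_prod_symm _ hint2]
  have hin : ∀ z ∈ S, |z.re| ≤ 1 ∧ |z.im| ≤ 1 := fun z hz => by
    have := hS1 hz
    rw [mem_closedBall_zero_iff] at this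
    exact ⟨(Complex.abs_re_le_norm z).trans this, (Complex.abs_im_le_norm z).trans this⟩
  have hbound : ∀ y : ℝ,
      ‖∫ x : ℝ, S.indicator f (Complex.measurableEquivRealProd.symm (x, y))‖ ≤
        (Set.Icc (-1 : ℝ) 1).indicator (fun _ => 1 / (Real.pi * b)) y := by
    intro y
    set s : Set ℝ := {x : ℝ | (⟨x, y⟩ : ℂ) ∈ S} with hs
    have hso : s.OrdConnected := by
      refine Convex.ordConnected fun x₁ h₁ x₂ h₂ p q hp hq hpq => ?_
      have := hS h₁ h₂ hp hq hpq
      rw [hs, Set.mem_ofPred_eq]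
      convert this using 1
      apply Complex.ext
      · simp
      · simp [← add_mul, hpq]
    have heq : (fun x : ℝ => S.indicator f (Complex.measurableEquivRealProd.symm (x, y))) =
        s.indicator fun x => e2 (-(b * x)) := by
      ext x
      simp only [Set.indicator, hs, Set.mem_ofPred_eq]
      rfl
    rw [heq, integral_indicator hso.measurableSet]
    by_cases hy : y ∈ Set.Icc (-1 : ℝ) 1
    · rw [Set.indicator_of_mem hy]
      exact norm_setIntegral_e2_le hb hso
        ⟨-1, fun x hx => (abs_le.1 (hin _ hx).1).1⟩ ⟨1, fun x hx => (abs_le.1 (hin _ hx).1).2⟩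
    · have : s = ∅ := Set.eq_empty_of_forall_notMem fun x hx => hy (abs_le.1 (hin _ hx).2)
      simp [this, hy]
  refine (norm_integral_le_of_norm_le ?_ (Filter.Eventually.of_forall hbound)).trans ?_
  · rw [integrable_indicator_iff measurableSet_Icc]
    exact integrableOn_const (by simp)
  · rw [integral_indicator measurableSet_Icc, setIntegral_const]
    simp only [Real.volume_real_Icc, smul_eq_mul]
    apply le_of_eq
    norm_num
    ring

lemma norm_setIntegral_e2_cip_le {β : ℂ} (hβ : β ≠ 0) {S : Set ℂ} (hS : Convex ℝ S)
    (hS1 : S ⊆ Metric.closedBall 0 1) :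
    ‖∫ z in S, e2 (-(cip z β))‖ ≤ 2 / (Real.pi * ‖β‖) := by
  have hb : 0 < ‖β‖ := norm_pos_iff.2 hβ
  obtain ⟨u, hu⟩ : ∃ u : Circle, (u : ℂ) * ‖β‖ = β := by
    refine ⟨Circle.exp β.arg, ?_⟩
    rw [Circle.coe_exp, mul_comm]
    exact Complex.norm_mul_exp_arg_mul_I β
  have hmp := (rotation u).measurePreserving
  rw [← hmp.setIntegral_preimage_emb
    (rotation u).toHomeomorph.measurableEmbedding]
  have hc : ∀ z : ℂ, cip (rotation u z) β = ‖β‖ * z.re := by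
    intro z
    have h1 : (u : ℂ).re * (u : ℂ).re + (u : ℂ).im * (u : ℂ).im = 1 := by
      rw [← Complex.normSq_apply, Circle.normSq_coe]
    have h2 : β.re = (u : ℂ).re * ‖β‖ := by
      conv_lhs => rw [← hu]
      simp
    have h3 : β.im = (u : ℂ).im * ‖β‖ := by
      conv_lhs => rw [← hu]
      simp
    simp only [cip, rotation_apply, Complex.mul_re, Complex.mul_im]
    rw [h2, h3]
    linear_combination ‖β‖ * z.re * h1
  simp_rw [hc]
  refine norm_setIntegral_e2_re_le hb (hS.linear_preimage (rotation u).toLinearEquiv.toLinearMap) ?_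
  intro z hz
  have := hS1 hz
  rw [mem_closedBall_zero_iff] at this ⊢
  exact ((rotation u).norm_map z).symm.trans_le this

lemma le_arg_iff_of_im_pos {z : ℂ} (hz : 0 < z.im) {c : ℝ} (h0 : 0 < c) (hπ : c < Real.pi) :
    c ≤ z.arg ↔ 0 ≤ z.im * Real.cos c - z.re * Real.sin c := by
  have hz0 : 0 < ‖z‖ := norm_pos_iff.2 (by rintro rfl; simp at hz)
  have h1 : 0 ≤ z.arg := Complex.arg_nonneg_iff.2 hz.le
  have h2 := Complex.arg_le_pi z
  have heq : z.im * Real.cos c - z.re * Real.sin c = ‖z‖ * Real.sin (z.arg - c) := by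
    rw [Real.sin_sub]
    linear_combination (-Real.cos c) * Complex.norm_mul_sin_arg z +
      Real.sin c * Complex.norm_mul_cos_arg z
  rw [heq, mul_nonneg_iff_of_pos_left hz0]
  constructor
  · intro h
    exact Real.sin_nonneg_of_nonneg_of_le_pi (by linarith) (by linarith)
  · intro h
    by_contra! hlt
    exact absurd h (not_le.2 (Real.sin_neg_of_neg_of_neg_pi_lt (by linarith) (by linarith)))

/-- The part of the sector `c ≤ arg z < d` of the unit disc lying in the upper half plane. -/
def upperSector (c d : ℝ) : Set ℂ :=
  {z | Complex.normSq z ≤ 1 ∧ 0 < z.im ∧ c ≤ z.arg ∧ z.arg < d}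

lemma setOf_normSq_le_one : {z : ℂ | Complex.normSq z ≤ 1} = Metric.closedBall 0 1 := by
  ext z
  rw [mem_closedBall_zero_iff, Set.mem_ofPred_eq, Complex.normSq_eq_norm_sq,
    sq_le_one_iff₀ (norm_nonneg z)]

lemma convex_im_pos_le_arg (c : ℝ) :
    Convex ℝ {z : ℂ | 0 < z.im ∧ c ≤ z.arg} ∧ Convex ℝ {z : ℂ | 0 < z.im ∧ z.arg < c} := by
  have hH : Convex ℝ {z : ℂ | 0 < z.im} := convex_halfSpace_im_gt 0
  have hpos : ∀ z : ℂ, 0 < z.im → 0 < z.arg := fun z hz =>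
    (Complex.arg_nonneg_iff.2 hz.le).lt_of_ne fun h => hz.ne' (Complex.arg_eq_zero_iff.1 h.symm).2
  have hlt : ∀ z : ℂ, 0 < z.im → z.arg < Real.pi := fun z hz =>
    (Complex.arg_le_pi z).lt_of_ne fun h => hz.ne' (Complex.arg_eq_pi_iff.1 h).2
  rcases le_or_gt c 0 with h0 | h0
  · constructor
    · convert hH using 3 with z
      exact and_iff_left_of_imp fun hz => h0.trans (hpos z hz).le
    · convert convex_empty (𝕜 := ℝ) (E := ℂ)
      ext z
      simpa using fun hz => h0.trans (hpos z hz).le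
  rcases le_or_gt Real.pi c with hπ | hπ
  · constructor
    · convert convex_empty (𝕜 := ℝ) (E := ℂ)
      ext z
      simpa using fun hz => (hlt z hz).trans_le hπ
    · convert hH using 3 with z
      exact and_iff_left_of_imp fun hz => (hlt z hz).trans_le hπ
  have hlin : IsLinearMap ℝ fun z : ℂ => z.im * Real.cos c - z.re * Real.sin c :=
    ⟨fun x y => by simp only [Complex.add_im, Complex.add_re]; ring, fun r x => by
      simp only [Complex.real_smul, Complex.re_ofReal_mul, Complex.im_ofReal_mul, smul_eq_mul]
      ring⟩
  constructor
  · convert hH.inter (convex_halfSpace_ge hlin 0) using 1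
    ext z
    exact and_congr_right fun hz => le_arg_iff_of_im_pos hz h0 hπ
  · convert hH.inter (convex_halfSpace_lt hlin 0) using 1
    ext z
    exact and_congr_right fun hz => by
      simpa using (le_arg_iff_of_im_pos hz h0 hπ).not

lemma convex_upperSector (c d : ℝ) : Convex ℝ (upperSector c d) := by
  convert (setOf_normSq_le_one ▸ convex_closedBall (0 : ℂ) 1 :
    Convex ℝ {z : ℂ | Complex.normSq z ≤ 1}).inter
    ((convex_im_pos_le_arg c).1.inter (convex_im_pos_le_arg d).2) using 1
  ext z
  simp only [upperSector, Set.mem_inter_iff, Set.mem_ofPred_eq]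
  tauto

/-- The part of the sector `c ≤ arg z < d` of the unit disc lying in the lower half plane. -/
def lowerSector (c d : ℝ) : Set ℂ :=
  {z | Complex.normSq z ≤ 1 ∧ z.im < 0 ∧ c ≤ z.arg ∧ z.arg < d}

lemma convex_lowerSector (c d : ℝ) : Convex ℝ (lowerSector c d) := by
  suffices h : lowerSector c d = -upperSector (c + Real.pi) (d + Real.pi) from
    h ▸ (convex_upperSector (c + Real.pi) (d + Real.pi)).neg
  ext z
  simp only [upperSector, lowerSector, Set.mem_neg, Set.mem_ofPred_eq, Complex.normSq_neg,
    Complex.neg_im, Left.neg_pos_iff]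
  refine and_congr_right fun _ => and_congr_right fun hz => ?_
  rw [Complex.arg_neg_eq_arg_add_pi_of_im_neg hz]
  simp

lemma volume_im_eq_zero : volume {z : ℂ | z.im = 0} = 0 := by
  have : {z : ℂ | z.im = 0} = (LinearMap.ker Complex.imLm : Set ℂ) := by
    ext z; simp
  rw [this]
  refine Measure.addHaar_submodule _ _ fun h => ?_
  have : Complex.I ∈ LinearMap.ker Complex.imLm := by rw [h]; trivial
  simp at this

lemma norm_setIntegral_union_le {f : ℂ → ℂ} {s t : Set ℂ} (hd : Disjoint s t)
    (ht : NullMeasurableSet t volume) (hs' : IntegrableOn f s) (ht' : IntegrableOn f t) :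
    ‖∫ z in s ∪ t, f z‖ ≤ ‖∫ z in s, f z‖ + ‖∫ z in t, f z‖ := by
  rw [setIntegral_union₀ hd.aedisjoint ht hs' ht']
  exact norm_add_le _ _

lemma integrableOn_e2_cip (β : ℂ) {S : Set ℂ} (hS : S ⊆ Metric.closedBall 0 1) :
    IntegrableOn (fun z => e2 (-(cip z β))) S := by
  have : Continuous fun z => e2 (-(cip z β)) :=
    continuous_e2.comp (by unfold cip; fun_prop)
  exact (this.continuousOn.integrableOn_compact (isCompact_closedBall 0 1)).mono_set hS

/-- The sector `c ≤ arg z < d` of the unit disc. -/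
def discSector (c d : ℝ) : Set ℂ := {z | Complex.normSq z ≤ 1 ∧ c ≤ z.arg ∧ z.arg < d}

lemma discSector_subset (c d : ℝ) : discSector c d ⊆ Metric.closedBall 0 1 := fun z hz => by
  rw [← setOf_normSq_le_one]; exact hz.1

lemma measurableSet_discSector (c d : ℝ) : MeasurableSet (discSector c d) := by
  have h1 : Measurable fun z : ℂ => Complex.normSq z := Complex.continuous_normSq.measurable
  exact (measurableSet_le h1 measurable_const).inter
    ((measurableSet_le measurable_const Complex.measurable_arg).inter
      (measurableSet_lt Complex.measurable_arg measurable_const))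

lemma norm_setIntegral_discSector_le {β : ℂ} (hβ : β ≠ 0) (c d : ℝ) :
    ‖∫ z in discSector c d, e2 (-(cip z β))‖ ≤ 4 / (Real.pi * ‖β‖) := by
  have hu : upperSector c d ⊆ Metric.closedBall 0 1 := fun z hz =>
    discSector_subset c d ⟨hz.1, hz.2.2⟩
  have hl : lowerSector c d ⊆ Metric.closedBall 0 1 := fun z hz =>
    discSector_subset c d ⟨hz.1, hz.2.2⟩
  have hae : discSector c d =ᵐ[volume] (upperSector c d ∪ lowerSector c d : Set ℂ) := by
    have : ∀ᵐ z : ℂ, z.im ≠ 0 := by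
      rw [ae_iff]; simpa using volume_im_eq_zero
    filter_upwards [this] with z hz
    apply propext
    change z ∈ discSector c d ↔ z ∈ upperSector c d ∨ z ∈ lowerSector c d
    simp only [discSector, upperSector, lowerSector, Set.mem_ofPred_eq]
    have := lt_or_gt_of_ne hz
    tauto
  have hd : Disjoint (upperSector c d) (lowerSector c d) :=
    Set.disjoint_left.2 fun z hz hz' => lt_asymm hz.2.1 hz'.2.1
  rw [setIntegral_congr_set hae]
  refine (norm_setIntegral_union_le hd ((convex_lowerSector c d).nullMeasurableSet volume)
    (integrableOn_e2_cip β hu) (integrableOn_e2_cip β hl)).trans ?_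
  refine (add_le_add (norm_setIntegral_e2_cip_le hβ (convex_upperSector c d) hu)
    (norm_setIntegral_e2_cip_le hβ (convex_lowerSector c d) hl)).trans_eq ?_
  ring

lemma argIn_arc_iff (z : ℂ) (a l : ℝ) :
    argIn z ((fun θ : ℝ => (θ : Real.Angle)) '' Set.Ico a (a + l)) ↔
      ∃ n : ℤ, a ≤ z.arg + 2 * Real.pi * n ∧ z.arg + 2 * Real.pi * n < a + l := by
  unfold argIn
  constructor
  · rintro ⟨θ, hθ, h⟩
    obtain ⟨n, hn⟩ := Real.Angle.angle_eq_iff_two_pi_dvd_sub.1 h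
    refine ⟨n, ?_⟩
    rw [← hn, add_sub_cancel]
    exact hθ
  · rintro ⟨n, hn⟩
    refine ⟨_, hn, Real.Angle.angle_eq_iff_two_pi_dvd_sub.2 ⟨n, by ring⟩⟩

lemma norm_setIntegral_arc_le {β : ℂ} (hβ : β ≠ 0) {ω : Set Real.Angle} {l : ℝ}
    (hω : IsArc ω l) :
    ‖∫ z in {z : ℂ | Complex.normSq z ≤ 1 ∧ argIn z ω}, e2 (-(cip z β))‖ ≤
      8 / (Real.pi * ‖β‖) := by
  have hπ := Real.pi_pos
  have hb : 0 < ‖β‖ := norm_pos_iff.2 hβ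
  obtain ⟨a₀, rfl⟩ := hω
  simp_rw [argIn_arc_iff]
  obtain ⟨m, hm, -⟩ := existsUnique_add_zsmul_mem_Ioc Real.two_pi_pos a₀ (-Real.pi)
  rw [zsmul_eq_mul] at hm
  set a : ℝ := a₀ + m * (2 * Real.pi) with ha
  have hshift : ∀ z : ℂ,
      (∃ n : ℤ, a₀ ≤ z.arg + 2 * Real.pi * n ∧ z.arg + 2 * Real.pi * n < a₀ + l) ↔
        ∃ n : ℤ, a ≤ z.arg + 2 * Real.pi * n ∧ z.arg + 2 * Real.pi * n < a + l := by
    intro z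
    constructor
    · rintro ⟨n, h1, h2⟩
      refine ⟨n + m, ?_⟩
      push_cast
      constructor <;> linarith
    · rintro ⟨n, h1, h2⟩
      refine ⟨n - m, ?_⟩
      push_cast
      constructor <;> linarith
  simp_rw [hshift]
  rcases le_or_gt (2 * Real.pi) l with hl | hl
  · have : {z : ℂ | Complex.normSq z ≤ 1 ∧
        ∃ n : ℤ, a ≤ z.arg + 2 * Real.pi * n ∧ z.arg + 2 * Real.pi * n < a + l} =
        Metric.closedBall 0 1 := by
      rw [← setOf_normSq_le_one]
      ext z
      refine and_iff_left_of_imp fun _ => ?_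
      obtain ⟨n, hn, -⟩ := existsUnique_add_zsmul_mem_Ico Real.two_pi_pos z.arg a
      rw [zsmul_eq_mul] at hn
      exact ⟨n, by linarith [hn.1], by linarith [hn.2]⟩
    rw [this]
    refine (norm_setIntegral_e2_cip_le hβ (convex_closedBall 0 1) subset_rfl).trans ?_
    gcongr
    norm_num
  · have : {z : ℂ | Complex.normSq z ≤ 1 ∧
        ∃ n : ℤ, a ≤ z.arg + 2 * Real.pi * n ∧ z.arg + 2 * Real.pi * n < a + l} =
        discSector a (a + l) ∪ discSector (a - 2 * Real.pi) (a + l - 2 * Real.pi) := by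
      ext z
      have h1 := Complex.neg_pi_lt_arg z
      have h2 := Complex.arg_le_pi z
      simp only [discSector, Set.mem_ofPred_eq, Set.mem_union, ← and_or_left]
      refine and_congr_right fun _ => ?_
      constructor
      · rintro ⟨n, h3, h4⟩
        have hn0 : (-1 : ℝ) < n := by nlinarith [hm.1]
        have hn2 : (n : ℝ) < 2 := by nlinarith [hm.2]
        have hn0' : -1 < n := by exact_mod_cast hn0
        have hn2' : n < 2 := by exact_mod_cast hn2
        interval_cases n
        · left; push_cast at h3 h4; constructor <;> linarith
        · right; push_cast at h3 h4; constructor <;> linarith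
      · rintro (h | h)
        · exact ⟨0, by simpa using h⟩
        · exact ⟨1, by push_cast; constructor <;> linarith [h.1, h.2]⟩
    rw [this]
    have hd : Disjoint (discSector a (a + l))
        (discSector (a - 2 * Real.pi) (a + l - 2 * Real.pi)) :=
      Set.disjoint_left.2 fun z hz hz' => by linarith [hz.2.1, hz'.2.2]
    refine (norm_setIntegral_union_le hd (measurableSet_discSector _ _).nullMeasurableSet
      (integrableOn_e2_cip β (discSector_subset _ _))
      (integrableOn_e2_cip β (discSector_subset _ _))).trans ?_
    refine (add_le_add (norm_setIntegral_discSector_le hβ _ _)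
      (norm_setIntegral_discSector_le hβ _ _)).trans_eq ?_
    ring

theorem sector_fourier_decay (ω : Set Real.Angle) (l : ℝ) (hω : IsArc ω l) :
    ∃ C : ℝ, ∀ β : ℂ, max 2 (C / l ^ 2) ≤ Complex.normSq β →
      ‖((2 * Real.pi / l : ℝ) : ℂ) *
          ∫ x in {z : ℂ | Complex.normSq z ≤ 1 ∧ argIn z ω}, e2 (-(cip x β))‖
        ≤ C * Real.log (Complex.normSq β) / Real.sqrt (Complex.normSq β) := by
  have hlog : 0 < Real.log 2 := Real.log_pos one_lt_two
  refine ⟨|2 * Real.pi / l| * (8 / Real.pi) / Real.log 2, fun β h => ?_⟩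
  have h2 : 2 ≤ Complex.normSq β := (le_max_left _ _).trans h
  have hβ : β ≠ 0 := by rintro rfl; norm_num at h2
  have hb : 0 < ‖β‖ := norm_pos_iff.2 hβ
  have hlog2 : Real.log 2 ≤ Real.log (Complex.normSq β) := Real.log_le_log two_pos h2
  have hπ := Real.pi_pos
  rw [norm_mul, Complex.norm_real, Real.norm_eq_abs]
  have hs : Real.sqrt (Complex.normSq β) = ‖β‖ := rfl
  rw [hs]
  calc _ ≤ |2 * Real.pi / l| * (8 / (Real.pi * ‖β‖)) := by
        gcongr
        exact norm_setIntegral_arc_le hβ hω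
    _ = |2 * Real.pi / l| * (8 / Real.pi) / Real.log 2 * Real.log 2 / ‖β‖ := by
        field_simp
    _ ≤ _ := by gcongr

end
end

section
/- For every nonzero q ∈ ℤ[i] and every r ∈ ℤ[i]: the indicator of the condition gcd(r̄, q) = 1 equals (1/N(q)) Σ_{k ∈ B_q} e(⟨−r, k/q⟩) τ_{q̄}(k). -/
open Complex GaussianInt MeasureTheory
open scoped Real ENNReal

noncomputable section
attribute [local instance] Classical.propDecidable

/-- The `ℤ`-basis `1, i` of `ℤ[i]`. -/
def GaussianInt.basisOneI : Module.Basis (Fin 2) ℤ GaussianInt :=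
  Module.Basis.ofEquivFun
    { toFun := fun z => ![z.re, z.im]
      invFun := fun v => ⟨v 0, v 1⟩
      map_add' := fun x y => by ext i; fin_cases i <;> simp
      map_smul' := fun c x => by ext i; fin_cases i <;> simp
      left_inv := fun x => by simp
      right_inv := fun v => by ext i; fin_cases i <;> simp }

lemma GaussianInt.algebraNorm_eq (q : GaussianInt) : Algebra.norm ℤ q = Zsqrtd.norm q := by
  have h0 : basisOneI 0 = (⟨1, 0⟩ : GaussianInt) := by
    simp [basisOneI, Module.Basis.coe_ofEquivFun]
  have h1 : basisOneI 1 = (⟨0, 1⟩ : GaussianInt) := by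
    simp [basisOneI, Module.Basis.coe_ofEquivFun]
  have hr : ∀ z : GaussianInt, basisOneI.repr z 0 = z.re := fun z => by
    simp [basisOneI]
  have hi : ∀ z : GaussianInt, basisOneI.repr z 1 = z.im := fun z => by
    simp [basisOneI]
  rw [Algebra.norm_eq_matrix_det basisOneI, Matrix.det_fin_two]
  simp only [Algebra.leftMulMatrix_eq_repr_mul, h0, h1, hr, hi, Zsqrtd.norm, Zsqrtd.re_mul,
    Zsqrtd.im_mul]
  ring

lemma GaussianInt.card_quotient_span (q : GaussianInt) :
    (Nat.card (GaussianInt ⧸ Ideal.span {q}) : ℤ) = Zsqrtd.norm q := by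
  have : Module.Free ℤ GaussianInt := Module.Free.of_basis basisOneI
  have : Module.Finite ℤ GaussianInt := Module.Finite.of_basis basisOneI
  have h := Ideal.absNorm_span_singleton q
  rw [algebraNorm_eq, Ideal.absNorm_apply, Submodule.cardQuot_apply] at h
  rw [h, abs_natCast_norm]

lemma mem_Bq_iff (q r : GaussianInt) :
    r ∈ Bq q ↔ 0 ≤ (r * star q).re ∧ (r * star q).re < Zsqrtd.norm q ∧
      0 ≤ (r * star q).im ∧ (r * star q).im < Zsqrtd.norm q := by
  have h1 : cip (toComplex r) (toComplex q) = ((r * star q).re : ℤ) := by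
    simp [cip]
  have h2 : cip (toComplex r) (Complex.I * toComplex q) = ((r * star q).im : ℤ) := by
    simp [cip]
  simp only [Bq, Set.mem_ofPred_eq, h1, h2, ← intCast_real_norm, Int.cast_nonneg_iff, Int.cast_lt]

lemma exists_mem_Bq_dvd_sub {q : GaussianInt} (hq : q ≠ 0) (x : GaussianInt) :
    ∃ b ∈ Bq q, q ∣ b - x := by
  have hN : 0 < Zsqrtd.norm q := norm_pos.2 hq
  set z := x * star q with hz
  set t : GaussianInt := ⟨z.re / Zsqrtd.norm q, z.im / Zsqrtd.norm q⟩ with ht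
  have key : (x - q * t) * star q = z - (Zsqrtd.norm q : GaussianInt) * t := by
    rw [Zsqrtd.norm_eq_mul_conj]; ring
  refine ⟨x - q * t, ?_, ⟨-t, by ring⟩⟩
  have hre : ((x - q * t) * star q).re = z.re % Zsqrtd.norm q := by
    rw [key, Int.emod_def]; simp [ht]
  have him : ((x - q * t) * star q).im = z.im % Zsqrtd.norm q := by
    rw [key, Int.emod_def]; simp [ht]
  rw [mem_Bq_iff, hre, him]
  exact ⟨Int.emod_nonneg _ hN.ne', Int.emod_lt_of_pos _ hN, Int.emod_nonneg _ hN.ne',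
    Int.emod_lt_of_pos _ hN⟩

lemma eq_of_mem_Bq_of_dvd_sub {q a b : GaussianInt} (hq : q ≠ 0) (ha : a ∈ Bq q) (hb : b ∈ Bq q)
    (h : q ∣ a - b) : a = b := by
  have hN : 0 < Zsqrtd.norm q := norm_pos.2 hq
  obtain ⟨t, ht⟩ := h
  have key : a * star q - b * star q = (Zsqrtd.norm q : GaussianInt) * t := by
    rw [Zsqrtd.norm_eq_mul_conj, ← sub_mul, ht]; ring
  have zero_of_bounds : ∀ x y s : ℤ, 0 ≤ x → x < Zsqrtd.norm q → 0 ≤ y → y < Zsqrtd.norm q →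
      x - y = Zsqrtd.norm q * s → s = 0 := fun x y s _ _ _ _ hs => by
    have h1 : s < 1 := by nlinarith
    have h2 : -1 < s := by nlinarith
    omega
  rw [mem_Bq_iff] at ha hb
  have hre := congrArg Zsqrtd.re key
  have him := congrArg Zsqrtd.im key
  simp only [Zsqrtd.re_sub, Zsqrtd.im_sub, Zsqrtd.re_smul, Zsqrtd.im_smul] at hre him
  have h0 : t = 0 := Zsqrtd.ext
    (zero_of_bounds _ _ _ ha.1 ha.2.1 hb.1 hb.2.1 hre)
    (zero_of_bounds _ _ _ ha.2.2.1 ha.2.2.2 hb.2.2.1 hb.2.2.2 him)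
  rw [h0, mul_zero, sub_eq_zero] at ht
  exact ht

/-- Reduction modulo `q` identifies the box `B_q` with `ℤ[i] ⧸ (q)`. -/
def BqEquivQuotient {q : GaussianInt} (hq : q ≠ 0) :
    Bq q ≃ GaussianInt ⧸ Ideal.span {q} :=
  Equiv.ofBijective (fun b => Ideal.Quotient.mk _ (b : GaussianInt)) <| by
    constructor
    · intro a b h
      rw [Ideal.Quotient.eq, Ideal.mem_span_singleton] at h
      exact Subtype.ext (eq_of_mem_Bq_of_dvd_sub hq a.2 b.2 h)
    · intro y
      obtain ⟨x, rfl⟩ := Ideal.Quotient.mk_surjective y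
      obtain ⟨b, hb, hd⟩ := exists_mem_Bq_dvd_sub hq x
      exact ⟨⟨b, hb⟩, by rwa [Ideal.Quotient.eq, Ideal.mem_span_singleton]⟩

lemma card_Bq {q : GaussianInt} (hq : q ≠ 0) : (Nat.card (Bq q) : ℤ) = Zsqrtd.norm q := by
  rw [Nat.card_congr (BqEquivQuotient hq), GaussianInt.card_quotient_span]

lemma finite_Bq {q : GaussianInt} (hq : q ≠ 0) : Finite (Bq q) := by
  refine Nat.finite_of_card_ne_zero fun h => ?_
  have := card_Bq hq
  rw [h] at this
  exact (norm_pos.2 hq).ne this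

lemma e2_add (s t : ℝ) : e2 (s + t) = e2 s * e2 t := by
  simp [e2, mul_add, Complex.exp_add]

lemma e2_eq_one_iff (t : ℝ) : e2 t = 1 ↔ ∃ n : ℤ, t = n := by
  rw [e2, Complex.exp_eq_one_iff]
  refine exists_congr fun n => ?_
  rw [mul_comm (n : ℂ), mul_right_inj' Complex.two_pi_I_ne_zero]
  exact_mod_cast Iff.rfl

lemma e2_re_div_eq_one_of_dvd {q x : GaussianInt} (hq : q ≠ 0) (h : q ∣ x) :
    e2 (toComplex x / toComplex q).re = 1 := by
  obtain ⟨t, rfl⟩ := h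
  rw [toComplex_mul, mul_div_cancel_left₀ _ (by simpa using hq), e2_eq_one_iff]
  exact ⟨t.re, by simp⟩

lemma dvd_of_forall_e2_re_div_eq_one {q m : GaussianInt} (hq : q ≠ 0)
    (h : ∀ k : GaussianInt, e2 (toComplex (k * m) / toComplex q).re = 1) : q ∣ m := by
  obtain ⟨a, ha⟩ := (e2_eq_one_iff _).1 (h 1)
  obtain ⟨b, hb⟩ := (e2_eq_one_iff _).1 (h ⟨0, 1⟩)
  have hI : toComplex ⟨0, 1⟩ = Complex.I := by simp [toComplex_def']
  rw [one_mul] at ha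
  rw [toComplex_mul, hI, mul_div_assoc, Complex.I_mul_re] at hb
  have hdiv : toComplex m / toComplex q = toComplex ⟨a, -b⟩ := by
    apply Complex.ext
    · simp [ha]
    · simp [← hb]
  refine ⟨⟨a, -b⟩, toComplex_injective ?_⟩
  rw [toComplex_mul, ← hdiv, mul_div_cancel₀ _ (by simpa using hq)]

/-- Orthogonality of the additive characters `k ↦ e(Re(km/q))` over the box `B_q`. -/
lemma sum_Bq_e2_re_div {q : GaussianInt} (hq : q ≠ 0) [Fintype (Bq q)] (m : GaussianInt) :
    ∑ k : Bq q, e2 (toComplex ((k : GaussianInt) * m) / toComplex q).re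
      = if q ∣ m then ((Zsqrtd.norm q : ℤ) : ℂ) else 0 := by
  split_ifs with hm
  · rw [Finset.sum_congr rfl fun k _ => e2_re_div_eq_one_of_dvd hq (hm.mul_left _), ← card_Bq hq]
    simp
  · obtain ⟨c, hc⟩ : ∃ c : GaussianInt, e2 (toComplex (c * m) / toComplex q).re ≠ 1 := by
      by_contra! h
      exact hm (dvd_of_forall_e2_re_div_eq_one hq h)
    set S := ∑ k : Bq q, e2 (toComplex ((k : GaussianInt) * m) / toComplex q).re with hS
    let E := BqEquivQuotient hq
    let σ : Bq q ≃ Bq q := (E.trans (Equiv.addRight (Ideal.Quotient.mk _ c))).trans E.symm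
    have hσ : ∀ k, q ∣ (σ k : GaussianInt) - (k + c) := fun k => by
      have : E (σ k) = E k + Ideal.Quotient.mk _ c := by simp [σ]
      rw [← Ideal.mem_span_singleton, ← Ideal.Quotient.eq, map_add]
      exact this
    have shift : S = S * e2 (toComplex (c * m) / toComplex q).re := by
      rw [hS, Finset.sum_mul, ← Equiv.sum_comp σ]
      refine Finset.sum_congr rfl fun k _ => ?_
      have hsplit : (σ k : GaussianInt) * m = (σ k - (k + c)) * m + k * m + c * m := by ring
      rw [hsplit, toComplex_add, toComplex_add, add_div, add_div, Complex.add_re, Complex.add_re,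
        e2_add, e2_add, e2_re_div_eq_one_of_dvd hq ((hσ k).mul_right m), one_mul]
    have hzero : S * (e2 (toComplex (c * m) / toComplex q).re - 1) = 0 := by
      rw [mul_sub, ← shift, mul_one, sub_self]
    exact (mul_eq_zero.1 hzero).resolve_right (sub_ne_zero.2 hc)

lemma e2_cip_mul_e2_cip_star (q r k n : GaussianInt) :
    e2 (cip (toComplex (-r)) (toComplex k / toComplex q)) *
        e2 (cip (toComplex k) (toComplex n / toComplex (star q)))
      = e2 (toComplex (k * star (n - r)) / toComplex q).re := by
  have cip_eq : ∀ z w : ℂ, cip z w = (starRingEnd ℂ z * w).re := fun z w => by simp [cip]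
  have cip_comm : ∀ z w : ℂ, cip z w = cip w z := fun z w => by simp [cip, mul_comm]
  rw [← e2_add, cip_comm (toComplex k), cip_eq, cip_eq, ← Complex.add_re]
  congr 2
  simp only [map_neg, map_sub, map_mul, map_div₀, toComplex_star, star_sub, Complex.conj_conj]
  ring

lemma isCoprime_star_left_iff (r q : GaussianInt) :
    IsCoprime (star r) q ↔ IsCoprime r (star q) := by
  constructor <;> intro h <;> simpa [starRingEnd_apply] using h.map (starRingEnd GaussianInt)

/-- Every residue coprime to `q` has exactly one representative in `𝔸_q`, and the other residues
have none. -/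
lemma sum_Aq_ite_dvd_sub {q : GaussianInt} (hq : q ≠ 0) [Fintype (Aq q)] (r : GaussianInt)
    (c : ℂ) :
    ∑ n : Aq q, (if q ∣ (n : GaussianInt) - r then c else 0) = if IsCoprime r q then c else 0 := by
  have coprime_iff : ∀ n : GaussianInt, q ∣ n - r → (IsCoprime n q ↔ IsCoprime r q) := by
    rintro n ⟨t, ht⟩
    rw [sub_eq_iff_eq_add'.1 ht, IsCoprime.add_mul_left_left_iff]
  split_ifs with h
  · obtain ⟨b, hb, hd⟩ := exists_mem_Bq_dvd_sub hq r
    have hbA : b ∈ Aq q := ⟨hb, EuclideanDomain.gcd_isUnit_iff.2 ((coprime_iff b hd).2 h)⟩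
    rw [Finset.sum_eq_single ⟨b, hbA⟩, if_pos hd]
    · intro n _ hn
      refine if_neg fun hnd => hn (Subtype.ext (eq_of_mem_Bq_of_dvd_sub hq n.2.1 hb ?_))
      simpa using dvd_sub hnd hd
    · simp
  · refine Finset.sum_eq_zero fun n _ => if_neg fun hnd => h ?_
    exact (coprime_iff n hnd).1 (EuclideanDomain.gcd_isUnit_iff.1 n.2.2)

theorem coprime_indicator_identity (q : GaussianInt) (hq : q ≠ 0) (r : GaussianInt) :
    (if IsUnit (EuclideanDomain.gcd (star r) q) then (1 : ℂ) else 0)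
      = (1 / ((Zsqrtd.norm q : ℤ) : ℂ)) *
        ∑' k : Bq q,
          e2 (cip (toComplex (-r)) (toComplex (k : GaussianInt) / toComplex q)) *
            gtau (star q) (k : GaussianInt) := by
  have hq' : star q ≠ 0 := by simpa using hq
  have := finite_Bq hq
  have : Finite (Aq (star q)) :=
    have := finite_Bq hq'
    Finite.Set.subset (Bq (star q)) fun _ h => h.1
  have := Fintype.ofFinite (Bq q)
  have := Fintype.ofFinite (Aq (star q))
  have hN : ((Zsqrtd.norm q : ℤ) : ℂ) ≠ 0 := by exact_mod_cast (norm_pos.2 hq).ne'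
  have dvd_star_iff : ∀ x : GaussianInt, q ∣ star x ↔ star q ∣ x := fun x => by
    constructor <;> intro h <;> simpa [starRingEnd_apply] using map_dvd (starRingEnd GaussianInt) h
  have inner_sum : ∀ n : Aq (star q),
      ∑ k : Bq q, e2 (cip (toComplex (-r)) (toComplex (k : GaussianInt) / toComplex q)) *
        e2 (cip (toComplex (k : GaussianInt)) (toComplex (n : GaussianInt) / toComplex (star q)))
      = if star q ∣ (n : GaussianInt) - r then ((Zsqrtd.norm q : ℤ) : ℂ) else 0 := fun n => by
    simp_rw [e2_cip_mul_e2_cip_star, sum_Bq_e2_re_div hq, dvd_star_iff]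
  rw [tsum_fintype]
  simp_rw [gtau, tsum_fintype, Finset.mul_sum (Finset.univ : Finset (Aq (star q)))]
  rw [Finset.sum_comm, Finset.sum_congr rfl fun n _ => inner_sum n,
    sum_Aq_ite_dvd_sub hq']
  simp only [EuclideanDomain.gcd_isUnit_iff, isCoprime_star_left_iff]
  split_ifs
  · rw [one_div_mul_cancel hN]
  · rw [mul_zero]

end
end
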